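/- arXiv:1207.0672 — 3 statements merged into one kernel-verified Lean document; each statement's English description precedes it below -/
import Mathlib

section
/- For every integer k ≥ 2, any 12^(2^(k-1)+2^(k-2)-2)-fold covering of any subset of ℝ³ with a finite number of translates of a given octant can be decomposed into k coverings. Precisely: let I be a finite index set, a : I → ℝ³, and X ⊆ ℝ³; if every point of X belongs to O(a i) for at least 12^(2^(k-1)+2^(k-2)-2) indices i ∈ I, then there exists f : I → Fin k such that for every color j and every x ∈ X there is an index i with f i = j and x ∈ O(a i). -/
/-- The octant with apex `a`: all points with every coordinate at most
the corresponding coordinate of `a`. -/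
def Octant (a : Fin 3 → ℝ) : Set (Fin 3 → ℝ) :=
  {x | x 0 ≤ a 0 ∧ x 1 ≤ a 1 ∧ x 2 ≤ a 2}

namespace OctP
open Classical

section Plane
variable {I : Type}

def Good (x y : I → ℤ) (P : Finset I) (K : Set (I → Bool)) (a b : ℤ) : Prop :=
  ∀ c ∈ K, ∃ u ∈ P, ∃ v ∈ P, a ≤ x u ∧ b ≤ y u ∧ a ≤ x v ∧ b ≤ y v ∧ c u ≠ c v

theorem Good.swap {x y : I → ℤ} {P : Finset I} {K : Set (I → Bool)} {a b : ℤ}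
    (h : Good x y P K a b) : Good y x P K b a := by
  intro c hc
  obtain ⟨u, hu, v, hv, h1, h2, h3, h4, h5⟩ := h c hc
  exact ⟨u, hu, v, hv, h2, h1, h4, h3, h5⟩

theorem Good.mono {x y : I → ℤ} {P P' : Finset I} {K K' : Set (I → Bool)} {a b a' b' : ℤ}
    (h : Good x y P K a b) (hP : P ⊆ P') (hK : K' ⊆ K) (ha : a' ≤ a) (hb : b' ≤ b) :
    Good x y P' K' a' b' := by
  intro c hc
  obtain ⟨u, hu, v, hv, h1, h2, h3, h4, h5⟩ := h c (hK hc)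
  exact ⟨u, hP hu, v, hP hv, by omega, by omega, by omega, by omega, h5⟩

structure St (x y : I → ℤ) (P F C : Finset I) (κ : I → Bool) (K : Set (I → Bool)) : Prop where
  hF : F ⊆ P
  hC : C ⊆ P
  disj : ∀ i ∈ F, i ∉ C
  s1 : ∀ g : I → Bool, ∃ c ∈ K, ∀ i, (i ∈ F ∨ i ∉ P) → c i = g i
  s2 : ∀ c ∈ K, ∀ v ∈ C, c v = κ v
  s3 : ∀ p ∈ P, p ∉ F → p ∉ C → Good x y P K (x p) (y p)
  s4 : ∀ f ∈ F, ∀ q ∈ P, x f ≤ x q → y f ≤ y q → q = f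
  pc1 : ∀ u ∈ C, ∀ v ∈ C, x u < x v → y v < y u → Good x y P K (x u) (y v)
  pc2 : ∀ u ∈ C, ∀ v ∈ C, x u < x v → y u < y v → Good x y P K (x u) (y u) ∨
    ∃ f ∈ F, x u < x f ∧ y u < y f ∧ (x f ≤ x v ∨ y f ≤ y v)

theorem St.swap {x y : I → ℤ} {P F C : Finset I} {κ : I → Bool} {K : Set (I → Bool)}
    (h : St x y P F C κ K) : St y x P F C κ K where
  hF := h.hF
  hC := h.hC
  disj := h.disj
  s1 := h.s1
  s2 := h.s2
  s3 := fun p hp h1 h2 => (h.s3 p hp h1 h2).swap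
  s4 := fun f hf q hq h1 h2 => h.s4 f hf q hq h2 h1
  pc1 := fun u hu v hv h1 h2 => (h.pc1 v hv u hu h2 h1).swap
  pc2 := by
    intro u hu v hv h1 h2
    rcases h.pc2 u hu v hv h2 h1 with h3 | ⟨f, hf, h3, h4, h5⟩
    · exact Or.inl h3.swap
    · exact Or.inr ⟨f, hf, h4, h3, h5.symm⟩

theorem St.opp {x y : I → ℤ} {P F C : Finset I} {κ : I → Bool} {K : Set (I → Bool)}
    (h : St x y P F C κ K) {u v : I} (hu : u ∈ C) (hv : v ∈ C) (hn : κ u ≠ κ v)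
    {a b : ℤ} (h1 : a ≤ x u) (h2 : b ≤ y u) (h3 : a ≤ x v) (h4 : b ≤ y v) :
    Good x y P K a b := by
  intro c hc
  refine ⟨u, h.hC hu, v, h.hC hv, h1, h2, h3, h4, ?_⟩
  rw [h.s2 c hc u hu, h.s2 c hc v hv]
  exact hn

theorem St.lcol {x y : I → ℤ} {P F C : Finset I} {κ : I → Bool} {K : Set (I → Bool)}
    (h : St x y P F C κ K) (f : I) :
    ∃ α : Bool, ∀ u ∈ C, x u < x f → y f < y u → κ u = α → Good x y P K (x u) (y f) := by
  by_cases H : ∃ u ∈ C, x u < x f ∧ y f < y u ∧ ¬ Good x y P K (x u) (y f)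
  · obtain ⟨u, hu, h1, h2, h3⟩ := H
    refine ⟨!κ u, fun v hv h4 h5 h6 => ?_⟩
    have hne : κ u ≠ κ v := by rw [h6]; cases κ u <;> decide
    rcases le_total (x u) (x v) with h7 | h7
    · exact absurd (h.opp hu hv hne (le_refl _) h2.le h7 h5.le) h3
    · exact h.opp hu hv hne h7 h2.le (le_refl _) h5.le
  · push Not at H
    exact ⟨true, fun u hu h1 h2 _ => H u hu h1 h2⟩

/-- coloring a set of free points -/
theorem St.color {x y : I → ℤ} {P F C : Finset I} {κ : I → Bool} {K : Set (I → Bool)}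
    (h : St x y P F C κ K) (T : Finset I) (hT : T ⊆ F) (κ' : I → Bool)
    (hκ : ∀ v ∈ C, κ' v = κ v)
    (H : ∀ K' : Set (I → Bool), K' ⊆ K →
      (∀ u ∈ C ∪ T, ∀ v ∈ C ∪ T, κ' u ≠ κ' v → ∀ a b : ℤ, a ≤ x u → b ≤ y u → a ≤ x v →
        b ≤ y v → Good x y P K' a b) →
      (∀ u ∈ C ∪ T, ∀ v ∈ C ∪ T, x u < x v → y v < y u → Good x y P K' (x u) (y v)) ∧
      (∀ u ∈ C ∪ T, ∀ v ∈ C ∪ T, x u < x v → y u < y v → Good x y P K' (x u) (y u) ∨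
        ∃ f ∈ F \ T, x u < x f ∧ y u < y f ∧ (x f ≤ x v ∨ y f ≤ y v))) :
    ∃ K', K' ⊆ K ∧ St x y P (F \ T) (C ∪ T) κ' K' := by
  let K' : Set (I → Bool) := {c | c ∈ K ∧ ∀ i ∈ T, c i = κ' i}
  have hK : K' ⊆ K := fun c hc => hc.1
  have s2 : ∀ c ∈ K', ∀ v ∈ C ∪ T, c v = κ' v := by
    intro c hc v hv
    rcases Finset.mem_union.1 hv with h1 | h1
    · rw [hκ v h1]; exact h.s2 c hc.1 v h1
    · exact hc.2 v h1
  have hC' : C ∪ T ⊆ P := Finset.union_subset h.hC (hT.trans h.hF)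
  obtain ⟨H1, H2⟩ := H K' hK (by
    intro u hu v hv hn a b h1 h2 h3 h4 c hc
    refine ⟨u, hC' hu, v, hC' hv, h1, h2, h3, h4, ?_⟩
    rw [s2 c hc u hu, s2 c hc v hv]
    exact hn)
  refine ⟨K', hK, ?_, hC', ?_, ?_, s2, ?_, ?_, H1, H2⟩
  · exact Finset.sdiff_subset.trans h.hF
  · intro i hi hi'
    rw [Finset.mem_sdiff] at hi
    rcases Finset.mem_union.1 hi' with h1 | h1
    · exact h.disj i hi.1 h1
    · exact hi.2 h1
  · intro g
    obtain ⟨c, hc, hcg⟩ := h.s1 (fun i => if i ∈ T then κ' i else g i)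
    refine ⟨c, ⟨hc, fun i hi => ?_⟩, fun i hi => ?_⟩
    · rw [hcg i (Or.inl (hT hi))]; simp [hi]
    · have hiT : i ∉ T := by
        rcases hi with h1 | h1
        · exact (Finset.mem_sdiff.1 h1).2
        · exact fun h2 => h1 (h.hF (hT h2))
      rw [hcg i (hi.imp (fun h1 => (Finset.mem_sdiff.1 h1).1) id)]
      simp [hiT]
  · intro p hp h1 h2
    simp only [Finset.mem_sdiff, Finset.mem_union, not_and, not_not, not_or] at h1 h2
    have hpF : p ∉ F := fun h3 => h2.2 (h1 h3)
    exact (h.s3 p hp hpF h2.1).mono subset_rfl hK le_rfl le_rfl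
  · intro f hf
    exact h.s4 f (Finset.mem_sdiff.1 hf).1

/-- arrival of a point -/
theorem St.arrive {x y : I → ℤ} (hx : Function.Injective x) (hy : Function.Injective y)
    {P F C : Finset I} {κ : I → Bool} {K : Set (I → Bool)}
    (h : St x y P F C κ K) (p : I) (hp : p ∉ P)
    (hmax : ∀ q ∈ P, x p ≤ x q → y p ≤ y q → False) :
    ∃ F' C' κ' K', K' ⊆ K ∧ St x y (insert p P) F' C' κ' K' := by
  let D : Finset I := F.filter (fun f => x f < x p ∧ y f < y p)
  let K' : Set (I → Bool) := {c | c ∈ K ∧ ∀ f ∈ D, c f ≠ c p}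
  have hK : K' ⊆ K := fun c hc => hc.1
  have hPP : P ⊆ insert p P := Finset.subset_insert _ _
  have hD : ∀ f ∈ D, ∀ a b, a ≤ x f → b ≤ y f → Good x y (insert p P) K' a b := by
    intro f hf a b h1 h2 c hc
    have hf' := Finset.mem_filter.1 hf
    exact ⟨f, hPP (h.hF hf'.1), p, Finset.mem_insert_self _ _, h1, h2, by omega, by omega,
      hc.2 f hf⟩
  refine ⟨insert p (F \ D), C, κ, K', hK, ?_, h.hC.trans hPP, ?_, ?_, ?_, ?_, ?_, ?_, ?_⟩
  · intro i hi
    rcases Finset.mem_insert.1 hi with rfl | h1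
    · exact Finset.mem_insert_self _ _
    · exact hPP (h.hF (Finset.mem_sdiff.1 h1).1)
  · intro i hi
    rcases Finset.mem_insert.1 hi with rfl | h1
    · exact fun h2 => hp (h.hC h2)
    · exact h.disj i (Finset.mem_sdiff.1 h1).1
  · intro g
    obtain ⟨c, hc, hcg⟩ := h.s1 (fun i => if i ∈ D then !g p else g i)
    have hpD : p ∉ D := fun h1 => hp (h.hF (Finset.mem_filter.1 h1).1)
    have hcp : c p = g p := by rw [hcg p (Or.inr hp)]; simp [hpD]
    refine ⟨c, ⟨hc, fun f hf => ?_⟩, fun i hi => ?_⟩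
    · rw [hcp, hcg f (Or.inl (Finset.mem_filter.1 hf).1)]
      simp [hf]
    · rcases hi with h1 | h1
      · rcases Finset.mem_insert.1 h1 with rfl | h1
        · exact hcp
        · rw [Finset.mem_sdiff] at h1
          rw [hcg i (Or.inl h1.1)]; simp [h1.2]
      · have hi : i ∉ P := fun h2 => h1 (hPP h2)
        have hiD : i ∉ D := fun h1 => hi (h.hF (Finset.mem_filter.1 h1).1)
        rw [hcg i (Or.inr hi)]; simp [hiD]
  · exact fun c hc => h.s2 c hc.1
  · intro q hq h1 h2
    rw [Finset.mem_insert, not_or] at h1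
    have hqP : q ∈ P := (Finset.mem_insert.1 hq).resolve_left h1.1
    by_cases hqF : q ∈ F
    · have hqD : q ∈ D := by
        by_contra h3
        exact h1.2 (Finset.mem_sdiff.2 ⟨hqF, h3⟩)
      exact hD q hqD _ _ le_rfl le_rfl
    · exact (h.s3 q hqP hqF h2).mono hPP hK le_rfl le_rfl
  · intro f hf q hq h1 h2
    rcases Finset.mem_insert.1 hf with rfl | hf
    · rcases Finset.mem_insert.1 hq with rfl | hq
      · rfl
      · exact (hmax q hq h1 h2).elim
    · rw [Finset.mem_sdiff] at hf
      rcases Finset.mem_insert.1 hq with rfl | hq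
      · exfalso
        have hne : f ≠ q := fun h3 => hp (h3 ▸ h.hF hf.1)
        have h3 : x f ≠ x q := fun h3 => hne (hx h3)
        have h4 : y f ≠ y q := fun h3 => hne (hy h3)
        exact hf.2 (Finset.mem_filter.2 ⟨hf.1, by omega, by omega⟩)
      · exact h.s4 f hf.1 q hq h1 h2
  · intro u hu v hv h1 h2
    exact (h.pc1 u hu v hv h1 h2).mono hPP hK le_rfl le_rfl
  · intro u hu v hv h1 h2
    rcases h.pc2 u hu v hv h1 h2 with h3 | ⟨f, hf, h3, h4, h5⟩
    · exact Or.inl (h3.mono hPP hK le_rfl le_rfl)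
    · by_cases hfD : f ∈ D
      · exact Or.inl (hD f hfD _ _ h3.le h4.le)
      · exact Or.inr ⟨f, Finset.mem_insert_of_mem (Finset.mem_sdiff.2 ⟨hf, hfD⟩), h3, h4, h5⟩

theorem St.r1 {x y : I → ℤ} (hx : Function.Injective x) (hy : Function.Injective y)
    {P F C : Finset I} {κ : I → Bool} {K : Set (I → Bool)}
    (h : St x y P F C κ K) {f1 f2 f3 f4 f5 : I} (m1 : f1 ∈ F) (m2 : f2 ∈ F) (m3 : f3 ∈ F)
    (m4 : f4 ∈ F) (m5 : f5 ∈ F) (x12 : x f1 < x f2) (x23 : x f2 < x f3) (x34 : x f3 < x f4)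
    (x45 : x f4 < x f5) (hW : ∀ c ∈ C, x c < x f1 ∨ y c < y f5) :
    ∃ F' C' κ' K', F' ⊂ F ∧ K' ⊆ K ∧ St x y P F' C' κ' K' := by
  have dec : ∀ f ∈ F, ∀ g ∈ F, x f < x g → y g < y f := by
    intro f hf g hg hfg
    by_contra h1
    have := h.s4 f hf g (h.hF hg) hfg.le (by omega)
    subst this
    omega
  have y12 := dec _ m1 _ m2 x12
  have y23 := dec _ m2 _ m3 x23
  have y34 := dec _ m3 _ m4 x34
  have y45 := dec _ m4 _ m5 x45
  -- a colored point is not above a free one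
  have nab : ∀ f ∈ F, ∀ v ∈ C, x f ≤ x v → y f ≤ y v → False := by
    intro f hf v hv h1 h2
    have := h.s4 f hf v (h.hC hv) h1 h2
    subst this
    exact h.disj _ hf hv
  obtain ⟨α, hα⟩ := h.lcol f2
  obtain ⟨β, hβ0⟩ := h.swap.lcol f4
  have hβ : ∀ u ∈ C, x f4 < x u → y u < y f4 → κ u = β → Good x y P K (x f4) (y u) :=
    fun u hu h1 h2 h3 => (hβ0 u hu h2 h1 h3).swap
  let T : Finset I := {f2, f4} ∪ (if α = β then {f3} else ∅)
  let κ' : I → Bool := fun i => if i = f2 then α else if i = f4 then β else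
    if i = f3 then !α else κ i
  have n23 : f2 ≠ f3 := fun e => by rw [e] at x23; omega
  have n34 : f3 ≠ f4 := fun e => by rw [e] at x34; omega
  have n24 : f2 ≠ f4 := fun e => by rw [e] at x23; omega
  have k2 : κ' f2 = α := by simp [κ']
  have k4 : κ' f4 = β := by simp [κ', n24.symm]
  have k3 : κ' f3 = !α := by simp [κ', n23.symm, n34]
  have kC : ∀ v ∈ C, κ' v = κ v := by
    intro v hv
    have h2 : v ≠ f2 := fun e => h.disj f2 m2 (e ▸ hv)
    have h3 : v ≠ f3 := fun e => h.disj f3 m3 (e ▸ hv)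
    have h4 : v ≠ f4 := fun e => h.disj f4 m4 (e ▸ hv)
    simp [κ', h2, h3, h4]
  have memT : ∀ i, i ∈ T ↔ i = f2 ∨ i = f4 ∨ (α = β ∧ i = f3) := by
    intro i
    by_cases e : α = β <;> simp [T, e]
  have hT : T ⊆ F := by
    intro i hi
    rcases (memT i).1 hi with rfl | rfl | ⟨_, rfl⟩ <;> assumption
  have f2T : f2 ∈ T := (memT _).2 (Or.inl rfl)
  have f4T : f4 ∈ T := (memT _).2 (Or.inr (Or.inl rfl))
  have f1T : f1 ∉ T := by
    rw [memT]
    rintro (e | e | ⟨_, e⟩) <;> rw [e] at x12 <;> omega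
  have f5T : f5 ∉ T := by
    rw [memT]
    rintro (e | e | ⟨_, e⟩) <;> rw [e] at x45 <;> omega
  obtain ⟨K', hK, hst⟩ := h.color T hT κ' kC (by
    intro K' hK opp
    have mono : ∀ {a b a' b' : ℤ}, Good x y P K a b → a' ≤ a → b' ≤ b → Good x y P K' a' b' :=
      fun h1 h2 h3 => h1.mono subset_rfl hK h2 h3
    have inT : ∀ {i}, i ∈ T → i ∈ C ∪ T := fun h => Finset.mem_union_right _ h
    have inC : ∀ {i}, i ∈ C → i ∈ C ∪ T := fun h => Finset.mem_union_left _ h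
    have G23 : α = β → ∀ a b, a ≤ x f2 → b ≤ y f3 → Good x y P K' a b := by
      intro e a b h1 h2
      refine opp f2 (inT f2T) f3 (inT ((memT _).2 (Or.inr (Or.inr ⟨e, rfl⟩)))) ?_ a b h1
        (by omega) (by omega) h2
      rw [k2, k3]; cases α <;> decide
    have G34 : α = β → ∀ a b, a ≤ x f3 → b ≤ y f4 → Good x y P K' a b := by
      intro e a b h1 h2
      refine opp f3 (inT ((memT _).2 (Or.inr (Or.inr ⟨e, rfl⟩)))) f4 (inT f4T) ?_ a b h1
        (by omega) (by omega) h2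
      rw [k4, k3, ← e]; cases α <;> decide
    have G1 : ∀ a b, a ≤ x f2 → b ≤ y f4 → Good x y P K' a b := by
      intro a b h1 h2
      by_cases e : α = β
      · exact G23 e a b h1 (by omega)
      · refine opp f2 (inT f2T) f4 (inT f4T) ?_ a b h1 (by omega) (by omega) h2
        rw [k2, k4]; exact e
    have A2 : ∀ u ∈ C, x u < x f2 → y f2 < y u → ∀ a b, a ≤ x u → b ≤ y f2 →
        Good x y P K' a b := by
      intro u hu h1 h2 a b h3 h4
      by_cases e : κ u = α
      · exact mono (hα u hu h1 h2 e) h3 h4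
      · exact opp u (inC hu) f2 (inT f2T) (by rw [kC u hu, k2]; exact e) a b h3 (by omega)
          (by omega) h4
    have A4 : ∀ u ∈ C, x f4 < x u → y u < y f4 → ∀ a b, a ≤ x f4 → b ≤ y u →
        Good x y P K' a b := by
      intro u hu h1 h2 a b h3 h4
      by_cases e : κ u = β
      · exact mono (hβ u hu h1 h2 e) h3 h4
      · exact opp u (inC hu) f4 (inT f4T) (by rw [kC u hu, k4]; exact e) a b (by omega) h4
          h3 (by omega)
    constructor
    · intro u hu v hv h1 h2
      rcases Finset.mem_union.1 hu with hu' | hu'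
      · rcases Finset.mem_union.1 hv with hv' | hv'
        · exact mono (h.pc1 u hu' v hv' h1 h2) le_rfl le_rfl
        · have := hW u hu'
          rcases (memT v).1 hv' with rfl | rfl | ⟨e, rfl⟩
          · exact A2 u hu' h1 h2 _ _ le_rfl le_rfl
          · exact G1 _ _ (by omega) (by omega)
          · exact G23 e _ _ (by omega) (by omega)
      · rcases Finset.mem_union.1 hv with hv' | hv'
        · have := hW v hv'
          rcases (memT u).1 hu' with rfl | rfl | ⟨e, rfl⟩
          · exact G1 _ _ (by omega) (by omega)
          · exact A4 v hv' h1 h2 _ _ le_rfl le_rfl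
          · exact G34 e _ _ (by omega) (by omega)
        · rcases (memT u).1 hu' with rfl | rfl | ⟨e, rfl⟩ <;>
          rcases (memT v).1 hv' with rfl | rfl | ⟨e', rfl⟩ <;>
          first
          | omega
          | exact G1 _ _ (by omega) (by omega)
          | exact G23 ‹_› _ _ (by omega) (by omega)
          | exact G34 ‹_› _ _ (by omega) (by omega)
    · intro u hu v hv h1 h2
      rcases Finset.mem_union.1 hu with hu' | hu'
      · have hWu := hW u hu'
        rcases Finset.mem_union.1 hv with hv' | hv'
        · have hWv := hW v hv'
          rcases h.pc2 u hu' v hv' h1 h2 with h3 | ⟨f, hf, h3, h4, h5⟩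
          · exact Or.inl (mono h3 le_rfl le_rfl)
          · by_cases hfT : f ∈ T
            · left
              have := nab f hf v hv'
              have hny : y f ≠ y v := fun e => h.disj f hf (hy e ▸ hv')
              have hnx : x f ≠ x v := fun e => h.disj f hf (hx e ▸ hv')
              rcases (memT f).1 hfT with rfl | rfl | ⟨e, rfl⟩
              · by_cases h6 : y f < y v
                · exact A2 v hv' (by by_contra h7; exact this (by omega) (by omega)) h6 _ _
                    (by omega) (by omega)
                · exact G1 _ _ (by omega) (by omega)
              · by_cases h6 : x f < x v
                · exact A4 v hv' h6 (by by_contra h7; exact this (by omega) (by omega)) _ _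
                    (by omega) (by omega)
                · exact G1 _ _ (by omega) (by omega)
              · rcases hWu with h6 | h6
                · exact G23 e _ _ (by omega) (by omega)
                · exact G34 e _ _ (by omega) (by omega)
            · exact Or.inr ⟨f, Finset.mem_sdiff.2 ⟨hf, hfT⟩, h3, h4, h5⟩
        · rcases (memT v).1 hv' with rfl | rfl | ⟨e, rfl⟩
          · by_cases h6 : y u < y f5
            · exact Or.inl (G1 _ _ (by omega) (by omega))
            · exact Or.inr ⟨f1, Finset.mem_sdiff.2 ⟨m1, f1T⟩, by omega, by omega, by omega⟩
          · by_cases h6 : x u < x f1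
            · exact Or.inl (G1 _ _ (by omega) (by omega))
            · exact Or.inr ⟨f5, Finset.mem_sdiff.2 ⟨m5, f5T⟩, by omega, by omega, by omega⟩
          · left
            rcases hWu with h6 | h6
            · exact G23 e _ _ (by omega) (by omega)
            · exact G34 e _ _ (by omega) (by omega)
      · exfalso
        have := h.s4 u (hT hu') v (Finset.union_subset h.hC (hT.trans h.hF) hv) h1.le h2.le
        subst this
        omega)
  refine ⟨F \ T, C ∪ T, κ', K', ?_, hK, hst⟩
  refine Finset.ssubset_iff_subset_ne.2 ⟨Finset.sdiff_subset, fun e => ?_⟩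
  have : f2 ∈ F \ T := by rw [e]; exact m2
  exact (Finset.mem_sdiff.1 this).2 f2T

theorem St.r1' {x y : I → ℤ} (hx : Function.Injective x) (hy : Function.Injective y)
    {P F C : Finset I} {κ : I → Bool} {K : Set (I → Bool)}
    (h : St x y P F C κ K) {f1 f2 f3 c : I} (m1 : f1 ∈ F) (m2 : f2 ∈ F) (m3 : f3 ∈ F)
    (mc : c ∈ C) (x12 : x f1 < x f2) (x23 : x f2 < x f3) (x34 : x f3 < x c)
    (hW : ∀ d ∈ C, x d < x f1 ∨ y d < y c ∨ d = c) :
    ∃ F' C' κ' K', F' ⊂ F ∧ K' ⊆ K ∧ St x y P F' C' κ' K' := by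
  have dec : ∀ f ∈ F, ∀ g ∈ P, x f < x g → y g < y f := by
    intro f hf g hg hfg
    by_contra h1
    have := h.s4 f hf g hg hfg.le (by omega)
    subst this
    omega
  have y12 := dec _ m1 _ (h.hF m2) x12
  have y23 := dec _ m2 _ (h.hF m3) x23
  have y34 := dec _ m3 _ (h.hC mc) x34
  have nab : ∀ f ∈ F, ∀ v ∈ C, x f ≤ x v → y f ≤ y v → False := by
    intro f hf v hv h1 h2
    have := h.s4 f hf v (h.hC hv) h1 h2
    subst this
    exact h.disj _ hf hv
  obtain ⟨α, hα⟩ := h.lcol f2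
  let T : Finset I := {f2} ∪ (if α = κ c then {f3} else ∅)
  let κ' : I → Bool := fun i => if i = f2 then α else if i = f3 then !α else κ i
  have n23 : f2 ≠ f3 := fun e => by rw [e] at x23; omega
  have k2 : κ' f2 = α := by simp [κ']
  have k3 : κ' f3 = !α := by simp [κ', n23.symm]
  have kC : ∀ v ∈ C, κ' v = κ v := by
    intro v hv
    have h2 : v ≠ f2 := fun e => h.disj f2 m2 (e ▸ hv)
    have h3 : v ≠ f3 := fun e => h.disj f3 m3 (e ▸ hv)
    simp [κ', h2, h3]
  have memT : ∀ i, i ∈ T ↔ i = f2 ∨ (α = κ c ∧ i = f3) := by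
    intro i
    by_cases e : α = κ c <;> simp [T, e]
  have hT : T ⊆ F := by
    intro i hi
    rcases (memT i).1 hi with rfl | ⟨_, rfl⟩ <;> assumption
  have f2T : f2 ∈ T := (memT _).2 (Or.inl rfl)
  have f1T : f1 ∉ T := by
    rw [memT]
    rintro (e | ⟨_, e⟩) <;> rw [e] at x12 <;> omega
  obtain ⟨K', hK, hst⟩ := h.color T hT κ' kC (by
    intro K' hK opp
    have mono : ∀ {a b a' b' : ℤ}, Good x y P K a b → a' ≤ a → b' ≤ b → Good x y P K' a' b' :=
      fun h1 h2 h3 => h1.mono subset_rfl hK h2 h3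
    have inT : ∀ {i}, i ∈ T → i ∈ C ∪ T := fun h => Finset.mem_union_right _ h
    have inC : ∀ {i}, i ∈ C → i ∈ C ∪ T := fun h => Finset.mem_union_left _ h
    have G23 : α = κ c → ∀ a b, a ≤ x f2 → b ≤ y f3 → Good x y P K' a b := by
      intro e a b h1 h2
      refine opp f2 (inT f2T) f3 (inT ((memT _).2 (Or.inr ⟨e, rfl⟩))) ?_ a b h1
        (by omega) (by omega) h2
      rw [k2, k3]; cases α <;> decide
    have G34 : α = κ c → ∀ a b, a ≤ x f3 → b ≤ y c → Good x y P K' a b := by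
      intro e a b h1 h2
      refine opp f3 (inT ((memT _).2 (Or.inr ⟨e, rfl⟩))) c (inC mc) ?_ a b h1
        (by omega) (by omega) h2
      rw [kC c mc, k3, ← e]; cases α <;> decide
    have G1 : ∀ a b, a ≤ x f2 → b ≤ y c → Good x y P K' a b := by
      intro a b h1 h2
      by_cases e : α = κ c
      · exact G23 e a b h1 (by omega)
      · refine opp f2 (inT f2T) c (inC mc) ?_ a b h1 (by omega) (by omega) h2
        rw [k2, kC c mc]; exact e
    have A2 : ∀ u ∈ C, x u < x f2 → y f2 < y u → ∀ a b, a ≤ x u → b ≤ y f2 →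
        Good x y P K' a b := by
      intro u hu h1 h2 a b h3 h4
      by_cases e : κ u = α
      · exact mono (hα u hu h1 h2 e) h3 h4
      · exact opp u (inC hu) f2 (inT f2T) (by rw [kC u hu, k2]; exact e) a b h3 (by omega)
          (by omega) h4
    constructor
    · intro u hu v hv h1 h2
      rcases Finset.mem_union.1 hu with hu' | hu'
      · rcases Finset.mem_union.1 hv with hv' | hv'
        · exact mono (h.pc1 u hu' v hv' h1 h2) le_rfl le_rfl
        · have := hW u hu'
          rcases (memT v).1 hv' with rfl | ⟨e, rfl⟩
          · exact A2 u hu' h1 h2 _ _ le_rfl le_rfl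
          · rcases this with h3 | h3 | rfl
            · exact G23 e _ _ (by omega) (by omega)
            · omega
            · omega
      · rcases Finset.mem_union.1 hv with hv' | hv'
        · have h3 : y v ≤ y c := by
            rcases hW v hv' with h3 | h3 | rfl
            · rcases (memT u).1 hu' with rfl | ⟨e, rfl⟩ <;> omega
            · omega
            · omega
          rcases (memT u).1 hu' with rfl | ⟨e, rfl⟩
          · exact G1 _ _ (by omega) (by omega)
          · exact G34 e _ _ (by omega) (by omega)
        · rcases (memT u).1 hu' with rfl | ⟨e, rfl⟩ <;>
          rcases (memT v).1 hv' with rfl | ⟨e', rfl⟩ <;>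
          first
          | omega
          | exact G23 ‹_› _ _ (by omega) (by omega)
    · intro u hu v hv h1 h2
      rcases Finset.mem_union.1 hu with hu' | hu'
      · have hWu := hW u hu'
        rcases Finset.mem_union.1 hv with hv' | hv'
        · have hWv := hW v hv'
          rcases h.pc2 u hu' v hv' h1 h2 with h3 | ⟨f, hf, h3, h4, h5⟩
          · exact Or.inl (mono h3 le_rfl le_rfl)
          · by_cases hfT : f ∈ T
            · left
              have := nab f hf v hv'
              have hny : y f ≠ y v := fun e => h.disj f hf (hy e ▸ hv')
              have hnx : x f ≠ x v := fun e => h.disj f hf (hx e ▸ hv')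
              rcases (memT f).1 hfT with rfl | ⟨e, rfl⟩
              · by_cases h6 : y f < y v
                · exact A2 v hv' (by by_contra h7; exact this (by omega) (by omega)) h6 _ _
                    (by omega) (by omega)
                · rcases hWv with h7 | h7 | rfl
                  · omega
                  · exact G1 _ _ (by omega) (by omega)
                  · exact G1 _ _ (by omega) (by omega)
              · rcases hWu with h6 | h6 | rfl
                · exact G23 e _ _ (by omega) (by omega)
                · exact G34 e _ _ (by omega) (by omega)
                · omega
            · exact Or.inr ⟨f, Finset.mem_sdiff.2 ⟨hf, hfT⟩, h3, h4, h5⟩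
        · rcases hWu with h6 | h6 | rfl
          · rcases (memT v).1 hv' with rfl | ⟨e, rfl⟩
            · exact Or.inr ⟨f1, Finset.mem_sdiff.2 ⟨m1, f1T⟩, by omega, by omega, by omega⟩
            · exact Or.inl (G23 e _ _ (by omega) (by omega))
          · rcases (memT v).1 hv' with rfl | ⟨e, rfl⟩
            · exact Or.inl (G1 _ _ (by omega) (by omega))
            · exact Or.inl (G34 e _ _ (by omega) (by omega))
          · rcases (memT v).1 hv' with rfl | ⟨e, rfl⟩ <;> omega
      · exfalso
        have := h.s4 u (hT hu') v (Finset.union_subset h.hC (hT.trans h.hF) hv) h1.le h2.le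
        subst this
        omega)
  refine ⟨F \ T, C ∪ T, κ', K', ?_, hK, hst⟩
  refine Finset.ssubset_iff_subset_ne.2 ⟨Finset.sdiff_subset, fun e => ?_⟩
  have : f2 ∈ F \ T := by rw [e]; exact m2
  exact (Finset.mem_sdiff.1 this).2 f2T

theorem extract (x : I → ℤ) (hx : Function.Injective x) (S : Finset I) (n : ℕ)
    (hn : n ≤ S.card) : ∃ e : Fin n → I, (∀ i, e i ∈ S) ∧ ∀ i j, i < j → x (e i) < x (e j) := by
  have h1 : n ≤ (S.image x).card := by rwa [Finset.card_image_of_injective _ hx]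
  obtain ⟨t, ht, htc⟩ := Finset.exists_subset_card_eq h1
  have h2 : ∀ i : Fin n, ∃ p ∈ S, x p = t.orderEmbOfFin htc i := by
    intro i
    have := ht (Finset.orderEmbOfFin_mem t htc i)
    simpa using this
  choose e he1 he2 using h2
  refine ⟨e, he1, fun i j hij => ?_⟩
  rw [he2, he2]
  exact (t.orderEmbOfFin htc).strictMono hij

theorem St.r1S {x y : I → ℤ} (hx : Function.Injective x) (hy : Function.Injective y)
    {P F C : Finset I} {κ : I → Bool} {K : Set (I → Bool)}
    (h : St x y P F C κ K) (S : Finset I) (hS : S ⊆ F) (h5 : 5 ≤ S.card)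
    (hW : ∀ c ∈ C, ∀ f ∈ S, ∀ g ∈ S, x c < x f ∨ y c < y g) :
    ∃ F' C' κ' K', F' ⊂ F ∧ K' ⊆ K ∧ St x y P F' C' κ' K' := by
  obtain ⟨e, he, hlt⟩ := extract x hx S 5 h5
  exact h.r1 hx hy (hS (he 0)) (hS (he 1)) (hS (he 2)) (hS (he 3)) (hS (he 4))
    (hlt 0 1 (by decide)) (hlt 1 2 (by decide)) (hlt 2 3 (by decide)) (hlt 3 4 (by decide))
    (fun c hc => hW c hc _ (he 0) _ (he 4))

theorem St.r1S' {x y : I → ℤ} (hx : Function.Injective x) (hy : Function.Injective y)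
    {P F C : Finset I} {κ : I → Bool} {K : Set (I → Bool)}
    (h : St x y P F C κ K) (S : Finset I) (hS : S ⊆ F) (h5 : 3 ≤ S.card) (c : I) (hc : c ∈ C)
    (hSc : ∀ f ∈ S, x f < x c)
    (hW : ∀ d ∈ C, ∀ f ∈ S, x d < x f ∨ y d < y c ∨ d = c) :
    ∃ F' C' κ' K', F' ⊂ F ∧ K' ⊆ K ∧ St x y P F' C' κ' K' := by
  obtain ⟨e, he, hlt⟩ := extract x hx S 3 h5
  exact h.r1' hx hy (hS (he 0)) (hS (he 1)) (hS (he 2)) hc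
    (hlt 0 1 (by decide)) (hlt 1 2 (by decide)) (hSc _ (he 2))
    (fun d hd => hW d hd _ (he 0))

theorem St.reduce {x y : I → ℤ} (hx : Function.Injective x) (hy : Function.Injective y)
    {P F C : Finset I} {κ : I → Bool} {K : Set (I → Bool)}
    (h : St x y P F C κ K) (a b : ℤ) (hng : ¬ Good x y P K a b)
    (h12 : 12 ≤ (P.filter (fun p => a ≤ x p ∧ b ≤ y p)).card) :
    ∃ F' C' κ' K', F' ⊂ F ∧ K' ⊆ K ∧ St x y P F' C' κ' K' := by
  have ng : ∀ a' b', a ≤ a' → b ≤ b' → ¬ Good x y P K a' b' :=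
    fun a' b' h1 h2 h3 => hng (h3.mono subset_rfl subset_rfl h1 h2)
  obtain ⟨FW, hFW⟩ : ∃ S, S = F.filter (fun p => a ≤ x p ∧ b ≤ y p) := ⟨_, rfl⟩
  obtain ⟨CW, hCW⟩ : ∃ S, S = C.filter (fun p => a ≤ x p ∧ b ≤ y p) := ⟨_, rfl⟩
  have memF : ∀ i, i ∈ FW ↔ i ∈ F ∧ a ≤ x i ∧ b ≤ y i := by simp [hFW]
  have memC : ∀ i, i ∈ CW ↔ i ∈ C ∧ a ≤ x i ∧ b ≤ y i := by simp [hCW]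
  have hsub : P.filter (fun p => a ≤ x p ∧ b ≤ y p) ⊆ FW ∪ CW := by
    intro p hp
    rw [Finset.mem_filter] at hp
    rw [Finset.mem_union, memF, memC]
    by_contra h1
    refine ng _ _ hp.2.1 hp.2.2 (h.s3 p hp.1 ?_ ?_) <;> tauto
  have hcard : 12 ≤ FW.card + CW.card :=
    (h12.trans (Finset.card_le_card hsub)).trans (Finset.card_union_le _ _)
  by_cases hCe : CW = ∅
  · refine h.r1S hx hy FW (fun i hi => ((memF i).1 hi).1) (by simp [hCe] at hcard; omega) ?_
    intro c hc f hf g hg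
    by_contra h1
    have := (memF f).1 hf
    have := (memF g).1 hg
    have : c ∈ CW := (memC c).2 ⟨hc, by omega, by omega⟩
    simp [hCe] at this
  obtain ⟨c, hc, hcm⟩ := Finset.exists_max_image CW x (Finset.nonempty_iff_ne_empty.2 hCe)
  have hc' := (memC c).1 hc
  -- chain
  have chain : ∀ d ∈ CW, ∀ e ∈ CW, x d < x e → y d < y e := by
    intro d hd e he hlt
    have hd' := (memC d).1 hd
    have he' := (memC e).1 he
    by_contra h1
    have h2 : y d ≠ y e := fun h2 => by rw [hy h2] at hlt; omega
    exact ng _ _ hd'.2.1 he'.2.2 (h.pc1 d hd'.1 e he'.1 hlt (by omega))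
  have ymax : ∀ d ∈ CW, d ≠ c → y d < y c := by
    intro d hd hne
    have h1 : x d ≠ x c := fun h2 => hne (hx h2)
    have := hcm d hd
    exact chain d hd c hc (by omega)
  have xmax : ∀ d ∈ CW, d ≠ c → x d < x c := by
    intro d hd hne
    have h1 : x d ≠ x c := fun h2 => hne (hx h2)
    have := hcm d hd
    omega
  have nab : ∀ f ∈ FW, x f < x c → y c < y f := by
    intro f hf hlt
    by_contra h1
    have := h.s4 f ((memF f).1 hf).1 c (h.hC hc'.1) hlt.le (by omega)
    rw [this] at hlt
    omega
  have fne : ∀ f ∈ FW, x f ≠ x c ∧ y f ≠ y c := by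
    intro f hf
    have hne : f ≠ c := fun e => h.disj f ((memF f).1 hf).1 (e ▸ hc'.1)
    exact ⟨fun e => hne (hx e), fun e => hne (hy e)⟩
  -- spare injection
  have spare : ∀ d, ∃ f, d ∈ CW.erase c → f ∈ FW ∧ x d < x f ∧ y d < y f ∧
      ∀ e ∈ CW, x d < x e → ¬ (x e < x f ∧ y e < y f) := by
    intro d
    by_cases hd : d ∈ CW.erase c
    swap
    · exact ⟨d, fun h1 => absurd h1 hd⟩
    rw [Finset.mem_erase] at hd
    obtain ⟨e, he, hem⟩ := Finset.exists_min_image (CW.filter (fun e => x d < x e)) x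
      ⟨c, Finset.mem_filter.2 ⟨hc, xmax d hd.2 hd.1⟩⟩
    rw [Finset.mem_filter] at he
    have hd' := (memC d).1 hd.2
    have he' := (memC e).1 he.1
    rcases h.pc2 d hd'.1 e he'.1 he.2 (chain d hd.2 e he.1 he.2) with h1 | ⟨f, hf, h1, h2, h3⟩
    · exact absurd h1 (ng _ _ hd'.2.1 hd'.2.2)
    · refine ⟨f, fun _ => ⟨(memF f).2 ⟨hf, by omega, by omega⟩, h1, h2, ?_⟩⟩
      intro e' he1 he2 he3
      have h4 := hem e' (Finset.mem_filter.2 ⟨he1, he2⟩)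
      have h5 : y e ≤ y e' := by
        rcases h4.eq_or_lt with h5 | h5
        · rw [hx h5]
        · exact (chain e he.1 e' he1 h5).le
      omega
  choose φ hφ using spare
  obtain ⟨A, hA⟩ : ∃ S, S = FW.filter (fun f => x f < x c) := ⟨_, rfl⟩
  obtain ⟨B, hB⟩ : ∃ S, S = FW.filter (fun f => y f < y c) := ⟨_, rfl⟩
  obtain ⟨S1, hS1⟩ : ∃ S, S = FW.filter (fun f => ¬ y f < y c) := ⟨_, rfl⟩
  obtain ⟨S2, hS2⟩ : ∃ S, S = FW.filter (fun f => ¬ x f < x c) := ⟨_, rfl⟩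
  have hc1 : S1.card + B.card = FW.card := by
    rw [hS1, hB, add_comm]; exact Finset.card_filter_add_card_filter_not _
  have hc2 : S2.card + A.card = FW.card := by
    rw [hS2, hA, add_comm]; exact Finset.card_filter_add_card_filter_not _
  have hc3 : (CW.erase c).card ≤ (A ∪ B).card := by
    apply Finset.card_le_card_of_injOn φ
    · intro d hd
      obtain ⟨h1, h2, h3, h4⟩ := hφ d hd
      have hd' := Finset.mem_erase.1 hd
      have h5 := h4 c hc (xmax d hd'.2 hd'.1)
      have h6 := fne _ h1
      rw [Finset.mem_coe, Finset.mem_union, hA, hB, Finset.mem_filter, Finset.mem_filter]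
      by_cases h7 : x (φ d) < x c
      · exact Or.inl ⟨h1, h7⟩
      · exact Or.inr ⟨h1, by omega⟩
    · have key : ∀ d ∈ CW.erase c, ∀ d' ∈ CW.erase c, φ d = φ d' → ¬ x d < x d' := by
        intro d hd d' hd' he hlt
        obtain ⟨h1, h2, h3, h4⟩ := hφ d hd
        obtain ⟨h1', h2', h3', h4'⟩ := hφ d' hd'
        refine h4 d' (Finset.mem_erase.1 hd').2 hlt ?_
        rw [he]; exact ⟨h2', h3'⟩
      intro d hd d' hd' he
      have h1 := key d hd d' hd' he
      have h2 := key d' hd' d hd he.symm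
      exact hx (by omega)
  have hc4 := Finset.card_union_le A B
  have hc5 := Finset.card_erase_add_one hc
  have inF : ∀ {S : Finset I}, S ⊆ FW → S ⊆ F := fun hS i hi => ((memF i).1 (hS hi)).1
  have AF : A ⊆ FW := by rw [hA]; exact Finset.filter_subset _ _
  have BF : B ⊆ FW := by rw [hB]; exact Finset.filter_subset _ _
  have S1F : S1 ⊆ FW := by rw [hS1]; exact Finset.filter_subset _ _
  have S2F : S2 ⊆ FW := by rw [hS2]; exact Finset.filter_subset _ _
  have hcases : 3 ≤ A.card ∨ 3 ≤ B.card ∨ 5 ≤ S1.card ∨ 5 ≤ S2.card := by omega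
  rcases hcases with h3 | h3 | h3 | h3
  · refine h.r1S' hx hy A (inF AF) h3 c hc'.1 ?_ ?_
    · intro f hf; rw [hA] at hf; exact (Finset.mem_filter.1 hf).2
    · intro d hd f hf
      have := (memF f).1 (AF hf)
      by_contra h1
      push Not at h1
      have := ymax d ((memC d).2 ⟨hd, by omega, by omega⟩) h1.2.2
      omega
  · obtain ⟨F', C', κ', K', g1, g2, g3⟩ := h.swap.r1S' hy hx B (inF BF) h3 c hc'.1 (by
      intro f hf; rw [hB] at hf; exact (Finset.mem_filter.1 hf).2) (by
      intro d hd f hf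
      have := (memF f).1 (BF hf)
      by_contra h1
      push Not at h1
      have := xmax d ((memC d).2 ⟨hd, by omega, by omega⟩) h1.2.2
      omega)
    exact ⟨F', C', κ', K', g1, g2, g3.swap⟩
  · refine h.r1S hx hy S1 (inF S1F) h3 ?_
    intro d hd f hf g hg
    have h4 := (memF f).1 (S1F hf)
    have h5 := (memF g).1 (S1F hg)
    have h6 := (fne g (S1F hg)).2
    rw [hS1] at hg
    have h7 := (Finset.mem_filter.1 hg).2
    by_contra h1
    have h8 : d ∈ CW := (memC d).2 ⟨hd, by omega, by omega⟩
    by_cases h9 : d = c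
    · rw [h9] at h1; omega
    · have := ymax d h8 h9; omega
  · refine h.r1S hx hy S2 (inF S2F) h3 ?_
    intro d hd g hg f hf
    have h4 := (memF f).1 (S2F hf)
    have h5 := (memF g).1 (S2F hg)
    have h6 := (fne g (S2F hg)).1
    rw [hS2] at hg
    have h7 := (Finset.mem_filter.1 hg).2
    by_contra h1
    have h8 : d ∈ CW := (memC d).2 ⟨hd, by omega, by omega⟩
    by_cases h9 : d = c
    · rw [h9] at h1; omega
    · have := xmax d h8 h9; omega

theorem St.finish {x y : I → ℤ} (hx : Function.Injective x) (hy : Function.Injective y)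
    {P : Finset I} : ∀ (n : ℕ) {F C : Finset I} {κ : I → Bool} {K : Set (I → Bool)},
    F.card ≤ n → St x y P F C κ K →
    ∃ F' C' κ' K', K' ⊆ K ∧ St x y P F' C' κ' K' ∧ ∀ a b : ℤ,
      12 ≤ (P.filter (fun p => a ≤ x p ∧ b ≤ y p)).card → Good x y P K' a b := by
  intro n
  induction n with
  | zero =>
    intro F C κ K hn h
    refine ⟨F, C, κ, K, subset_rfl, h, fun a b h12 => ?_⟩
    by_contra hng
    obtain ⟨F', C', κ', K', h1, h2, h3⟩ := h.reduce hx hy a b hng h12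
    have := Finset.card_lt_card h1
    omega
  | succ n ih =>
    intro F C κ K hn h
    by_cases H : ∀ a b : ℤ,
      12 ≤ (P.filter (fun p => a ≤ x p ∧ b ≤ y p)).card → Good x y P K a b
    · exact ⟨F, C, κ, K, subset_rfl, h, H⟩
    · push Not at H
      obtain ⟨a, b, h12, hng⟩ := H
      obtain ⟨F', C', κ', K', h1, h2, h3⟩ := h.reduce hx hy a b hng h12
      have := Finset.card_lt_card h1
      obtain ⟨F'', C'', κ'', K'', h4, h5, h6⟩ := ih (by omega) h3
      exact ⟨F'', C'', κ'', K'', h4.trans h2, h5, h6⟩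
end Plane

section Space
variable {I : Type}

def ofil (x y z : I → ℤ) (P : Finset I) (X Y Z : ℤ) : Finset I :=
  P.filter (fun i => X ≤ x i ∧ Y ≤ y i ∧ Z ≤ z i)

theorem mem_ofil {x y z : I → ℤ} {P : Finset I} {X Y Z : ℤ} {i : I} :
    i ∈ ofil x y z P X Y Z ↔ i ∈ P ∧ X ≤ x i ∧ Y ≤ y i ∧ Z ≤ z i := by
  simp [ofil]

/-- dominance -/
def Dom (x y z : I → ℤ) (p q : I) : Prop := x p < x q ∧ y p < y q ∧ z p < z q

def Anti (x y z : I → ℤ) (A : Finset I) : Prop := ∀ p ∈ A, ∀ q ∈ A, ¬ Dom x y z p q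

theorem sweep {x y z : I → ℤ} (hx : Function.Injective x) (hy : Function.Injective y)
    (hz : Function.Injective z) (A : Finset I) (hA : Anti x y z A) :
    ∃ F C κ K, St x y A F C κ K ∧ ∀ c ∈ K, ∀ X Y Z, 12 ≤ (ofil x y z A X Y Z).card →
      ∃ i ∈ ofil x y z A X Y Z, ∃ j ∈ ofil x y z A X Y Z, c i ≠ c j := by
  induction A using Finset.induction_on_min_value z with
  | empty =>
    refine ⟨∅, ∅, fun _ => true, Set.univ, ⟨by simp, by simp, by simp, ?_, by simp, by simp,
      by simp, by simp, by simp⟩, ?_⟩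
    · exact fun g => ⟨g, trivial, fun _ _ => rfl⟩
    · intro c _ X Y Z h
      simp [ofil] at h
  | insert p s hp hmin ih =>
    obtain ⟨F, C, κ, K, hst, hK⟩ := ih (fun u hu v hv =>
      hA u (Finset.mem_insert_of_mem hu) v (Finset.mem_insert_of_mem hv))
    have ne : ∀ q ∈ s, p ≠ q := fun q hq e => hp (e ▸ hq)
    obtain ⟨F1, C1, κ1, K1, hK1, hst1⟩ := hst.arrive hx hy p hp (by
      intro q hq h1 h2
      have n1 : x p ≠ x q := fun e => ne q hq (hx e)
      have n2 : y p ≠ y q := fun e => ne q hq (hy e)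
      have n3 : z p ≠ z q := fun e => ne q hq (hz e)
      have h3 := hmin q hq
      exact hA p (Finset.mem_insert_self _ _) q (Finset.mem_insert_of_mem hq)
        ⟨by omega, by omega, by omega⟩)
    obtain ⟨F2, C2, κ2, K2, hK2, hst2, hgood⟩ := hst1.finish hx hy F1.card le_rfl
    refine ⟨F2, C2, κ2, K2, hst2, fun c hc X Y Z h12 => ?_⟩
    by_cases hZ : Z ≤ z p
    · have hall : ∀ q ∈ insert p s, Z ≤ z q := by
        intro q hq
        rcases Finset.mem_insert.1 hq with rfl | hq
        · exact hZ
        · exact hZ.trans (hmin q hq)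
      have h1 : ofil x y z (insert p s) X Y Z =
          (insert p s).filter (fun p => X ≤ x p ∧ Y ≤ y p) := by
        ext q
        rw [mem_ofil, Finset.mem_filter]
        constructor
        · rintro ⟨h1, h2, h3, h4⟩; exact ⟨h1, h2, h3⟩
        · rintro ⟨h1, h2, h3⟩; exact ⟨h1, h2, h3, hall q h1⟩
      rw [h1] at h12
      obtain ⟨u, hu, v, hv, g1, g2, g3, g4, g5⟩ := hgood X Y h12 c hc
      exact ⟨u, mem_ofil.2 ⟨hu, g1, g2, hall u hu⟩, v, mem_ofil.2 ⟨hv, g3, g4, hall v hv⟩, g5⟩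
    · have h1 : ofil x y z (insert p s) X Y Z = ofil x y z s X Y Z := by
        ext q
        rw [mem_ofil, mem_ofil, Finset.mem_insert]
        constructor
        · rintro ⟨rfl | h1, h2⟩
          · exact absurd h2.2.2 hZ
          · exact ⟨h1, h2⟩
        · rintro ⟨h1, h2⟩; exact ⟨Or.inr h1, h2⟩
      rw [h1] at h12 ⊢
      exact hK c (hK1 (hK2 hc)) X Y Z h12

theorem anti_two {x y z : I → ℤ} (hx : Function.Injective x) (hy : Function.Injective y)
    (hz : Function.Injective z) (A : Finset I) (hA : Anti x y z A) :
    ∃ c : I → Bool, ∀ X Y Z, 12 ≤ (ofil x y z A X Y Z).card →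
      ∀ b, ∃ i ∈ ofil x y z A X Y Z, c i = b := by
  obtain ⟨F, C, κ, K, hst, hK⟩ := sweep hx hy hz A hA
  obtain ⟨c, hc, _⟩ := hst.s1 (fun _ => true)
  refine ⟨c, fun X Y Z h12 b => ?_⟩
  obtain ⟨i, hi, j, hj, hij⟩ := hK c hc X Y Z h12
  by_cases h : c i = b
  · exact ⟨i, hi, h⟩
  · refine ⟨j, hj, ?_⟩
    cases b <;> cases h1 : c i <;> cases h2 : c j <;> simp_all

theorem Dom.of_le {x y z : I → ℤ} (hx : Function.Injective x) (hy : Function.Injective y)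
    (hz : Function.Injective z) {p q : I} (hne : p ≠ q) (h1 : x p ≤ x q) (h2 : y p ≤ y q)
    (h3 : z p ≤ z q) : Dom x y z p q := by
  have n1 : x p ≠ x q := fun e => hne (hx e)
  have n2 : y p ≠ y q := fun e => hne (hy e)
  have n3 : z p ≠ z q := fun e => hne (hz e)
  exact ⟨by omega, by omega, by omega⟩

theorem exists_layer (x y z : I → ℤ) (P : Finset I) :
    ∃ A ⊆ P, Anti x y z A ∧ ∀ p ∈ P, p ∉ A → ∃ q ∈ A, Dom x y z p q := by
  refine ⟨P.filter (fun p => ∀ q ∈ P, ¬ Dom x y z p q), Finset.filter_subset _ _, ?_, ?_⟩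
  · intro p hp q hq
    exact (Finset.mem_filter.1 hp).2 q (Finset.mem_filter.1 hq).1
  · intro p hp hpA
    have : ∃ q ∈ P, Dom x y z p q := by
      by_contra h
      push Not at h
      exact hpA (Finset.mem_filter.2 ⟨hp, h⟩)
    obtain ⟨q0, hq0, hd0⟩ := this
    obtain ⟨q, hq, hqm⟩ := Finset.exists_max_image (P.filter (fun q => Dom x y z p q)) x
      ⟨q0, Finset.mem_filter.2 ⟨hq0, hd0⟩⟩
    rw [Finset.mem_filter] at hq
    refine ⟨q, Finset.mem_filter.2 ⟨hq.1, fun t ht hqt => ?_⟩, hq.2⟩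
    obtain ⟨a1, a2, a3⟩ := hq.2
    obtain ⟨b1, b2, b3⟩ := hqt
    have := hqm t (Finset.mem_filter.2 ⟨ht, by omega, by omega, by omega⟩)
    omega

theorem Dom.mem_ofil {x y z : I → ℤ} {P Q : Finset I} {X Y Z : ℤ} {p q : I}
    (h : Dom x y z p q) (hp : p ∈ ofil x y z P X Y Z) (hq : q ∈ Q) :
    q ∈ ofil x y z Q X Y Z := by
  obtain ⟨h1, h2, h3⟩ := h
  have := OctP.mem_ofil.1 hp
  exact OctP.mem_ofil.2 ⟨hq, by omega, by omega, by omega⟩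

theorem ofil_mono {x y z : I → ℤ} {P Q : Finset I} (h : P ⊆ Q) {X Y Z : ℤ} :
    ofil x y z P X Y Z ⊆ ofil x y z Q X Y Z := by
  intro i hi
  rw [mem_ofil] at hi ⊢
  exact ⟨h hi.1, hi.2⟩

theorem ofil_disj_card {x y z : I → ℤ} {P Q : Finset I} (h : Q ⊆ P) (X Y Z : ℤ) :
    (ofil x y z P X Y Z).card = (ofil x y z Q X Y Z).card + (ofil x y z (P \ Q) X Y Z).card := by
  rw [← Finset.card_union_of_disjoint]
  · congr 1
    ext i
    simp only [mem_ofil, Finset.mem_union, Finset.mem_sdiff]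
    have := @h i
    tauto
  · rw [Finset.disjoint_left]
    intro i hi hi'
    rw [mem_ofil] at hi hi'
    exact (Finset.mem_sdiff.1 hi'.1).2 hi.1

theorem ofil_filter_card {x y z : I → ℤ} {P : Finset I} (c : I → Bool) (b : Bool) (X Y Z : ℤ) :
    (ofil x y z P X Y Z).card = (ofil x y z (P.filter (fun i => c i = b)) X Y Z).card +
      (ofil x y z (P.filter (fun i => c i ≠ b)) X Y Z).card := by
  rw [ofil_disj_card (Finset.filter_subset (fun i => c i = b) P), Finset.filter_not]

def Col (x y z : I → ℤ) (k m : ℕ) : Prop :=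
  ∀ P : Finset I, ∃ c : I → Fin k, ∀ X Y Z, m ≤ (ofil x y z P X Y Z).card →
    ∀ j, ∃ i ∈ ofil x y z P X Y Z, c i = j

theorem col_two {x y z : I → ℤ} (hx : Function.Injective x) (hy : Function.Injective y)
    (hz : Function.Injective z) : Col x y z 2 12 := by
  intro P
  obtain ⟨A, hAP, hA, hdom⟩ := exists_layer x y z P
  obtain ⟨c, hc⟩ := anti_two hx hy hz A hA
  have : ∀ p, ∃ q, p ∈ P → p ∉ A → q ∈ A ∧ Dom x y z p q := by
    intro p
    by_cases h : p ∈ P ∧ p ∉ A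
    · obtain ⟨q, hq⟩ := hdom p h.1 h.2
      exact ⟨q, fun _ _ => hq⟩
    · exact ⟨p, fun h1 h2 => absurd ⟨h1, h2⟩ h⟩
  choose φ hφ using this
  let c' : I → Bool := fun p => if p ∈ A then c p else !c (φ p)
  have key : ∀ X Y Z, 12 ≤ (ofil x y z P X Y Z).card →
      ∀ b, ∃ i ∈ ofil x y z P X Y Z, c' i = b := by
    intro X Y Z h12 b
    by_cases h : ∃ p ∈ ofil x y z P X Y Z, p ∉ A
    · obtain ⟨p, hp, hpA⟩ := h
      obtain ⟨h1, h2⟩ := hφ p (mem_ofil.1 hp).1 hpA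
      by_cases hb : c (φ p) = b
      · exact ⟨φ p, h2.mem_ofil hp (hAP h1), by simp [c', h1, hb]⟩
      · refine ⟨p, hp, ?_⟩
        simp only [c', hpA, if_false]
        cases b <;> cases h3 : c (φ p) <;> simp_all
    · push Not at h
      have he : ofil x y z P X Y Z = ofil x y z A X Y Z := by
        ext i
        constructor
        · intro hi
          exact mem_ofil.2 ⟨h i hi, (mem_ofil.1 hi).2⟩
        · intro hi; exact ofil_mono hAP hi
      rw [he] at h12 ⊢
      obtain ⟨i, hi, hib⟩ := hc X Y Z h12 b
      exact ⟨i, hi, by simp [c', (mem_ofil.1 hi).1, hib]⟩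
  refine ⟨fun i => if c' i then 0 else 1, fun X Y Z h12 j => ?_⟩
  fin_cases j
  · obtain ⟨i, hi, h⟩ := key X Y Z h12 true
    exact ⟨i, hi, by simp [h]⟩
  · obtain ⟨i, hi, h⟩ := key X Y Z h12 false
    exact ⟨i, hi, by simp [h]⟩

theorem anti_fiber {x y z : I → ℤ} (hx : Function.Injective x) (hy : Function.Injective y)
    (hz : Function.Injective z) (L : Finset I) (hL : Anti x y z L) (c : I → Bool)
    (hc : ∀ X Y Z, 12 ≤ (ofil x y z L X Y Z).card → ∀ b, ∃ i ∈ ofil x y z L X Y Z, c i = b)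
    (n : ℕ) (b : Bool) (X Y Z : ℤ)
    (hS : (ofil x y z (L.filter (fun i => c i = b)) X Y Z).card < n) :
    (ofil x y z (L.filter (fun i => c i ≠ b)) X Y Z).card ≤ 11 * n ^ 2 := by
  by_contra hcon
  push Not at hcon
  obtain ⟨S, hSd⟩ : ∃ S, S = ofil x y z (L.filter (fun i => c i = b)) X Y Z := ⟨_, rfl⟩
  obtain ⟨U, hUd⟩ : ∃ U, U = ofil x y z (L.filter (fun i => c i ≠ b)) X Y Z := ⟨_, rfl⟩
  rw [← hSd] at hS
  rw [← hUd] at hcon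
  let key : I → ℕ × ℕ := fun q =>
    ((S.filter (fun s => x s < x q)).card, (S.filter (fun s => y s < y q)).card)
  obtain ⟨v, hv, hfib⟩ := Finset.exists_lt_card_fiber_of_mul_lt_card_of_maps_to
    (s := U) (t := Finset.range n ×ˢ Finset.range n) (f := key) (n := 11) (by
      intro q _
      rw [Finset.mem_product, Finset.mem_range, Finset.mem_range]
      exact ⟨(Finset.card_filter_le _ _).trans_lt hS, (Finset.card_filter_le _ _).trans_lt hS⟩)
    (by rw [Finset.card_product, Finset.card_range]; nlinarith)
  obtain ⟨Φ, hΦ⟩ : ∃ Φ, Φ = U.filter (fun q => key q = v) := ⟨_, rfl⟩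
  rw [← hΦ] at hfib
  have hne : Φ.Nonempty := Finset.card_pos.1 (by omega)
  obtain ⟨q1, hq1, m1⟩ := Finset.exists_min_image Φ x hne
  obtain ⟨q2, hq2, m2⟩ := Finset.exists_min_image Φ y hne
  obtain ⟨q3, hq3, m3⟩ := Finset.exists_min_image Φ z hne
  have hΦm : ∀ q ∈ Φ, (q ∈ L ∧ c q ≠ b) ∧ (X ≤ x q ∧ Y ≤ y q ∧ Z ≤ z q) ∧ key q = v := by
    intro q hq
    rw [hΦ, Finset.mem_filter, hUd, mem_ofil, Finset.mem_filter] at hq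
    exact ⟨hq.1.1, hq.1.2, hq.2⟩
  obtain ⟨s, hs, hsb⟩ := hc (x q1) (y q2) (z q3) (by
    refine le_trans (Nat.succ_le_of_lt hfib) (Finset.card_le_card fun q hq => ?_)
    exact mem_ofil.2 ⟨(hΦm q hq).1.1, m1 q hq, m2 q hq, m3 q hq⟩) b
  rw [mem_ofil] at hs
  have h1 := hΦm q1 hq1
  have h2 := hΦm q2 hq2
  have h3 := hΦm q3 hq3
  have hsS : s ∈ S := by
    rw [hSd, mem_ofil, Finset.mem_filter]
    exact ⟨⟨hs.1, hsb⟩, by omega, by omega, by omega⟩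
  have hsx : x q3 ≤ x s := by
    have hsub : S.filter (fun s => x s < x q1) ⊆ S.filter (fun s => x s < x q3) := by
      intro t ht
      rw [Finset.mem_filter] at ht ⊢
      exact ⟨ht.1, ht.2.trans_le (m1 q3 hq3)⟩
    have heq := Finset.eq_of_subset_of_card_le hsub (by
      have := congrArg Prod.fst (h1.2.2.trans h3.2.2.symm)
      exact this.ge)
    by_contra hlt
    have : s ∈ S.filter (fun s => x s < x q1) := by
      rw [heq]; exact Finset.mem_filter.2 ⟨hsS, by omega⟩
    have := (Finset.mem_filter.1 this).2
    omega
  have hsy : y q3 ≤ y s := by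
    have hsub : S.filter (fun s => y s < y q2) ⊆ S.filter (fun s => y s < y q3) := by
      intro t ht
      rw [Finset.mem_filter] at ht ⊢
      exact ⟨ht.1, ht.2.trans_le (m2 q3 hq3)⟩
    have heq := Finset.eq_of_subset_of_card_le hsub (by
      have := congrArg Prod.snd (h2.2.2.trans h3.2.2.symm)
      exact this.ge)
    by_contra hlt
    have : s ∈ S.filter (fun s => y s < y q2) := by
      rw [heq]; exact Finset.mem_filter.2 ⟨hsS, by omega⟩
    have := (Finset.mem_filter.1 this).2
    omega
  refine hL q3 h3.1.1 s hs.1 (Dom.of_le hx hy hz ?_ hsx hsy hs.2.2.2)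
  rintro rfl
  exact h3.1.2 hsb

theorem anti_balance {x y z : I → ℤ} (hx : Function.Injective x) (hy : Function.Injective y)
    (hz : Function.Injective z) (L : Finset I) (hL : Anti x y z L) (n : ℕ) :
    ∃ c : I → Bool, ∀ X Y Z, n + 11 * n ^ 2 ≤ (ofil x y z L X Y Z).card →
      ∀ b, n ≤ (ofil x y z (L.filter (fun i => c i = b)) X Y Z).card := by
  obtain ⟨c, hc⟩ := anti_two hx hy hz L hL
  refine ⟨c, fun X Y Z hO b => ?_⟩
  by_contra hlt
  have h1 := anti_fiber hx hy hz L hL c hc n b X Y Z (by omega)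
  have h2 := ofil_filter_card (x := x) (y := y) (z := z) (P := L) c b X Y Z
  omega

theorem peel {x y z : I → ℤ} (hx : Function.Injective x) (hy : Function.Injective y)
    (hz : Function.Injective z) (P : Finset I) (n M : ℕ) (hM : n + 11 * n ^ 2 ≤ M + 1) (D : ℕ) :
    ∃ Q ⊆ P, ∃ c : I → Bool,
      (∀ p ∈ Q, D ≤ ((P \ Q).filter (fun q => Dom x y z p q)).card) ∧
      ∀ X Y Z, D * M + 1 ≤ (ofil x y z (P \ Q) X Y Z).card →
        ∀ b, n ≤ (ofil x y z ((P \ Q).filter (fun i => c i = b)) X Y Z).card := by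
  induction D with
  | zero =>
    refine ⟨P, subset_rfl, fun _ => true, by simp, fun X Y Z h => ?_⟩
    simp [ofil] at h
  | succ D ih =>
    obtain ⟨Q, hQ, c, h1, h2⟩ := ih
    obtain ⟨A, hAQ, hA, hdom⟩ := exists_layer x y z Q
    obtain ⟨c1, hc1⟩ := anti_balance hx hy hz A hA n
    have memd : ∀ i, i ∈ P \ (Q \ A) ↔ i ∈ P \ Q ∨ i ∈ A := by
      intro i
      simp only [Finset.mem_sdiff]
      have := @hAQ i
      have := @hQ i
      tauto
    have notA : ∀ i ∈ P \ Q, i ∉ A := fun i hi hiA => (Finset.mem_sdiff.1 hi).2 (hAQ hiA)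
    refine ⟨Q \ A, Finset.sdiff_subset.trans hQ, fun i => if i ∈ A then c1 i else c i, ?_, ?_⟩
    · intro p hp
      rw [Finset.mem_sdiff] at hp
      obtain ⟨q, hqA, hpq⟩ := hdom p hp.1 hp.2
      have h3 := h1 p hp.1
      have hq : q ∉ (P \ Q).filter (fun q => Dom x y z p q) :=
        fun h => notA q (Finset.mem_filter.1 h).1 hqA
      have h4 : insert q ((P \ Q).filter (fun q => Dom x y z p q)) ⊆
          (P \ (Q \ A)).filter (fun q => Dom x y z p q) := by
        intro i hi
        rw [Finset.mem_filter, memd]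
        rcases Finset.mem_insert.1 hi with rfl | hi
        · exact ⟨Or.inr hqA, hpq⟩
        · rw [Finset.mem_filter] at hi
          exact ⟨Or.inl hi.1, hi.2⟩
      have h5 := Finset.card_le_card h4
      rw [Finset.card_insert_of_notMem hq] at h5
      omega
    · intro X Y Z hO b
      have h3 : (ofil x y z (P \ (Q \ A)) X Y Z).card ≤
          (ofil x y z (P \ Q) X Y Z).card + (ofil x y z A X Y Z).card := by
        refine le_trans (Finset.card_le_card ?_) (Finset.card_union_le _ _)
        intro i hi
        rw [mem_ofil, memd] at hi
        rw [Finset.mem_union, mem_ofil, mem_ofil]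
        tauto
      have h4 : (D + 1) * M = D * M + M := by ring
      by_cases h5 : D * M + 1 ≤ (ofil x y z (P \ Q) X Y Z).card
      · refine (h2 X Y Z h5 b).trans (Finset.card_le_card (ofil_mono ?_))
        intro i hi
        rw [Finset.mem_filter] at hi ⊢
        refine ⟨(memd i).2 (Or.inl hi.1), ?_⟩
        simp [notA i hi.1, hi.2]
      · refine (hc1 X Y Z (by omega) b).trans (Finset.card_le_card (ofil_mono ?_))
        intro i hi
        rw [Finset.mem_filter] at hi ⊢
        refine ⟨(memd i).2 (Or.inr hi.1), ?_⟩
        simp [hi.1, hi.2]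

theorem balance {x y z : I → ℤ} (hx : Function.Injective x) (hy : Function.Injective y)
    (hz : Function.Injective z) (P : Finset I) (r n : ℕ) (hr : 1 ≤ r) (hrn : r ≤ n) :
    ∃ R ⊆ P, ∀ X Y Z, (r + n - 1) * (n + 11 * n ^ 2) ≤ (ofil x y z P X Y Z).card →
      r ≤ (ofil x y z R X Y Z).card ∧ n ≤ (ofil x y z (P \ R) X Y Z).card := by
  obtain ⟨M, hM⟩ : ∃ M, n + 11 * n ^ 2 = M + 1 := ⟨n + 11 * n ^ 2 - 1, by omega⟩
  obtain ⟨D, hD⟩ : ∃ D, D = r + n - 1 := ⟨_, rfl⟩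
  rw [hM, ← hD]
  obtain ⟨Q, hQ, c, h1, h2⟩ := peel hx hy hz P n M hM.le D
  obtain ⟨red, hred⟩ : ∃ f : I → Finset I, ∀ p, f p =
      ((P \ Q).filter (fun i => c i = true)).filter (fun q => Dom x y z p q) :=
    ⟨_, fun _ => rfl⟩
  obtain ⟨blue, hblue⟩ : ∃ f : I → Finset I, ∀ p, f p =
      ((P \ Q).filter (fun i => c i = false)).filter (fun q => Dom x y z p q) :=
    ⟨_, fun _ => rfl⟩
  have hrb : ∀ p ∈ Q, D ≤ (red p).card + (blue p).card := by
    intro p hp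
    refine (h1 p hp).trans (le_trans (Finset.card_le_card ?_) (Finset.card_union_le _ _))
    intro q hq
    rw [Finset.mem_filter] at hq
    rw [Finset.mem_union, hred, hblue]
    simp only [Finset.mem_filter]
    cases c q <;> simp [hq.1, hq.2]
  obtain ⟨QR, hQR⟩ : ∃ S, S = Q.filter (fun p => (red p).card < r) := ⟨_, rfl⟩
  have QRQ : QR ⊆ Q := by rw [hQR]; exact Finset.filter_subset _ _
  obtain ⟨R, hR⟩ : ∃ S, S = (P \ Q).filter (fun i => c i = true) ∪ QR := ⟨_, rfl⟩
  have sub1 : (P \ Q).filter (fun i => c i = true) ⊆ R := by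
    rw [hR]; exact Finset.subset_union_left
  have sub2 : QR ⊆ R := by rw [hR]; exact Finset.subset_union_right
  have sub3 : (P \ Q).filter (fun i => c i = false) ⊆ P \ R := by
    intro i hi
    rw [Finset.mem_filter, Finset.mem_sdiff] at hi
    rw [Finset.mem_sdiff, hR, Finset.mem_union, Finset.mem_filter]
    refine ⟨hi.1.1, ?_⟩
    rintro (h | h)
    · rw [hi.2] at h; simp at h
    · exact hi.1.2 (QRQ h)
  have sub4 : Q \ QR ⊆ P \ R := by
    intro i hi
    rw [Finset.mem_sdiff] at hi
    rw [Finset.mem_sdiff, hR, Finset.mem_union, Finset.mem_filter, Finset.mem_sdiff]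
    refine ⟨hQ hi.1, ?_⟩
    rintro (h | h)
    · exact h.1.2 hi.1
    · exact hi.2 h
  have hRP : R ⊆ P := by
    rw [hR]
    exact Finset.union_subset ((Finset.filter_subset _ _).trans Finset.sdiff_subset)
      (QRQ.trans hQ)
  refine ⟨R, hRP, fun X Y Z hO => ?_⟩
  have e1 := ofil_disj_card (x := x) (y := y) (z := z) hQ X Y Z
  have e2 := ofil_disj_card (x := x) (y := y) (z := z) QRQ X Y Z
  have b1 := Finset.card_le_card (ofil_mono (x := x) (y := y) (z := z) sub1 (X := X) (Y := Y) (Z := Z))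
  have b2 := Finset.card_le_card (ofil_mono (x := x) (y := y) (z := z) sub2 (X := X) (Y := Y) (Z := Z))
  have b3 := Finset.card_le_card (ofil_mono (x := x) (y := y) (z := z) sub3 (X := X) (Y := Y) (Z := Z))
  have b4 := Finset.card_le_card (ofil_mono (x := x) (y := y) (z := z) sub4 (X := X) (Y := Y) (Z := Z))
  by_cases hc1 : D ≤ (ofil x y z Q X Y Z).card
  · by_cases hc2 : n ≤ (ofil x y z (Q \ QR) X Y Z).card
    · obtain ⟨p, hp⟩ := Finset.card_pos.1 (show 0 < (ofil x y z (Q \ QR) X Y Z).card by omega)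
      have hp' := Finset.mem_sdiff.1 (mem_ofil.1 hp).1
      have hpr : r ≤ (red p).card := by
        by_contra h
        exact hp'.2 (by rw [hQR, Finset.mem_filter]; exact ⟨hp'.1, by omega⟩)
      have : red p ⊆ ofil x y z ((P \ Q).filter (fun i => c i = true)) X Y Z := by
        intro q hq
        rw [hred, Finset.mem_filter] at hq
        exact hq.2.mem_ofil hp hq.1
      have := Finset.card_le_card this
      exact ⟨by omega, by omega⟩
    · have hc3 : r ≤ (ofil x y z QR X Y Z).card := by omega
      obtain ⟨p, hp⟩ := Finset.card_pos.1 (show 0 < (ofil x y z QR X Y Z).card by omega)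
      have hp' := (mem_ofil.1 hp).1
      have hpr : (red p).card < r := by
        rw [hQR, Finset.mem_filter] at hp'; exact hp'.2
      have := hrb p (QRQ hp')
      have : blue p ⊆ ofil x y z ((P \ Q).filter (fun i => c i = false)) X Y Z := by
        intro q hq
        rw [hblue, Finset.mem_filter] at hq
        exact hq.2.mem_ofil hp hq.1
      have := Finset.card_le_card this
      exact ⟨by omega, by omega⟩
  · have h4 : D * (M + 1) = D * M + D := by ring
    have h5 := h2 X Y Z (by omega)
    have h6 := h5 true
    have h7 := h5 false
    exact ⟨by omega, by omega⟩

theorem Col.mono {x y z : I → ℤ} {k m m' : ℕ} (h : Col x y z k m) (hm : m ≤ m') :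
    Col x y z k m' := by
  intro P
  obtain ⟨c, hc⟩ := h P
  exact ⟨c, fun X Y Z h1 => hc X Y Z (hm.trans h1)⟩

theorem Col.shrink {x y z : I → ℤ} {k k' m : ℕ} (h : Col x y z k m) (hk : k' ≤ k)
    (h0 : 0 < k') : Col x y z k' m := by
  intro P
  obtain ⟨c, hc⟩ := h P
  refine ⟨fun i => if hi : (c i).val < k' then ⟨c i, hi⟩ else ⟨0, h0⟩, fun X Y Z h1 j => ?_⟩
  obtain ⟨i, hi, hij⟩ := hc X Y Z h1 (Fin.castLE hk j)
  refine ⟨i, hi, ?_⟩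
  have : (c i).val = j.val := by rw [hij]; rfl
  have h2 : (c i).val < k' := by omega
  simp only [h2, dif_pos]
  exact Fin.ext this

theorem Col.split {x y z : I → ℤ} (hx : Function.Injective x) (hy : Function.Injective y)
    (hz : Function.Injective z) {k1 k2 r n : ℕ} (hr : 1 ≤ r) (hrn : r ≤ n)
    (h1 : Col x y z k1 r) (h2 : Col x y z k2 n) :
    Col x y z (k1 + k2) ((r + n - 1) * (n + 11 * n ^ 2)) := by
  intro P
  obtain ⟨R, hRP, hR⟩ := balance hx hy hz P r n hr hrn
  obtain ⟨c1, hc1⟩ := h1 R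
  obtain ⟨c2, hc2⟩ := h2 (P \ R)
  refine ⟨fun i => if i ∈ R then Fin.castAdd k2 (c1 i) else Fin.natAdd k1 (c2 i), ?_⟩
  intro X Y Z hO j
  obtain ⟨g1, g2⟩ := hR X Y Z hO
  refine Fin.addCases (fun j => ?_) (fun j => ?_) j
  · obtain ⟨i, hi, hij⟩ := hc1 X Y Z g1 j
    exact ⟨i, ofil_mono hRP hi, by simp [(mem_ofil.1 hi).1, hij]⟩
  · obtain ⟨i, hi, hij⟩ := hc2 X Y Z g2 j
    have := (Finset.mem_sdiff.1 (mem_ofil.1 hi).1).2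
    exact ⟨i, ofil_mono Finset.sdiff_subset hi, by simp [this, hij]⟩

theorem col_one (x y z : I → ℤ) : Col x y z 1 1 := by
  intro P
  refine ⟨fun _ => 0, fun X Y Z h j => ?_⟩
  obtain ⟨i, hi⟩ := Finset.card_pos.1 (show 0 < (ofil x y z P X Y Z).card by omega)
  exact ⟨i, hi, Subsingleton.elim _ _⟩

theorem col_many {x y z : I → ℤ} (hx : Function.Injective x) (hy : Function.Injective y)
    (hz : Function.Injective z) (j : ℕ) :
    Col x y z (j + 2) (12 ^ (3 * 2 ^ j - 2)) ∧ Col x y z (j + 3) (12 ^ (3 * 2 ^ (j + 1) - 2)) := by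
  have step : ∀ j, Col x y z (j + 2) (12 ^ (3 * 2 ^ j - 2)) →
      Col x y z (j + 4) (12 ^ (3 * 2 ^ (j + 2) - 2)) := by
    intro j h
    obtain ⟨n, hn⟩ : ∃ n, n = 12 ^ (3 * 2 ^ j - 2) := ⟨_, rfl⟩
    have hn1 : 1 ≤ n := by rw [hn]; exact Nat.one_le_pow _ _ (by norm_num)
    have he : 3 * 2 ^ (j + 2) - 2 = (3 * 2 ^ j - 2) * 4 + 6 := by
      have : 1 ≤ 2 ^ j := Nat.one_le_two_pow
      have : 2 ^ (j + 2) = 4 * 2 ^ j := by ring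
      omega
    rw [he, pow_add, pow_mul, ← hn]
    rw [← hn] at h
    refine ((Col.split hx hy hz hn1 le_rfl h h).shrink (by omega) (by omega)).mono ?_
    calc (n + n - 1) * (n + 11 * n ^ 2) ≤ (2 * n) * (n ^ 2 + 11 * n ^ 2) := by
          apply Nat.mul_le_mul
          · omega
          · have : n ≤ n ^ 2 := by nlinarith
            omega
      _ = 24 * n ^ 3 := by ring
      _ ≤ n ^ 4 * 12 ^ 6 := by
          have : n ^ 3 ≤ n ^ 4 := Nat.pow_le_pow_right hn1 (by norm_num)
          omega
  induction j with
  | zero =>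
    constructor
    · exact (col_two hx hy hz).mono (by norm_num)
    · exact (Col.split hx hy hz le_rfl (by norm_num) (col_one x y z) (col_two hx hy hz)).mono
        (by norm_num)
  | succ j ih => exact ⟨ih.2, step j ih.1⟩

theorem exists_rank [Fintype I] (a : I → ℝ) :
    ∃ r : I → ℤ, Function.Injective r ∧ ∀ t : ℝ, ∃ T : ℤ, ∀ i, t ≤ a i ↔ T ≤ r i := by
  let e := Fintype.equivFin I
  let lt : I → I → Prop := fun p q => a p < a q ∨ (a p = a q ∧ e p < e q)
  have trans : ∀ p q s, lt p q → lt q s → lt p s := by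
    rintro p q s (h1 | ⟨h1, h1'⟩) (h2 | ⟨h2, h2'⟩)
    · exact Or.inl (h1.trans h2)
    · exact Or.inl (h2 ▸ h1)
    · exact Or.inl (h1 ▸ h2)
    · exact Or.inr ⟨h1.trans h2, h1'.trans h2'⟩
  have irr : ∀ p, ¬ lt p p := by
    rintro p (h | ⟨_, h⟩) <;> exact lt_irrefl _ h
  have tri : ∀ p q, p ≠ q → lt p q ∨ lt q p := by
    intro p q hne
    rcases lt_trichotomy (a p) (a q) with h | h | h
    · exact Or.inl (Or.inl h)
    · rcases lt_trichotomy (e p) (e q) with h' | h' | h'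
      · exact Or.inl (Or.inr ⟨h, h'⟩)
      · exact absurd (e.injective h') hne
      · exact Or.inr (Or.inr ⟨h.symm, h'⟩)
    · exact Or.inr (Or.inl h)
  let r : I → ℕ := fun i => (Finset.univ.filter (fun k => lt k i)).card
  have mono : ∀ p q, lt p q → r p < r q := by
    intro p q h
    apply Finset.card_lt_card
    refine Finset.ssubset_iff_subset_ne.2 ⟨?_, fun he => ?_⟩
    · intro s hs
      simp only [Finset.mem_filter, Finset.mem_univ, true_and] at hs ⊢
      exact trans s p q hs h
    · have : p ∈ Finset.univ.filter (fun k => lt k q) := by simpa using h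
      rw [← he] at this
      simp only [Finset.mem_filter, Finset.mem_univ, true_and] at this
      exact irr p this
  refine ⟨fun i => (r i : ℤ), ?_, ?_⟩
  · intro p q h
    by_contra hne
    have h' : r p = r q := Nat.cast_injective (R := ℤ) h
    rcases tri p q hne with h1 | h1
    · have := mono p q h1; omega
    · have := mono q p h1; omega
  · intro t
    refine ⟨((Finset.univ.filter (fun k => a k < t)).card : ℤ), fun i => ?_⟩
    rw [Nat.cast_le]
    constructor
    · intro h
      apply Finset.card_le_card
      intro k hk
      simp only [Finset.mem_filter, Finset.mem_univ, true_and] at hk ⊢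
      exact Or.inl (hk.trans_le h)
    · intro h
      by_contra hlt
      push Not at hlt
      have : r i < (Finset.univ.filter (fun k => a k < t)).card := by
        apply Finset.card_lt_card
        refine Finset.ssubset_iff_subset_ne.2 ⟨?_, fun he => ?_⟩
        · intro k hk
          simp only [Finset.mem_filter, Finset.mem_univ, true_and] at hk ⊢
          rcases hk with h1 | ⟨h1, _⟩
          · exact h1.trans hlt
          · rw [h1]; exact hlt
        · have : i ∈ Finset.univ.filter (fun k => a k < t) := by simpa using hlt
          rw [← he] at this
          simp only [Finset.mem_filter, Finset.mem_univ, true_and] at this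
          exact irr i this
      omega
end Space
end OctP

theorem octants_cover_decomposable_many
    (k : ℕ) (hk : 2 ≤ k) (I : Type) [Fintype I]
    (a : I → (Fin 3 → ℝ)) (X : Set (Fin 3 → ℝ))
    (hcov : ∀ x ∈ X,
      12 ^ (2 ^ (k - 1) + 2 ^ (k - 2) - 2) ≤ {i : I | x ∈ Octant (a i)}.ncard) :
    ∃ f : I → Fin k, ∀ j : Fin k, ∀ x ∈ X, ∃ i : I, f i = j ∧ x ∈ Octant (a i) := by
  obtain ⟨x, hx, hxT⟩ := OctP.exists_rank (fun i => a i 0)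
  obtain ⟨y, hy, hyT⟩ := OctP.exists_rank (fun i => a i 1)
  obtain ⟨z, hz, hzT⟩ := OctP.exists_rank (fun i => a i 2)
  obtain ⟨j, rfl⟩ : ∃ j, k = j + 2 := ⟨k - 2, by omega⟩
  have he : 2 ^ (j + 2 - 1) + 2 ^ (j + 2 - 2) - 2 = 3 * 2 ^ j - 2 := by
    have h1 : j + 2 - 1 = j + 1 := by omega
    have h2 : j + 2 - 2 = j := by omega
    rw [h1, h2, pow_succ]
    omega
  rw [he] at hcov
  obtain ⟨c, hc⟩ := (OctP.col_many hx hy hz j).1 Finset.univ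
  refine ⟨c, fun b p hp => ?_⟩
  obtain ⟨X', hX'⟩ := hxT (p 0)
  obtain ⟨Y', hY'⟩ := hyT (p 1)
  obtain ⟨Z', hZ'⟩ := hzT (p 2)
  have hmem : ∀ i, i ∈ OctP.ofil x y z Finset.univ X' Y' Z' ↔ p ∈ Octant (a i) := by
    intro i
    rw [OctP.mem_ofil, ← hX', ← hY', ← hZ']
    simp [Octant]
  have hset : {i : I | p ∈ Octant (a i)} = ↑(OctP.ofil x y z Finset.univ X' Y' Z') := by
    ext i
    rw [Finset.mem_coe, hmem]
    rfl
  have h := hcov p hp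
  rw [hset, Set.ncard_coe_finset] at h
  obtain ⟨i, hi, hib⟩ := hc X' Y' Z' h b
  exact ⟨i, hib, (hmem i).1 hi⟩
end

section
/- Any 12-fold covering of any subset of ℝ³ with a finite number of translates of a given octant can be decomposed into two coverings. Precisely: let I be a finite index set, a : I → ℝ³, and X ⊆ ℝ³; if every point of X belongs to O(a i) for at least 12 indices i ∈ I, then there exists f : I → Bool such that for each b ∈ Bool and every x ∈ X there is an index i with f i = b and x ∈ O(a i). -/
namespace Oct

open Classical

inductive Ty | S | N | O (c : Bool)

variable (X Y : ℕ → ℕ)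

def dom (j i : ℕ) : Prop := X j < X i ∧ Y j < Y i
def St (t i : ℕ) : Prop := i < t ∧ ∀ j < t, ¬ dom X Y j i
def nb (t a b : ℕ) : Prop := St X Y t a ∧ St X Y t b ∧ a ≠ b ∧
  ∀ q, St X Y t q → ¬ (X a < X q ∧ X q < X b) ∧ ¬ (X b < X q ∧ X q < X a)
def Kill (v w : ℕ) : Prop := St X Y w v ∧ dom X Y w v
def Vis (v w : ℕ) : Prop := Kill X Y v w ∧
  ∀ j, w < j → St X Y (j+1) w → St X Y (j+1) j → ¬ dom X Y j v

def Prot (s : ℕ) (σ : ℕ → Option Bool) (p : ℕ) (k : Bool) : Prop := ∃ q, nb X Y s p q ∧ σ q = some k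

def OK (s : ℕ) (τ : ℕ → Ty) (σ : ℕ → Option Bool) (p : ℕ) : Prop :=
  σ p = none →
    (τ p = Ty.N → Prot X Y s σ p true ∧ Prot X Y s σ p false) ∧
    (∀ c, τ p = Ty.O c → Prot X Y s σ p (!c) ∨
      ∃ q, nb X Y s p q ∧ τ q = Ty.O c ∧ σ q = none ∧ p < q ∧ Prot X Y s σ q (!c))

def Rep (s : ℕ) (τ : ℕ → Ty) (σ σ' : ℕ → Option Bool) : Prop :=
  ∃ z c, St X Y s z ∧ σ z = none ∧ τ z ≠ Ty.S ∧ (∀ q, nb X Y s z q → σ q ≠ some c) ∧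
    (∀ d, τ z = Ty.O d → c = (!d) ∧
      ((∀ q, nb X Y s z q → τ q = Ty.O d → σ q = none → q < z) ∨
       (∃ q, nb X Y s z q ∧ τ q = Ty.O d ∧ σ q = none ∧ q < z))) ∧
    σ' = Function.update σ z (some c)

variable {X Y}

lemma nb_symm {t a b : ℕ} (h : nb X Y t a b) : nb X Y t b a :=
  ⟨h.2.1, h.1, h.2.2.1.symm, fun q hq => ⟨(h.2.2.2 q hq).2, (h.2.2.2 q hq).1⟩⟩

lemma St_mono {s t i : ℕ} (h : St X Y t i) (hst : s ≤ t) (his : i < s) : St X Y s i :=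
  ⟨his, fun j hj => h.2 j (by omega)⟩

lemma St_anti (hY : Function.Injective Y) {t a b : ℕ} (ha : St X Y t a) (hb : St X Y t b)
    (h : X a < X b) : Y b < Y a := by
  have h1 := hb.2 a ha.1
  have h2 : Y a ≠ Y b := fun e => by
    have := hY e; subst this; omega
  unfold dom at h1
  omega

lemma Kill_St {v w : ℕ} (h : Kill X Y v w) : St X Y (w+1) w := by
  refine ⟨by omega, fun j hj hd => ?_⟩
  obtain ⟨h1, h2⟩ := h
  unfold dom at *
  by_cases e : j = w
  · subst e; omega
  · exact h1.2 j (by omega) ⟨by omega, by omega⟩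

lemma St_die {t i : ℕ} (h : St X Y t i) (h' : ¬ St X Y (t+1) i) : Kill X Y i t := by
  refine ⟨h, ?_⟩
  by_contra hc
  apply h'
  refine ⟨by have := h.1; omega, fun j hj => ?_⟩
  by_cases e : j = t
  · subst e; exact hc
  · exact h.2 j (by omega)

lemma nb_old (hX : Function.Injective X) (hY : Function.Injective Y) {t a b : ℕ} (h : nb X Y (t+1) a b) (ha : a ≠ t) (hb : b ≠ t) : nb X Y t a b := by
  obtain ⟨h1, h2, h3, h4⟩ := h
  have key : ∀ a b, a ≠ t → St X Y (t+1) a → St X Y (t+1) b → (∀ q, St X Y (t+1) q → ¬ (X a < X q ∧ X q < X b)) →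
      ∀ q, St X Y t q → ¬ (X a < X q ∧ X q < X b) := by
    intro a b e h1 h2 h4 q hq hc
    by_cases hq' : St X Y (t+1) q
    · exact h4 q hq' hc
    · have hk := St_die hq hq'
      have ht := Kill_St hk
      have hd := hk.2
      unfold dom at hd
      have h5 := h4 t ht
      have haq : Y q < Y a := St_anti hY (St_mono h1 (by omega) (by have := h1.1; omega)) hq hc.1
      have : X t ≤ X a := by omega
      have h6 := h1.2 t (by omega)
      unfold dom at h6
      have h7 : X a ≠ X t := fun h => e (hX h)
      omega
  exact ⟨St_mono h1 (by omega) (by have := h1.1; omega), St_mono h2 (by omega) (by have := h2.1; omega), h3,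
    fun q hq => ⟨key a b ha h1 h2 (fun q hq => (h4 q hq).1) q hq, key b a hb h2 h1 (fun q hq => (h4 q hq).2) q hq⟩⟩

lemma Vis_left {v w s a : ℕ} (h : Vis X Y v w) (hw : St X Y s w) (ha : St X Y s a) (hx : X a < X w) : Y v ≤ Y a := by
  by_contra hc
  obtain ⟨⟨h1, h2⟩, h3⟩ := h
  have hd : dom X Y a v := by unfold dom at *; omega
  have := ha.1; have := hw.1
  rcases lt_trichotomy a w with h | h | h
  · exact h1.2 a h hd
  · subst h; omega
  · exact h3 a h (St_mono hw (by omega) (by omega)) (St_mono ha (by omega) (by omega)) hd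

lemma Vis_right (hY : Function.Injective Y) {v w s a : ℕ} (h : Vis X Y v w) (hw : St X Y s w) (ha : St X Y s a) (hx : X w < X a) : X v ≤ X a := by
  by_contra hc
  have hy := St_anti hY hw ha hx
  obtain ⟨⟨h1, h2⟩, h3⟩ := h
  have hd : dom X Y a v := by unfold dom at *; omega
  have := ha.1; have := hw.1
  rcases lt_trichotomy a w with h | h | h
  · exact h1.2 a h hd
  · subst h; omega
  · exact h3 a h (St_mono hw (by omega) (by omega)) (St_mono ha (by omega) (by omega)) hd

lemma exists_min (hX : Function.Injective X) (hY : Function.Injective Y) (t i : ℕ) (hi : i < t) : ∃ j, St X Y t j ∧ X j ≤ X i ∧ Y j ≤ Y i := by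
  induction' hn : X i using Nat.strong_induction_on with n ih generalizing i
  by_cases h : St X Y t i
  · exact ⟨i, h, by omega, by omega⟩
  · have : ∃ j < t, dom X Y j i := by
      by_contra hc
      push Not at hc
      exact h ⟨hi, hc⟩
    obtain ⟨j, hj, hd⟩ := this
    unfold dom at hd
    obtain ⟨k, hk, h1, h2⟩ := ih (X j) (by omega) j hj rfl
    exact ⟨k, hk, by omega, by omega⟩

lemma newer_nb (hX : Function.Injective X) (hY : Function.Injective Y) {v w t cx cy : ℕ} (hk : Kill X Y v w) (hv : ¬ Vis X Y v w) (hw : St X Y t w)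
    (hd : dom X Y t w) (hvx : X v < cx) (hvy : Y v < cy) :
    ∃ q, nb X Y t w q ∧ w < q ∧ X q < cx ∧ Y q < cy := by
  have : ∃ j, w < j ∧ St X Y (j+1) w ∧ St X Y (j+1) j ∧ dom X Y j v := by
    by_contra hc
    push Not at hc
    exact hv ⟨hk, hc⟩
  obtain ⟨j, hj, hjw, hjj, hjd⟩ := this
  have hjt : j < t := by
    by_contra hc
    exact hjw.2 t (by omega) hd
  obtain ⟨k, hkS, hk1, hk2⟩ := exists_min hX hY t j hjt
  have hne : X j ≠ X w := fun e => by have := hX e; omega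
  have hkd := hk.2
  unfold dom at hjd hkd
  have fin : ∀ a, St X Y t a → a ≠ w → dom X Y a v → (∀ q, St X Y t q → ¬ (X w < X q ∧ X q < X a) ∧ ¬ (X a < X q ∧ X q < X w)) →
     ∃ q, nb X Y t w q ∧ w < q ∧ X q < cx ∧ Y q < cy := by
    intro a ha hne hdd hq
    refine ⟨a, ⟨hw, ha, hne.symm, hq⟩, ?_, ?_, ?_⟩
    · by_contra hc
      exact hk.1.2 a (by omega) hdd
    · have := hdd.1; omega
    · have := hdd.2; omega
  rcases lt_or_gt_of_ne hne with h | h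
  · have hS : ((Finset.range t).filter (fun q => St X Y t q ∧ X q < X w)).Nonempty :=
      ⟨k, by simp only [Finset.mem_filter, Finset.mem_range]; exact ⟨hkS.1, hkS, by omega⟩⟩
    obtain ⟨a, ha, hmax⟩ := Finset.exists_max_image _ X hS
    simp only [Finset.mem_filter, Finset.mem_range] at ha hmax
    have h1 := hmax k ⟨hkS.1, hkS, by omega⟩
    have h2 : Y a ≤ Y k := by
      rcases Nat.eq_or_lt_of_le h1 with e | e
      · rw [hX e]
      · exact (St_anti hY hkS ha.2.1 e).le
    refine fin a ha.2.1 (fun e => by rw [e] at ha; omega) ⟨by omega, by omega⟩ (fun q hq => ⟨by omega, fun hc => ?_⟩)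
    have := hmax q ⟨hq.1, hq, hc.2⟩
    omega
  · have hkw : X w < X k := by
      by_contra hc
      have e : k ≠ w := by
        rintro rfl
        exact hjj.2 k (by omega) ⟨h, by
          have : Y k ≠ Y j := fun e => by have := hY e; omega
          omega⟩
      have h1 : X k < X w := by
        have : X k ≠ X w := fun h => e (hX h)
        omega
      have h2 := St_anti hY hkS hw h1
      have h3 := hjj.2 w (by omega)
      unfold dom at h3
      omega
    have hS : ((Finset.range t).filter (fun q => St X Y t q ∧ X w < X q)).Nonempty :=
      ⟨k, by simp only [Finset.mem_filter, Finset.mem_range]; exact ⟨hkS.1, hkS, by omega⟩⟩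
    obtain ⟨a, ha, hmax⟩ := Finset.exists_min_image _ X hS
    simp only [Finset.mem_filter, Finset.mem_range] at ha hmax
    have h1 := hmax k ⟨hkS.1, hkS, by omega⟩
    have h2 := St_anti hY hw ha.2.1 ha.2.2
    refine fin a ha.2.1 (fun e => by rw [e] at ha; omega) ⟨by omega, by omega⟩ (fun q hq => ⟨fun hc => ?_, by omega⟩)
    have := hmax q ⟨hq.1, hq, hc.1⟩
    omega


/-! process construction -/

lemma repair {s : ℕ} {τ : ℕ → Ty} {σ : ℕ → Option Bool} {p : ℕ} (hp : St X Y s p) (h : ¬ OK X Y s τ σ p) :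
    ∃ σ', Rep X Y s τ σ σ' ∧ (σ' p ≠ none ∨ ∃ q, nb X Y s p q ∧ p < q) := by
  unfold OK at h
  push Not at h
  obtain ⟨h0, h⟩ := h
  by_cases hN : τ p = Ty.N
  · have : ∃ c, ¬ Prot X Y s σ p c := by
      by_contra hc
      push Not at hc
      obtain ⟨c, hc1, _⟩ := h (fun _ => ⟨hc true, hc false⟩)
      rw [hN] at hc1
      cases hc1
    obtain ⟨c, hc⟩ := this
    refine ⟨Function.update σ p (some c), ⟨p, c, hp, h0, by rw [hN]; simp, ?_, ?_, rfl⟩, Or.inl (by simp)⟩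
    · intro q hq e
      exact hc ⟨q, hq, e⟩
    · intro d hd
      rw [hN] at hd
      cases hd
  · obtain ⟨c, hc, h1, h2⟩ := h (fun e => absurd e hN)
    by_cases hq : ∃ q, nb X Y s p q ∧ τ q = Ty.O c ∧ σ q = none ∧ p < q
    · obtain ⟨q, hq1, hq2, hq3, hq4⟩ := hq
      have h3 := h2 q hq1 hq2 hq3 hq4
      refine ⟨Function.update σ q (some (!c)), ⟨q, !c, hq1.2.1, hq3, by rw [hq2]; simp, ?_, ?_, rfl⟩, Or.inr ⟨q, hq1, hq4⟩⟩
      · intro q' hq' e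
        exact h3 ⟨q', hq', e⟩
      · intro d hd
        rw [hq2] at hd
        cases hd
        exact ⟨rfl, Or.inr ⟨p, nb_symm hq1, hc, h0, hq4⟩⟩
    · push Not at hq
      refine ⟨Function.update σ p (some (!c)), ⟨p, !c, hp, h0, by rw [hc]; simp, ?_, ?_, rfl⟩, Or.inl (by simp)⟩
      · intro q' hq' e
        exact h1 ⟨q', hq', e⟩
      · intro d hd
        rw [hc] at hd
        cases hd
        refine ⟨rfl, Or.inl ?_⟩
        intro q a b c
        have := hq q a b c
        have := a.2.2.1
        omega

lemma Rep_mono {s : ℕ} {τ : ℕ → Ty} {σ σ' : ℕ → Option Bool} (h : Rep X Y s τ σ σ') {i : ℕ} {c : Bool} (hi : σ i = some c) :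
    σ' i = some c := by
  obtain ⟨z, k, _, h0, _, _, _, rfl⟩ := h
  rw [Function.update_of_ne]
  · exact hi
  · rintro rfl
    rw [h0] at hi
    cases hi

lemma RTG_mono {s : ℕ} {τ : ℕ → Ty} {σ σ' : ℕ → Option Bool} (h : Relation.ReflTransGen (Rep X Y s τ) σ σ') {i : ℕ} {c : Bool} (hi : σ i = some c) :
    σ' i = some c := by
  induction h with
  | refl => exact hi
  | tail _ h ih => exact Rep_mono h ih

lemma closure (s : ℕ) (τ : ℕ → Ty) (σ : ℕ → Option Bool) :
    ∃ σ', Relation.ReflTransGen (Rep X Y s τ) σ σ' ∧ ∀ p, St X Y s p → OK X Y s τ σ' p := by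
  induction' hn : ((Finset.range s).filter (fun i => σ i = none)).card using Nat.strong_induction_on with n ih generalizing σ
  by_cases h : ∀ p, St X Y s p → OK X Y s τ σ p
  · exact ⟨σ, .refl, h⟩
  · push Not at h
    obtain ⟨p, hp, h⟩ := h
    obtain ⟨σ', h1, _⟩ := repair hp h
    have hlt : ((Finset.range s).filter (fun i => σ' i = none)).card < n := by
      rw [← hn]
      apply Finset.card_lt_card
      rw [Finset.ssubset_iff_of_subset]
      · obtain ⟨z, c, hz, h0, _, _, _, rfl⟩ := h1
        refine ⟨z, ?_, ?_⟩
        · simp only [Finset.mem_filter, Finset.mem_range]; exact ⟨hz.1, h0⟩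
        · simp
      · intro i hi
        simp only [Finset.mem_filter, Finset.mem_range] at hi ⊢
        refine ⟨hi.1, ?_⟩
        cases h2 : σ i with
        | none => rfl
        | some c => rw [Rep_mono h1 h2] at hi; cases hi.2
    obtain ⟨σ'', h3, h4⟩ := ih _ hlt σ' rfl
    exact ⟨σ'', .head h1 h3, h4⟩

lemma step (t : ℕ) (τ : ℕ → Ty) (σ : ℕ → Option Bool) :
    ∃ σ', Relation.ReflTransGen (Rep X Y (t+1) τ) σ σ' ∧ (∀ p, St X Y (t+1) p → OK X Y (t+1) τ σ' p) ∧
      (St X Y (t+1) t → OK X Y (t+1) τ σ t ∨ σ' t ≠ none) := by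
  by_cases h : St X Y (t+1) t ∧ ¬ OK X Y (t+1) τ σ t
  · obtain ⟨σ', h1, h2⟩ := repair h.1 h.2
    obtain ⟨σ'', h3, h4⟩ := closure (t+1) τ σ'
    refine ⟨σ'', .head h1 h3, h4, fun _ => Or.inr ?_⟩
    rcases h2 with h2 | ⟨q, hq, hq'⟩
    · obtain ⟨c, hc⟩ := Option.ne_none_iff_exists'.1 h2
      rw [RTG_mono h3 hc]
      simp
    · have := hq.2.1.1
      omega
  · obtain ⟨σ'', h3, h4⟩ := closure (t+1) τ σ
    refine ⟨σ'', h3, h4, fun h5 => Or.inl ?_⟩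
    by_contra hc
    exact h ⟨h5, hc⟩

/-- type of an arrival -/
def TySpec (X Y : ℕ → ℕ) (σ : ℕ → Option Bool) (w : ℕ) (T : Ty) : Prop :=
  (T = Ty.S → (∃ v, Vis X Y v w ∧ σ v = none) ∨ ((∃ v, Vis X Y v w ∧ σ v = some true) ∧ ∃ v, Vis X Y v w ∧ σ v = some false)) ∧
  (T = Ty.N → ∀ v, ¬ Vis X Y v w) ∧
  (∀ c, T = Ty.O c → (∃ v, Vis X Y v w) ∧ ∀ v, Vis X Y v w → σ v = some c)

lemma exists_ty (σ : ℕ → Option Bool) (w : ℕ) : ∃ T, TySpec X Y σ w T := by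
  by_cases h1 : ∃ v, Vis X Y v w
  · by_cases h2 : ∃ c, ∀ v, Vis X Y v w → σ v = some c
    · obtain ⟨c, hc⟩ := h2
      refine ⟨Ty.O c, by simp, by simp, ?_⟩
      intro d hd
      cases hd
      exact ⟨h1, hc⟩
    · refine ⟨Ty.S, fun _ => ?_, by simp, by simp⟩
      by_cases h3 : ∃ v, Vis X Y v w ∧ σ v = none
      · exact Or.inl h3
      · right
        push Not at h2 h3
        obtain ⟨v, hv, h4⟩ := h2 true
        obtain ⟨u, hu, h5⟩ := h2 false
        refine ⟨⟨u, hu, ?_⟩, ⟨v, hv, ?_⟩⟩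
        · have := h3 u hu
          revert this h5
          cases σ u with
          | none => simp
          | some c => cases c <;> simp
        · have := h3 v hv
          revert this h4
          cases σ v with
          | none => simp
          | some c => cases c <;> simp
  · refine ⟨Ty.N, by simp, fun _ v hv => h1 ⟨v, hv⟩, by simp⟩

lemma Rep_congr {s : ℕ} {τ τ' : ℕ → Ty} (h : ∀ i < s, τ i = τ' i) {σ σ' : ℕ → Option Bool} (hr : Rep X Y s τ σ σ') : Rep X Y s τ' σ σ' := by
  obtain ⟨z, c, h1, h2, h3, h4, h5, h6⟩ := hr
  refine ⟨z, c, h1, h2, by rwa [← h z h1.1], h4, ?_, h6⟩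
  intro d hd
  rw [← h z h1.1] at hd
  obtain ⟨h7, h8⟩ := h5 d hd
  refine ⟨h7, h8.imp ?_ ?_⟩
  · intro h8 q a b
    rw [← h q a.2.1.1] at b
    exact h8 q a b
  · rintro ⟨q, a, b, c⟩
    refine ⟨q, a, ?_, c⟩
    rwa [← h q a.2.1.1]

lemma OK_congr {s : ℕ} {τ τ' : ℕ → Ty} (h : ∀ i < s, τ i = τ' i) {σ : ℕ → Option Bool} {p : ℕ} (hp : p < s) (hr : OK X Y s τ σ p) : OK X Y s τ' σ p := by
  intro h0
  obtain ⟨h1, h2⟩ := hr h0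
  rw [h p hp] at h1 h2
  refine ⟨h1, fun c hc => (h2 c hc).imp id ?_⟩
  rintro ⟨q, a, b, c⟩
  refine ⟨q, a, ?_, c⟩
  rwa [← h q a.2.1.1]

structure Pr (X Y : ℕ → ℕ) (σ : ℕ → ℕ → Option Bool) (τ : ℕ → Ty) : Prop where
  init : ∀ i, σ 0 i = none
  p1 : ∀ t, Relation.ReflTransGen (Rep X Y (t+1) τ) (σ t) (σ (t+1))
  p2 : ∀ t p, St X Y t p → OK X Y t τ (σ t) p
  p4 : ∀ t, St X Y (t+1) t → OK X Y (t+1) τ (σ t) t ∨ σ (t+1) t ≠ none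
  p5 : ∀ t, TySpec X Y (σ t) t (τ t)

lemma exists_Pr (X Y : ℕ → ℕ) : ∃ σ τ, Pr X Y σ τ := by
  choose ty hty using @exists_ty X Y
  choose st hst using @step X Y
  let f : ℕ → (ℕ → Option Bool) × (ℕ → Ty) := fun t => Nat.rec (fun _ => none, fun _ => Ty.S)
    (fun t p => (st t (Function.update p.2 t (ty p.1 t)) p.1, Function.update p.2 t (ty p.1 t))) t
  have f1 : ∀ t, (f (t+1)).1 = st t (f (t+1)).2 (f t).1 := fun t => rfl
  have f2 : ∀ t, (f (t+1)).2 = Function.update (f t).2 t (ty (f t).1 t) := fun t => rfl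
  have f3 : ∀ s t i, i < s → s ≤ t → (f t).2 i = (f s).2 i := by
    intro s t i hi hst
    induction t, hst using Nat.le_induction with
    | base => rfl
    | succ t h ih => rw [f2, Function.update_of_ne (by omega), ih]
  have f4 : ∀ t i, i < t → (f t).2 i = (f (i+1)).2 i := fun t i hi => f3 (i+1) t i (by omega) (by omega)
  refine ⟨fun t => (f t).1, fun i => (f (i+1)).2 i, fun i => rfl, ?_, ?_, ?_, ?_⟩
  · intro t
    have := (hst t (f (t+1)).2 (f t).1).1
    rw [← f1] at this
    exact Relation.ReflTransGen.mono (fun a b h => Rep_congr (f4 _) h) _ _ this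
  · intro t p hp
    cases t with
    | zero => exact absurd hp.1 (by omega)
    | succ t =>
      have := (hst t (f (t+1)).2 (f t).1).2.1 p hp
      rw [← f1] at this
      exact OK_congr (f4 _) hp.1 this
  · intro t hp
    have := (hst t (f (t+1)).2 (f t).1).2.2 hp
    rw [← f1] at this
    exact this.imp (fun h => OK_congr (f4 _) hp.1 h) id
  · intro t
    have := hty (f t).1 t
    simp only [f2, Function.update_self]
    exact this

section
variable {σ : ℕ → ℕ → Option Bool} {τ : ℕ → Ty} (P : Pr X Y σ τ)
include P

lemma Pr.mono {s t : ℕ} (h : s ≤ t) {i : ℕ} {c : Bool} (hi : σ s i = some c) : σ t i = some c := by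
  induction t, h using Nat.le_induction with
  | base => exact hi
  | succ t h ih => exact RTG_mono (P.p1 t) ih

omit P in
lemma RTG_new {s : ℕ} {σ σ' : ℕ → Option Bool} (h : Relation.ReflTransGen (Rep X Y s τ) σ σ') {i : ℕ} (hi : ¬ St X Y s i) :
    σ' i = σ i := by
  induction h with
  | refl => rfl
  | tail _ h ih =>
    obtain ⟨z, k, hz, _, _, _, _, rfl⟩ := h
    rw [Function.update_of_ne]
    · exact ih
    · rintro rfl
      exact hi hz

lemma Pr.late {t i : ℕ} (h : t ≤ i) : σ t i = none := by
  induction t with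
  | zero => exact P.init i
  | succ t ih =>
    rw [RTG_new (P.p1 t), ih (by omega)]
    intro h'
    have := h'.1
    omega

lemma Pr.dead {s t i : ℕ} (h : s ≤ t) (hi : ∀ u, s < u → ¬ St X Y u i) : σ t i = σ s i := by
  induction t, h using Nat.le_induction with
  | base => rfl
  | succ t h ih => rw [RTG_new (P.p1 t) (hi _ (by omega)), ih]

lemma Pr.p3 (hX : Function.Injective X) (hY : Function.Injective Y) {t a b : ℕ} (h : nb X Y t a b) {c : Bool} (ha : σ t a = some c) : σ t b ≠ some c := by
  induction t generalizing a b c with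
  | zero => exact absurd h.1.1 (by omega)
  | succ t ih =>
    have h0 : ∀ a b c, nb X Y (t+1) a b → σ t a = some c → σ t b ≠ some c := by
      intro a b c h ha
      by_cases e1 : a = t
      · subst e1; rw [P.late le_rfl] at ha; cases ha
      by_cases e2 : b = t
      · subst e2; rw [P.late le_rfl]; simp
      · exact ih (nb_old hX hY h e1 e2) ha
    have key : ∀ σ', Relation.ReflTransGen (Rep X Y (t+1) τ) (σ t) σ' → ∀ a b c, nb X Y (t+1) a b → σ' a = some c → σ' b ≠ some c := by
      intro σ' h
      induction h with
      | refl => exact h0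
      | tail _ h ih =>
        obtain ⟨z, k, hz, hn, _, h4, _, rfl⟩ := h
        intro a b c hab
        by_cases e1 : a = z
        · subst e1
          rw [Function.update_self, Function.update_of_ne hab.2.2.1.symm]
          rintro h
          cases h
          exact h4 b hab
        · rw [Function.update_of_ne e1]
          by_cases e2 : b = z
          · subst e2
            rw [Function.update_self]
            intro h h'
            cases h'
            exact h4 a (nb_symm hab) h
          · rw [Function.update_of_ne e2]
            exact ih a b c hab
    exact key _ (P.p1 t) a b c h ha

lemma Pr.p6 {t p : ℕ} {c : Bool} (h : σ t p = some c) : τ p ≠ Ty.S ∧ ∀ d, τ p = Ty.O d → c = !d := by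
  induction t with
  | zero => rw [P.init] at h; cases h
  | succ t ih =>
    have key : ∀ σ', Relation.ReflTransGen (Rep X Y (t+1) τ) (σ t) σ' → σ' p = some c → τ p ≠ Ty.S ∧ ∀ d, τ p = Ty.O d → c = !d := by
      intro σ' h
      induction h with
      | refl => exact ih
      | tail _ h ih =>
        obtain ⟨z, k, hz, hn, h3, h4, h5, rfl⟩ := h
        by_cases e1 : p = z
        · subst e1
          rw [Function.update_self]
          rintro h
          cases h
          exact ⟨h3, fun d hd => (h5 d hd).1⟩
        · rw [Function.update_of_ne e1]
          exact ih
    exact key _ (P.p1 t) h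
end


/-! final coloring -/

def inW (X Y : ℕ → ℕ) (cx cy i : ℕ) : Prop := X i < cx ∧ Y i < cy

noncomputable def fin0 (X Y : ℕ → ℕ) (n : ℕ) (σ : ℕ → Option Bool) (i : ℕ) : Bool :=
  match σ i with
  | some c => c
  | none => if h : ∃ w, w < n ∧ i < w ∧ Kill X Y i w then !(fin0 X Y n σ h.choose) else true
termination_by n - i
decreasing_by
  have := h.choose_spec
  omega

lemma Kill_unique {i w w' : ℕ} (h : Kill X Y i w) (h' : Kill X Y i w') : w = w' := by
  rcases lt_trichotomy w w' with e | e | e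
  · exact absurd h.2 (h'.1.2 w e)
  · exact e
  · exact absurd h'.2 (h.1.2 w' e)

lemma fin0_some {n i : ℕ} {σ : ℕ → Option Bool} {c : Bool} (h : σ i = some c) : fin0 X Y n σ i = c := by
  rw [fin0, h]

lemma fin0_kill {n i w : ℕ} {σ : ℕ → Option Bool} (h : σ i = none) (hw : w < n) (hk : Kill X Y i w) :
    fin0 X Y n σ i = !(fin0 X Y n σ w) := by
  rw [fin0, h]
  have h1 : ∃ w, w < n ∧ i < w ∧ Kill X Y i w := ⟨w, hw, hk.1.1, hk⟩
  simp only [dif_pos h1]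
  rw [Kill_unique h1.choose_spec.2.2 hk]

structure Mn (X Y : ℕ → ℕ) (σ : ℕ → ℕ → Option Bool) (cx cy T : ℕ) (r : Bool) : Prop where
  m1 : ∀ t i c, t ≤ T → inW X Y cx cy i → σ t i = some c → c = r
  m2 : ∀ t i, t < T → inW X Y cx cy i → Kill X Y i t → σ t i = some r
  m3 : ∀ t, t < T → inW X Y cx cy t → St X Y (t+1) t

lemma exists_color (hX : Function.Injective X) (hY : Function.Injective Y)
    {σ : ℕ → ℕ → Option Bool} {τ : ℕ → Ty} (P : Pr X Y σ τ) (n : ℕ) :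
    ∃ col : ℕ → Bool, ∀ T ≤ n, ∀ cx cy r, (∀ i < T, inW X Y cx cy i → col i = r) → Mn X Y σ cx cy T r := by
  have hd : ∀ i, ¬ St X Y (i+1) i → ∃ j, St X Y i j ∧ dom X Y j i := by
    intro i hi
    have : ∃ j < i, dom X Y j i := by
      by_contra hc
      push Not at hc
      apply hi
      refine ⟨by omega, fun j hj => ?_⟩
      by_cases e : j = i
      · subst e; unfold dom; omega
      · exact hc j (by omega)
    obtain ⟨j, hj, hd⟩ := this
    obtain ⟨k, hk, h1, h2⟩ := exists_min hX hY i j hj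
    unfold dom at *
    exact ⟨k, hk, by omega, by omega⟩
  choose! d hd using hd
  let f := fin0 X Y n (σ n)
  refine ⟨fun i => if St X Y (i+1) i then f i else !(f (d i)), ?_⟩
  intro T hT cx cy r hmono
  have hf : ∀ i < T, inW X Y cx cy i → St X Y (i+1) i → f i = r := by
    intro i hi hw hs
    have := hmono i hi hw
    simpa [hs] using this
  have inWd : ∀ i j, inW X Y cx cy i → dom X Y j i → inW X Y cx cy j := by
    intro i j; unfold inW dom; omega
  refine ⟨?_, ?_, ?_⟩
  · intro t i c ht hi hc
    have hit : i < t := by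
      by_contra h
      rw [P.late (by omega)] at hc
      cases hc
    have hs : St X Y (i+1) i := by
      by_contra h
      have := P.dead (s := i) (t := t) (i := i) (by omega) (fun u hu hs => h (St_mono hs (by omega) (by omega)))
      rw [this, P.late le_rfl] at hc
      cases hc
    rw [← hf i (by omega) hi hs]
    exact (fin0_some (P.mono (by omega) hc)).symm
  · intro t i ht hi hk
    have hit := hk.1.1
    have hs : St X Y (i+1) i := St_mono hk.1 (by omega) (by omega)
    have h1 := hf i (by omega) hi hs
    have h2 := hf t ht (inWd _ _ hi hk.2) (Kill_St hk)
    cases h : σ t i with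
    | some c =>
      rw [← h1]
      congr 1
      exact (fin0_some (P.mono (by omega) h)).symm
    | none =>
      exfalso
      have h3 := P.dead (s := t) (t := n) (i := i) (by omega) (fun u hu hs => hs.2 t (by omega) hk.2)
      rw [h] at h3
      have := fin0_kill h3 (show t < n by omega) hk
      change f i = !(f t) at this
      rw [h1, h2] at this
      cases r <;> simp at this
  · intro t ht hi
    by_contra h
    obtain ⟨h1, h2⟩ := hd t h
    have h3 := hf (d t) (by have := h1.1; omega) (inWd _ _ hi h2) (St_mono h1 (by have := h1.1; omega) (by omega))
    have := hmono t ht hi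
    simp only [h, if_false, h3] at this
    cases r <;> simp at this

section
variable {σ : ℕ → ℕ → Option Bool} {τ : ℕ → Ty} {cx cy T : ℕ} {r : Bool}

def Q (τ : ℕ → Ty) (r : Bool) (p : ℕ) : Prop := τ p = Ty.S ∨ τ p = Ty.O r

def hh (X Y : ℕ → ℕ) (cx cy p : ℕ) : Prop := ∃ v, inW X Y cx cy v ∧ Kill X Y v p

lemma Q_unc (P : Pr X Y σ τ) (M : Mn X Y σ cx cy T r) {t p : ℕ} (ht : t ≤ T) (hp : inW X Y cx cy p) (hQ : Q τ r p) : σ t p = none := by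
  cases h : σ t p with
  | none => rfl
  | some c =>
    have h1 := M.m1 t p c ht hp h
    have h2 := P.p6 h
    rcases hQ with e | e
    · exact absurd e h2.1
    · have := h2.2 _ e
      rw [h1] at this
      cases r <;> simp at this

lemma die_nQ (P : Pr X Y σ τ) (M : Mn X Y σ cx cy T r) {t p : ℕ} (ht : t < T) (hp : inW X Y cx cy p) (hk : Kill X Y p t) : ¬ Q τ r p := by
  intro h
  have := Q_unc P M ht.le hp h
  rw [M.m2 t p ht hp hk] at this
  cases this

lemma F_death (hX : Function.Injective X) (hY : Function.Injective Y) (P : Pr X Y σ τ) (M : Mn X Y σ cx cy T r) {t p : ℕ} (ht : t < T) (hp : inW X Y cx cy p) (hk : Kill X Y p t)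
    (h : hh X Y cx cy p) : ∃ q, nb X Y t p q ∧ p < q ∧ inW X Y cx cy q := by
  obtain ⟨v, hv, hvk⟩ := h
  by_cases hvis : Vis X Y v p
  · exfalso
    have hpt := hk.1.1
    apply die_nQ P M ht hp hk
    have hc := M.m2 p v (by omega) hv hvk
    have h5 := P.p5 p
    cases e : τ p with
    | S => left; exact e
    | N => exact absurd hvis (h5.2.1 e v)
    | O c =>
      have := (h5.2.2 c e).2 v hvis
      rw [hc] at this
      cases this
      exact Or.inr e
  · obtain ⟨q, h1, h2, h3⟩ := newer_nb hX hY hvk hvis hk.1 hk.2 hv.1 hv.2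
    exact ⟨q, h1, h2, h3⟩

lemma two_nb (hX : Function.Injective X) {t p a b q : ℕ} (ha : nb X Y t p a) (hb : nb X Y t p b) (hab : a ≠ b) (hq : nb X Y t p q) : q = a ∨ q = b := by
  have e1 : X p ≠ X a := fun h => ha.2.2.1 (hX h)
  have e2 : X p ≠ X b := fun h => hb.2.2.1 (hX h)
  have e3 : X p ≠ X q := fun h => hq.2.2.1 (hX h)
  have e4 : X a ≠ X b := fun h => hab (hX h)
  by_contra hc
  push Not at hc
  have e5 : X q ≠ X a := fun h => hc.1 (hX h)
  have e6 : X q ≠ X b := fun h => hc.2 (hX h)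
  have h1 := ha.2.2.2 b hb.2.1
  have h2 := ha.2.2.2 q hq.2.1
  have h3 := hb.2.2.2 a ha.2.1
  have h4 := hb.2.2.2 q hq.2.1
  have h5 := hq.2.2.2 a ha.2.1
  have h6 := hq.2.2.2 b hb.2.1
  clear ha hb hq hc
  generalize X p = p at *
  generalize X q = q at *
  generalize X a = a at *
  generalize X b = b at *
  clear hX
  rcases lt_or_gt_of_ne e1 with f1 | f1 <;> rcases lt_or_gt_of_ne e2 with f2 | f2 <;> rcases lt_or_gt_of_ne e3 with f3 | f3
  · omega
  · omega
  · rcases lt_or_gt_of_ne e5 with f4 | f4 <;> omega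
  · rcases lt_or_gt_of_ne e6 with f4 | f4 <;> omega
  · rcases lt_or_gt_of_ne e6 with f4 | f4 <;> omega
  · rcases lt_or_gt_of_ne e5 with f4 | f4 <;> omega
  · omega
  · omega

/-- interior facts -/
lemma F_int (hX : Function.Injective X) (hY : Function.Injective Y) (P : Pr X Y σ τ) (M : Mn X Y σ cx cy T r) {t p a b : ℕ} (ht : t ≤ T)
    (ha : nb X Y t p a) (hb : nb X Y t p b) (hab : a ≠ b) (hp : inW X Y cx cy p) (haW : inW X Y cx cy a) (hbW : inW X Y cx cy b) :
    (τ p = Ty.N ∧ σ t p = some r) ∨ (τ p = Ty.O r ∧ ∃ q, (q = a ∨ q = b) ∧ p < q ∧ τ q = Ty.O r ∧ ∃ u, nb X Y t q u ∧ ¬ inW X Y cx cy u) := by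
  have hW : ∀ q, nb X Y t p q → inW X Y cx cy q := by
    intro q hq
    rcases two_nb hX ha hb hab hq with rfl | rfl <;> assumption
  have hpt := hp
  have hvW : ∀ v, Vis X Y v p → inW X Y cx cy v := by
    intro v hv
    have e1 : X p ≠ X a := fun h => ha.2.2.1 (hX h)
    have e2 : X p ≠ X b := fun h => hb.2.2.1 (hX h)
    have e4 : X a ≠ X b := fun h => hab (hX h)
    have h1 := ha.2.2.2 b hb.2.1
    have h3 := hb.2.2.2 a ha.2.1
    have hl := @Vis_left X Y v p t
    have hr := @Vis_right X Y hY v p t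
    rcases lt_or_gt_of_ne e1 with h | h
    · have := @hr a hv ha.1 ha.2.1 h
      have := @hl b hv ha.1 hb.2.1 (by omega)
      unfold inW at *
      omega
    · have := @hl a hv ha.1 ha.2.1 h
      have := @hr b hv ha.1 hb.2.1 (by omega)
      unfold inW at *
      omega
  have hvr : ∀ v, Vis X Y v p → σ p v = some r := fun v hv =>
    M.m2 p v (by have := ha.1.1; omega) (hvW v hv) hv.1
  have h5 := P.p5 p
  have hrr : ∀ q, nb X Y t p q → σ t q ≠ some (!r) := by
    intro q hq h
    have := M.m1 t q _ ht (hW q hq) h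
    cases r <;> simp at this
  have hOK := P.p2 t p ha.1
  cases e : τ p with
  | S =>
    exfalso
    rcases h5.1 e with ⟨v, hv, h⟩ | ⟨⟨v, hv, h⟩, ⟨u, hu, h'⟩⟩
    · rw [hvr v hv] at h; cases h
    · rw [hvr v hv] at h; rw [hvr u hu] at h'; cases h; cases h'
  | N =>
    left
    refine ⟨rfl, ?_⟩
    cases h : σ t p with
    | some c => rw [M.m1 t p c ht hp h]
    | none =>
      exfalso
      have := (hOK h).1 e
      cases r
      · obtain ⟨q, hq, h'⟩ := this.1
        exact hrr q hq h'
      · obtain ⟨q, hq, h'⟩ := this.2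
        exact hrr q hq h'
  | O c =>
    right
    obtain ⟨⟨v, hv⟩, h6⟩ := h5.2.2 c e
    have h7 := h6 v hv
    rw [hvr v hv] at h7
    cases h7
    refine ⟨rfl, ?_⟩
    have hn := Q_unc P M ht hp (Or.inr e)
    rcases (hOK hn).2 _ e with ⟨q, hq, h⟩ | ⟨q, h1, h2, h3, h4, ⟨u, hu, hu'⟩⟩
    · exact absurd h (hrr q hq)
    · refine ⟨q, two_nb hX ha hb hab h1, h4, h2, u, hu, fun huW => ?_⟩
      have := M.m1 t u _ ht huW hu'
      cases r <;> simp at this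

/-- a word neighbour of a dying point is uncolored -/
lemma adj_unc (hX : Function.Injective X) (hY : Function.Injective Y) (P : Pr X Y σ τ) (M : Mn X Y σ cx cy T r) {t p a : ℕ} (ht : t ≤ T)
    (ha : nb X Y t p a) (haW : inW X Y cx cy a) (hc : σ t p = some r) : σ t a = none := by
  cases h : σ t a with
  | none => rfl
  | some c =>
    rw [M.m1 t a c ht haW h] at h
    exact absurd h (P.p3 hX hY ha hc)
end


/-! words -/

def Word (X Y : ℕ → ℕ) (cx cy t : ℕ) (l : List ℕ) : Prop :=
  (∀ p, p ∈ l ↔ St X Y t p ∧ inW X Y cx cy p) ∧ (l.Pairwise (fun a b => X a < X b) ∨ l.Pairwise (fun a b => X b < X a))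

section
variable {σ : ℕ → ℕ → Option Bool} {τ : ℕ → Ty} {cx cy T : ℕ} {r : Bool}

lemma Word.rev {t : ℕ} {l : List ℕ} (h : Word X Y cx cy t l) : Word X Y cx cy t l.reverse := by
  refine ⟨fun p => by rw [List.mem_reverse]; exact h.1 p, ?_⟩
  rw [List.pairwise_reverse, List.pairwise_reverse]
  exact h.2.symm

lemma Word.inW {t : ℕ} {l : List ℕ} (h : Word X Y cx cy t l) {p : ℕ} (hp : p ∈ l) : inW X Y cx cy p := ((h.1 p).1 hp).2
lemma Word.St {t : ℕ} {l : List ℕ} (h : Word X Y cx cy t l) {p : ℕ} (hp : p ∈ l) : St X Y t p := ((h.1 p).1 hp).1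

lemma Word.nb (hY : Function.Injective Y) {t a b : ℕ} (l1 l2 : List ℕ) (h : Word X Y cx cy t (l1 ++ a :: b :: l2)) : nb X Y t a b := by
  have haS := h.St (p := a) (by simp)
  have hbS := h.St (p := b) (by simp)
  have haW := h.inW (p := a) (by simp)
  have hbW := h.inW (p := b) (by simp)
  have hm : ∀ q, Oct.St X Y t q → Oct.inW X Y cx cy q → q ∈ l1 ∨ q = a ∨ q = b ∨ q ∈ l2 := by
    intro q h1 h2
    have := (h.1 q).2 ⟨h1, h2⟩
    simpa using this
  rcases h.2 with hp | hp
  · rw [List.pairwise_append] at hp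
    obtain ⟨_, h2, h3⟩ := hp
    rw [List.pairwise_cons, List.pairwise_cons] at h2
    have hab := h2.1 b (by simp)
    refine ⟨haS, hbS, fun e => by rw [e] at hab; omega, fun q hq => ⟨fun hc => ?_, by omega⟩⟩
    have hy := St_anti hY haS hq hc.1
    unfold Oct.inW at *
    rcases hm q hq ⟨by omega, by omega⟩ with e | e | e | e
    · have := h3 q e a (by simp); omega
    · rw [e] at hc; omega
    · rw [e] at hc; omega
    · have := h2.2.1 q e; omega
  · rw [List.pairwise_append] at hp
    obtain ⟨_, h2, h3⟩ := hp
    rw [List.pairwise_cons, List.pairwise_cons] at h2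
    have hab := h2.1 b (by simp)
    refine ⟨haS, hbS, fun e => by rw [e] at hab; omega, fun q hq => ⟨by omega, fun hc => ?_⟩⟩
    have hy := St_anti hY hbS hq hc.1
    unfold Oct.inW at *
    rcases hm q hq ⟨by omega, by omega⟩ with e | e | e | e
    · have := h3 q e a (by simp); omega
    · rw [e] at hc; omega
    · rw [e] at hc; omega
    · have := h2.2.1 q e; omega

lemma Word.end_nb {t a b q : ℕ} {l2 : List ℕ} (h : Word X Y cx cy t (a :: b :: l2)) (hq : Oct.nb X Y t a q) (hqW : Oct.inW X Y cx cy q) : q = b := by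
  have hbS := h.St (p := b) (by simp)
  have h1 := (h.1 q).2 ⟨hq.2.1, hqW⟩
  have h2 := hq.2.2.2 b hbS
  simp only [List.mem_cons] at h1
  rcases h1 with e | e | e
  · exact absurd e.symm hq.2.2.1
  · exact e
  · exfalso
    rcases h.2 with hp | hp <;> rw [List.pairwise_cons, List.pairwise_cons] at hp
    · have := hp.1 b (by simp)
      have := hp.2.1 q e
      omega
    · have := hp.1 b (by simp)
      have := hp.2.1 q e
      omega

lemma Word.ne {t a b c : ℕ} {l1 l2 : List ℕ} (h : Word X Y cx cy t (l1 ++ a :: b :: c :: l2)) : a ≠ c := by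
  rcases h.2 with hp | hp <;>
  · rw [List.pairwise_append] at hp
    have hp := hp.2.1
    rw [List.pairwise_cons] at hp
    have := hp.1 c (by simp)
    rintro rfl
    omega

lemma Word.out {t : ℕ} {l : List ℕ} (h : Word X Y cx cy t l) (ht : ¬ Oct.inW X Y cx cy t) : Word X Y cx cy (t+1) l := by
  refine ⟨fun p => ?_, h.2⟩
  rw [h.1 p]
  constructor
  · rintro ⟨h1, h2⟩
    refine ⟨?_, h2⟩
    by_contra hc
    have := (St_die h1 hc).2
    apply ht
    unfold Oct.inW dom at *
    omega
  · rintro ⟨h1, h2⟩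
    refine ⟨St_mono h1 (by omega) ?_, h2⟩
    have := h1.1
    have : p ≠ t := by rintro rfl; exact ht h2
    omega

lemma split_at (x : ℕ) : ∀ l : List ℕ, l.Pairwise (fun a b => X a < X b) → (∀ p ∈ l, X p ≠ x) →
    ∃ l1 l2, l = l1 ++ l2 ∧ (∀ p ∈ l1, X p < x) ∧ ∀ p ∈ l2, x < X p
  | [], _, _ => ⟨[], [], rfl, by simp, by simp⟩
  | a :: l, h, hx => by
    rw [List.pairwise_cons] at h
    have ha := hx a (by simp)
    by_cases hlt : X a < x
    · obtain ⟨l1, l2, h1, h2, h3⟩ := split_at x l h.2 (fun p hp => hx p (by simp [hp]))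
      refine ⟨a :: l1, l2, by simp [h1], ?_, h3⟩
      intro p hp
      simp only [List.mem_cons] at hp
      rcases hp with rfl | hp
      · exact hlt
      · exact h2 p hp
    · refine ⟨[], a :: l, rfl, by simp, ?_⟩
      intro p hp
      simp only [List.mem_cons] at hp
      rcases hp with rfl | hp
      · omega
      · have := h.1 p hp
        omega

def Tr (X Y : ℕ → ℕ) (cx cy t : ℕ) (l : List ℕ) : Prop :=
  (∃ l1 l2, l = l1 ++ l2 ∧ Word X Y cx cy (t+1) (l1 ++ t :: l2)) ∨
  (∃ l1 v l2, l = l1 ++ v :: l2 ∧ Kill X Y v t ∧ Word X Y cx cy (t+1) (l1 ++ t :: l2))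

lemma Tr.rev {t : ℕ} {l : List ℕ} (h : Tr X Y cx cy t l) : Tr X Y cx cy t l.reverse := by
  rcases h with ⟨l1, l2, rfl, h⟩ | ⟨l1, v, l2, rfl, hk, h⟩
  · left
    refine ⟨l2.reverse, l1.reverse, by simp, ?_⟩
    simpa using h.rev
  · right
    refine ⟨l2.reverse, v, l1.reverse, by simp, hk, ?_⟩
    simpa using h.rev

lemma trans_inc (hX : Function.Injective X) (hY : Function.Injective Y) (P : Pr X Y σ τ) (M : Mn X Y σ cx cy T r) {t : ℕ} {l : List ℕ}
    (ht : t < T) (hW : inW X Y cx cy t) (h : Word X Y cx cy t l) (hl : l.Pairwise (fun a b => X a < X b)) : Tr X Y cx cy t l := by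
  have htS := M.m3 t ht hW
  have hne : ∀ p ∈ l, X p ≠ X t := by
    intro p hp e
    have := (h.St hp).1
    have := hX e
    omega
  obtain ⟨l1, l2, rfl, h1, h2⟩ := split_at (X t) l hl hne
  have hkill : ∀ p ∈ l1 ++ l2, ¬ St X Y (t+1) p → p ∈ l2 ∧ dom X Y t p := by
    intro p hp hc
    have hd := (St_die (h.St hp) hc).2
    refine ⟨?_, hd⟩
    rw [List.mem_append] at hp
    rcases hp with hp | hp
    · have := h1 p hp
      have := hd.1
      omega
    · exact hp
  have memnew : ∀ p, St X Y (t+1) p ∧ inW X Y cx cy p ↔ p = t ∨ (p ∈ l1 ++ l2 ∧ St X Y (t+1) p) := by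
    intro p
    constructor
    · rintro ⟨a, b⟩
      by_cases e : p = t
      · exact Or.inl e
      · right
        refine ⟨(h.1 p).2 ⟨St_mono a (by omega) (by have := a.1; omega), b⟩, a⟩
    · rintro (rfl | ⟨a, b⟩)
      · exact ⟨htS, hW⟩
      · exact ⟨b, h.inW a⟩
  have hl' := hl
  rw [List.pairwise_append] at hl'
  obtain ⟨s1, s2, s3⟩ := hl'
  by_cases hk : ∃ v ∈ l1 ++ l2, ¬ St X Y (t+1) v
  · obtain ⟨v, hv, hvk⟩ := hk
    obtain ⟨hv2, hvd⟩ := hkill v hv hvk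
    right
    cases l2 with
    | nil => simp at hv2
    | cons u l2 =>
      have hd1 : ∀ a b, St X Y t a → St X Y t b → X t < X a → X a < X b → dom X Y t b → dom X Y t a := by
        intro a b ha hb h1 h2 h3
        have := St_anti hY ha hb h2
        unfold dom at *
        omega
      have hu : Kill X Y u t := by
        refine ⟨h.St (by simp), ?_⟩
        by_cases e : v = u
        · rw [← e]; exact hvd
        · rw [List.pairwise_cons] at s2
          refine hd1 u v (h.St (by simp)) (h.St hv) (h2 u (by simp)) (s2.1 v ?_) hvd
          simpa [e] using hv2
      refine ⟨l1, u, l2, rfl, hu, ?_, Or.inl ?_⟩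
      · intro p
        rw [memnew]
        have hnu : ¬ St X Y (t+1) u := fun hc => hc.2 t (by omega) hu.2
        have hrest : ∀ p ∈ l2, St X Y (t+1) p := by
          intro p hp
          by_contra hc
          obtain ⟨_, hpd⟩ := hkill p (by simp [hp]) hc
          cases l2 with
          | nil => simp at hp
          | cons u' l3 =>
            have hu' : Kill X Y u' t := by
              refine ⟨h.St (by simp), ?_⟩
              by_cases e : p = u'
              · rw [← e]; exact hpd
              · rw [List.pairwise_cons, List.pairwise_cons] at s2
                refine hd1 u' p (h.St (by simp)) (h.St (by simp [hp])) (h2 u' (by simp)) (s2.2.1 p ?_) hpd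
                simpa [e] using hp
            have hn : nb X Y t u u' := h.nb hY l1 l3
            exact P.p3 hX hY hn (M.m2 t u ht (h.inW (by simp)) hu) (M.m2 t u' ht (h.inW (by simp)) hu')
        have hrest1 : ∀ p ∈ l1, St X Y (t+1) p := by
          intro p hp
          by_contra hc
          obtain ⟨hp2, hpd⟩ := hkill p (by simp [hp]) hc
          have := h1 p hp
          have := h2 p hp2
          omega
        simp only [List.mem_append, List.mem_cons]
        constructor
        · rintro (a | a | a)
          · exact Or.inr ⟨Or.inl a, hrest1 p a⟩
          · exact Or.inl a
          · exact Or.inr ⟨Or.inr (Or.inr a), hrest p a⟩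
        · rintro (a | ⟨a | a | a, b⟩)
          · exact Or.inr (Or.inl a)
          · exact Or.inl a
          · rw [a] at b; exact absurd b hnu
          · exact Or.inr (Or.inr a)
      · rw [List.pairwise_cons] at s2
        rw [List.pairwise_append, List.pairwise_cons]
        refine ⟨s1, ⟨fun p hp => h2 p (by simp [hp]), s2.2⟩, ?_⟩
        intro a ha b hb
        simp only [List.mem_cons] at hb
        rcases hb with rfl | hb
        · exact h1 a ha
        · exact s3 a ha b (by simp [hb])
  · push Not at hk
    left
    refine ⟨l1, l2, rfl, ?_, Or.inl ?_⟩
    · intro p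
      rw [memnew]
      have := hk p
      simp only [List.mem_append, List.mem_cons] at *
      tauto
    · rw [List.pairwise_append, List.pairwise_cons]
      refine ⟨s1, ⟨h2, s2⟩, ?_⟩
      intro a ha b hb
      simp only [List.mem_cons] at hb
      rcases hb with rfl | hb
      · exact h1 a ha
      · exact s3 a ha b hb

lemma trans (hX : Function.Injective X) (hY : Function.Injective Y) (P : Pr X Y σ τ) (M : Mn X Y σ cx cy T r) {t : ℕ} {l : List ℕ}
    (ht : t < T) (hW : inW X Y cx cy t) (h : Word X Y cx cy t l) : Tr X Y cx cy t l := by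
  rcases h.2 with hl | hl
  · exact trans_inc hX hY P M ht hW h hl
  · have := trans_inc hX hY P M ht hW h.rev (by rw [List.pairwise_reverse]; exact hl)
    simpa using this.rev
end


/-! invariant -/

noncomputable def cnt (X Y : ℕ → ℕ) (cx cy t : ℕ) : ℕ := ((Finset.range t).filter (fun i => inW X Y cx cy i)).card

lemma cnt_in {cx cy t : ℕ} (h : inW X Y cx cy t) : cnt X Y cx cy (t+1) = cnt X Y cx cy t + 1 := by
  unfold cnt
  rw [Finset.range_add_one, Finset.filter_insert, if_pos h, Finset.card_insert_of_notMem (by simp)]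

lemma cnt_out {cx cy t : ℕ} (h : ¬ inW X Y cx cy t) : cnt X Y cx cy (t+1) = cnt X Y cx cy t := by
  unfold cnt
  rw [Finset.range_add_one, Finset.filter_insert, if_neg h]

def Pz (X Y : ℕ → ℕ) (σ : ℕ → ℕ → Option Bool) (r : Bool) (t a b : ℕ) : Prop :=
  ∀ p, nb X Y t a p → p = b ∨ σ t p = some r ∨ a < p

def A1 (X Y : ℕ → ℕ) (σ : ℕ → ℕ → Option Bool) (τ : ℕ → Ty) (r : Bool) (t a b : ℕ) : Prop :=
  Q τ r a ∨ σ t a = some r ∨ (τ a = Ty.O (!r) ∧ σ t a = none ∧ Pz X Y σ r t a b)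

def A2 (X Y : ℕ → ℕ) (σ : ℕ → ℕ → Option Bool) (τ : ℕ → Ty) (r : Bool) (t a b : ℕ) : Prop :=
  Q τ r b ∨ σ t b = some r ∨ Q τ r a ∨ (τ a = Ty.O (!r) ∧ τ b = Ty.O (!r) ∧ σ t a = none ∧ Pz X Y σ r t a b)

def J1 (X Y : ℕ → ℕ) (cx cy t a : ℕ) : Prop := cnt X Y cx cy t ≤ 1 ∨ (cnt X Y cx cy t ≤ 2 ∧ hh X Y cx cy a)

def J2 (X Y : ℕ → ℕ) (σ : ℕ → ℕ → Option Bool) (τ : ℕ → Ty) (r : Bool) (cx cy t a b : ℕ) : Prop :=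
  cnt X Y cx cy t ≤ 3 ∨
  (cnt X Y cx cy t ≤ 4 ∧ hh X Y cx cy a ∧ b < a ∧ A1 X Y σ τ r t a b) ∨
  (cnt X Y cx cy t ≤ 5 ∧ hh X Y cx cy a ∧ hh X Y cx cy b ∧ a < b ∧ A2 X Y σ τ r t a b) ∨
  (cnt X Y cx cy t ≤ 6 ∧ Q τ r b ∧ hh X Y cx cy a ∧ b < a)

def J3 (X Y : ℕ → ℕ) (τ : ℕ → Ty) (r : Bool) (cx cy t a m b : ℕ) : Prop :=
  cnt X Y cx cy t ≤ 7 ∨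
  (cnt X Y cx cy t ≤ 8 ∧ ((hh X Y cx cy m ∧ a < m ∧ b < m ∧ τ m = Ty.N) ∨
    (τ m = Ty.O r ∧ hh X Y cx cy a ∧ m < a ∧ Q τ r b)))

def J4 (X Y : ℕ → ℕ) (τ : ℕ → Ty) (cx cy t a m1 m2 : ℕ) : Prop :=
  cnt X Y cx cy t ≤ 9 ∨ (cnt X Y cx cy t ≤ 10 ∧ hh X Y cx cy m1 ∧ a < m1 ∧ m2 < m1 ∧ τ m1 = Ty.N)

def J5 (X Y : ℕ → ℕ) (cx cy t m1 m2 m3 : ℕ) : Prop :=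
  cnt X Y cx cy t ≤ 10 ∨ (cnt X Y cx cy t ≤ 11 ∧ hh X Y cx cy m2 ∧ m1 < m2 ∧ m3 < m2)

def J (X Y : ℕ → ℕ) (σ : ℕ → ℕ → Option Bool) (τ : ℕ → Ty) (r : Bool) (cx cy t : ℕ) : Prop :=
  (Word X Y cx cy t [] ∧ cnt X Y cx cy t = 0) ∨
  (∃ a, Word X Y cx cy t [a] ∧ J1 X Y cx cy t a) ∨
  (∃ a b, Word X Y cx cy t [a, b] ∧ J2 X Y σ τ r cx cy t a b) ∨
  (∃ a m b, Word X Y cx cy t [a, m, b] ∧ J3 X Y τ r cx cy t a m b) ∨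
  (∃ a m1 m2 b, Word X Y cx cy t [a, m1, m2, b] ∧ J4 X Y τ cx cy t a m1 m2) ∨
  (∃ a m1 m2 m3 b, Word X Y cx cy t [a, m1, m2, m3, b] ∧ J5 X Y cx cy t m1 m2 m3)

section
variable {σ : ℕ → ℕ → Option Bool} {τ : ℕ → Ty} {cx cy T : ℕ} {r : Bool}

lemma micro {s a b : ℕ} {σ0 σ' : ℕ → Option Bool} (h : Relation.ReflTransGen (Rep X Y s τ) σ0 σ') (hab : nb X Y s a b) (hlt : a < b)
    (ha : τ a = Ty.O (!r)) (hb : τ b = Ty.O (!r)) (hp : ∀ p, nb X Y s a p → p = b ∨ σ0 p = some r ∨ a < p) (h0 : σ0 a = none) :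
    σ' a = none ∨ σ' b ≠ none := by
  induction h with
  | refl => exact Or.inl h0
  | tail h1 h2 ih =>
    rename_i σ1 σ2
    have h2' := h2
    obtain ⟨z, c, hz, hn, _, _, h5, rfl⟩ := h2
    by_cases hbn : σ1 b = none
    · by_cases e : z = a
      · subst e
        exfalso
        rcases (h5 _ ha).2 with h6 | ⟨q, hq1, hq2, hq3, hq4⟩
        · have := h6 b hab hb hbn
          omega
        · rcases hp q hq1 with rfl | hh | hh
          · omega
          · rw [RTG_mono h1 hh] at hq3; cases hq3
          · omega
      · left
        rw [Function.update_of_ne (Ne.symm e)]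
        exact ih.resolve_right (fun h => h hbn)
    · right
      obtain ⟨c, hc⟩ := Option.ne_none_iff_exists'.1 hbn
      rw [Rep_mono h2' hc]
      simp

lemma Pz_step (hX : Function.Injective X) (hY : Function.Injective Y) (P : Pr X Y σ τ) {t a b b' : ℕ} (hat : a < t) (h : Pz X Y σ r t a b)
    (hb : b = b' ∨ ¬ St X Y (t+1) b) : ∀ p, nb X Y (t+1) a p → p = b' ∨ σ t p = some r ∨ a < p := by
  intro p hp
  by_cases e : p = t
  · right; right; omega
  · rcases h p (nb_old hX hY hp (by omega) e) with rfl | h | h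
    · rcases hb with rfl | hb
      · exact Or.inl rfl
      · exact absurd hp.2.1 hb
    · exact Or.inr (Or.inl h)
    · exact Or.inr (Or.inr h)

variable (hX : Function.Injective X) (hY : Function.Injective Y) (P : Pr X Y σ τ) (M : Mn X Y σ cx cy T r)
include hX hY P M

lemma some_r {t p : ℕ} (ht : t ≤ T) (hp : inW X Y cx cy p) (h : σ t p ≠ none) : σ t p = some r := by
  obtain ⟨c, hc⟩ := Option.ne_none_iff_exists'.1 h
  rw [hc, M.m1 t p c ht hp hc]

lemma A1_step {t a b : ℕ} (ht : t < T) (hat : a < t) (haW : inW X Y cx cy a) (h : A1 X Y σ τ r t a b) : A1 X Y σ τ r (t+1) a b := by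
  rcases h with h | h | ⟨h1, h2, h3⟩
  · exact Or.inl h
  · exact Or.inr (Or.inl (P.mono (by omega) h))
  · by_cases e : σ (t+1) a = none
    · refine Or.inr (Or.inr ⟨h1, e, fun p hp => ?_⟩)
      exact (Pz_step hX hY P hat h3 (Or.inl rfl) p hp).imp id (Or.imp (P.mono (by omega)) id)
    · exact Or.inr (Or.inl (some_r hX hY P M (by omega) haW e))

lemma A2_of {t a b b' : ℕ} (ht : t < T) (hat : a < t) (hbW : inW X Y cx cy b') (hn : nb X Y (t+1) a b') (hlt : a < b')
    (h1 : τ a = Ty.O (!r)) (h1b : τ b' = Ty.O (!r)) (h2 : σ t a = none) (h3 : Pz X Y σ r t a b) (hb : b = b' ∨ ¬ St X Y (t+1) b) :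
    A2 X Y σ τ r (t+1) a b' := by
  have h4 := Pz_step hX hY P hat h3 hb
  rcases micro (P.p1 t) hn hlt h1 h1b h4 h2 with e | e
  · refine Or.inr (Or.inr (Or.inr ⟨h1, h1b, e, fun p hp => ?_⟩))
    exact (h4 p hp).imp id (Or.imp (P.mono (by omega)) id)
  · exact Or.inr (Or.inl (some_r hX hY P M (by omega) hbW e))

/-- killer in a word of length two -/
lemma killer2 {t a b : ℕ} (ht : t < T) (hW : inW X Y cx cy t) (h : Word X Y cx cy t [a, b]) (hk : Kill X Y a t)
    (h' : Word X Y cx cy (t+1) [t, b]) : A1 X Y σ τ r (t+1) t b := by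
  have hb : σ t b = none := adj_unc hX hY P M ht.le (h.nb hY [] []) (h.inW (by simp)) (M.m2 t a ht (h.inW (by simp)) hk)
  have hn : nb X Y (t+1) t b := h'.nb hY [] []
  by_cases hc : σ (t+1) t = none
  · have hOK := (P.p4 t hn.1).resolve_right (fun e => e hc)
    obtain ⟨h1, h2⟩ := hOK (P.late le_rfl)
    cases e : τ t with
    | S => exact Or.inl (Or.inl e)
    | N =>
      exfalso
      obtain ⟨⟨q1, hq1, e1⟩, ⟨q2, hq2, e2⟩⟩ := h1 e
      have n1 : q1 ≠ b := by rintro rfl; rw [hb] at e1; cases e1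
      have n2 : q2 ≠ b := by rintro rfl; rw [hb] at e2; cases e2
      rcases two_nb hX hn hq1 n1.symm hq2 with h | h
      · exact n2 h
      · rw [h, e1] at e2; cases e2
    | O c =>
      by_cases ec : c = r
      · subst ec; exact Or.inl (Or.inr e)
      · have ec' : c = !r := by cases c <;> cases r <;> simp_all
        subst ec'
        refine Or.inr (Or.inr ⟨e, hc, ?_⟩)
        rcases h2 _ e with ⟨q, hq, hq'⟩ | ⟨q, hq, _, _, hlt, _⟩
        · intro p hp
          have n1 : q ≠ b := by rintro rfl; rw [hb] at hq'; cases hq'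
          rcases two_nb hX hn hq n1.symm hp with h | h
          · exact Or.inl h
          · right; left
            subst h
            simp only [Bool.not_not] at hq'
            exact P.mono (by omega) hq'
        · have := hq.2.1.1
          omega
  · exact Or.inr (Or.inl (some_r hX hY P M (by omega) hW hc))

/-- end of a word with no newer neighbour and `hh` cannot die -/
lemma end_frozen {t a b : ℕ} {l : List ℕ} (ht : t < T) (h : Word X Y cx cy t (a :: b :: l)) (hk : Kill X Y a t) (hh' : hh X Y cx cy a) (hlt : b < a) : False := by
  obtain ⟨q, h1, h2, h3⟩ := F_death hX hY P M ht (h.inW (by simp)) hk hh'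
  have := h.end_nb h1 h3
  omega

lemma int_frozen {t a m b : ℕ} {l1 l : List ℕ} (ht : t < T) (h : Word X Y cx cy t (l1 ++ a :: m :: b :: l)) (hk : Kill X Y m t) (hh' : hh X Y cx cy m) (h1 : a < m) (h2 : b < m) : False := by
  obtain ⟨q, h3, h4, _⟩ := F_death hX hY P M ht (h.inW (by simp)) hk hh'
  have n1 : nb X Y t a m := h.nb hY l1 (b :: l)
  have n2 : nb X Y t m b := Word.nb hY (l1 ++ [a]) l (by simpa using h)
  rcases two_nb hX (nb_symm n1) n2 h.ne h3 with rfl | rfl <;> omega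

lemma W_int {t a m b : ℕ} (l1 l : List ℕ) (ht : t ≤ T) (h : Word X Y cx cy t (l1 ++ a :: m :: b :: l)) :
    ((τ m = Ty.N ∧ σ t m = some r) ∨ (τ m = Ty.O r ∧ ∃ q, (q = a ∨ q = b) ∧ m < q ∧ τ q = Ty.O r ∧ ∃ u, nb X Y t q u ∧ ¬ inW X Y cx cy u))
    ∧ ∀ u, nb X Y t m u → inW X Y cx cy u := by
  have n1 : nb X Y t a m := h.nb hY l1 (b :: l)
  have n2 : nb X Y t m b := Word.nb hY (l1 ++ [a]) l (by simpa using h)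
  refine ⟨F_int hX hY P M ht (nb_symm n1) n2 h.ne (h.inW (by simp)) (h.inW (by simp)) (h.inW (by simp)), fun u hu => ?_⟩
  rcases two_nb hX (nb_symm n1) n2 h.ne hu with rfl | rfl
  · exact h.inW (by simp)
  · exact h.inW (by simp)

lemma W_new {t a b : ℕ} (l1 l : List ℕ) (ht : t < T) (h : Word X Y cx cy (t+1) (l1 ++ a :: t :: b :: l)) :
    τ t = Ty.N ∧ a < t ∧ b < t := by
  have ha : a < t := by
    have := (h.St (p := a) (by simp)).1
    have := (h.nb hY l1 (b :: l)).2.2.1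
    omega
  have hb : b < t := by
    have := (h.St (p := b) (by simp)).1
    have := (Word.nb hY (l1 ++ [a]) l (a := t) (b := b) (cx := cx) (cy := cy) (by simpa using h)).2.2.1
    omega
  refine ⟨?_, ha, hb⟩
  rcases (W_int hX hY P M l1 l (by omega) h).1 with h1 | ⟨_, q, hq, hlt, _⟩
  · exact h1.1
  · rcases hq with rfl | rfl <;> omega

lemma struct3 {t a m b : ℕ} (ht : t ≤ T) (h : Word X Y cx cy t [a, m, b]) :
    (τ m = Ty.N ∧ σ t m = some r) ∨ (τ m = Ty.O r ∧ ((Q τ r a ∧ m < a) ∨ (Q τ r b ∧ m < b))) := by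
  refine (W_int hX hY P M [] [] ht h).1.imp id ?_
  rintro ⟨h1, q, hq, hlt, hO, _⟩
  refine ⟨h1, ?_⟩
  rcases hq with rfl | rfl
  · exact Or.inl ⟨Or.inr hO, hlt⟩
  · exact Or.inr ⟨Or.inr hO, hlt⟩

lemma struct4 {t a m1 m2 b : ℕ} (ht : t ≤ T) (h : Word X Y cx cy t [a, m1, m2, b]) :
    (τ m1 = Ty.O r ∧ τ m2 = Ty.O r ∧ Q τ r a ∧ Q τ r b) ∨ (τ m1 = Ty.N ∧ σ t m1 = some r ∧ τ m2 = Ty.O r ∧ Q τ r b) ∨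
    (τ m2 = Ty.N ∧ σ t m2 = some r ∧ τ m1 = Ty.O r ∧ Q τ r a) := by
  obtain ⟨h1, o1⟩ := W_int hX hY P M [] [b] ht h
  obtain ⟨h2, o2⟩ := W_int hX hY P M [a] [] ht h
  have g1 : ∀ q, (q = a ∨ q = m2) → τ q = Ty.O r → (∃ u, nb X Y t q u ∧ ¬ inW X Y cx cy u) → Q τ r a := by
    rintro q (rfl | rfl) h3 ⟨u, hu, hu'⟩
    · exact Or.inr h3
    · exact absurd (o2 u hu) hu'
  have g2 : ∀ q, (q = m1 ∨ q = b) → τ q = Ty.O r → (∃ u, nb X Y t q u ∧ ¬ inW X Y cx cy u) → Q τ r b := by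
    rintro q (rfl | rfl) h3 ⟨u, hu, hu'⟩
    · exact absurd (o1 u hu) hu'
    · exact Or.inr h3
  rcases h1 with ⟨h1, c1⟩ | ⟨h1, q1, hq1, _, e1, u1⟩ <;> rcases h2 with ⟨h2, c2⟩ | ⟨h2, q2, hq2, _, e2, u2⟩
  · exact absurd c2 (P.p3 hX hY (Word.nb hY [a] [b] h) c1)
  · exact Or.inr (Or.inl ⟨h1, c1, h2, g2 q2 hq2 e2 u2⟩)
  · exact Or.inr (Or.inr ⟨h2, c2, h1, g1 q1 hq1 e1 u1⟩)
  · exact Or.inl ⟨h1, h2, g1 q1 hq1 e1 u1, g2 q2 hq2 e2 u2⟩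

/-- a point all of whose word neighbours are interior is colored -/
lemma deep {t x a m b y : ℕ} (l1 l : List ℕ) (ht : t ≤ T) (h : Word X Y cx cy t (l1 ++ x :: a :: m :: b :: y :: l)) : τ m = Ty.N ∧ σ t m = some r := by
  obtain ⟨h1, o1⟩ := W_int hX hY P M l1 (b :: y :: l) ht h
  obtain ⟨h2, o2⟩ := W_int hX hY P M (l1 ++ [x]) (y :: l) (a := a) (m := m) (b := b) ht (by simpa using h)
  obtain ⟨h3, o3⟩ := W_int hX hY P M (l1 ++ [x, a]) l (a := m) (m := b) (b := y) ht (by simpa using h)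
  rcases h2 with h2 | ⟨_, q, rfl | rfl, _, _, u, hu, hu'⟩
  · exact h2
  · exact absurd (o1 u hu) hu'
  · exact absurd (o3 u hu) hu'

lemma struct5 {t a m1 m2 m3 b : ℕ} (ht : t ≤ T) (h : Word X Y cx cy t [a, m1, m2, m3, b]) :
    τ m2 = Ty.N ∧ σ t m2 = some r ∧ τ m1 = Ty.O r ∧ τ m3 = Ty.O r ∧ Q τ r a ∧ Q τ r b := by
  obtain ⟨h2, c2⟩ := deep hX hY P M [] [] ht h
  obtain ⟨h1, o1⟩ := W_int hX hY P M [] [m3, b] ht h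
  obtain ⟨h3, o3⟩ := W_int hX hY P M [a, m1] [] ht h
  have n1 : nb X Y t m1 m2 := Word.nb hY [a] [m3, b] h
  have n2 : nb X Y t m2 m3 := Word.nb hY [a, m1] [b] h
  rcases h1 with ⟨_, c1⟩ | ⟨h1, q1, hq1, _, e1, _⟩
  · exact absurd c2 (P.p3 hX hY n1 c1)
  rcases h3 with ⟨_, c3⟩ | ⟨h3, q3, hq3, _, e3, _⟩
  · exact absurd c3 (P.p3 hX hY n2 c2)
  refine ⟨h2, c2, h1, h3, ?_, ?_⟩
  · rcases hq1 with rfl | rfl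
    · exact Or.inr e1
    · rw [h2] at e1; cases e1
  · rcases hq3 with rfl | rfl
    · rw [h2] at e3; cases e3
    · exact Or.inr e3

lemma struct6 {t a m1 m2 m3 m4 b : ℕ} (ht : t ≤ T) (h : Word X Y cx cy t [a, m1, m2, m3, m4, b]) : False := by
  obtain ⟨h2, c2⟩ := deep hX hY P M [] [b] ht h
  obtain ⟨h3, c3⟩ := deep hX hY P M [a] [] ht h
  exact P.p3 hX hY (Word.nb hY [a, m1] [m4, b] h) c2 c3

/-- a point adjacent to an `r`-colored word point does not die -/
lemma adj_live {t p a : ℕ} (ht : t < T) (ha : nb X Y t p a) (haW : inW X Y cx cy a) (hc : σ t p = some r) (hk : Kill X Y a t) : False := by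
  have h1 := adj_unc hX hY P M ht.le ha haW hc
  rw [M.m2 t a ht haW hk] at h1
  cases h1
end


lemma app_one {α : Type} {l1 l2 : List α} {a : α} (h : [a] = l1 ++ l2) : (l1 = [] ∧ l2 = [a]) ∨ (l1 = [a] ∧ l2 = []) := by
  cases l1 with
  | nil => left; simpa using h.symm
  | cons x l1 =>
    right
    simp at h
    simp [h]

lemma app_cons {α : Type} {l1 l2 l : List α} {a : α} (h : a :: l = l1 ++ l2) : (l1 = [] ∧ l2 = a :: l) ∨ (∃ l1', l1 = a :: l1' ∧ l = l1' ++ l2) := by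
  cases l1 with
  | nil => left; simpa using h.symm
  | cons x l1 =>
    right
    simp at h
    exact ⟨l1, by simp [h.1], h.2⟩

lemma cons_app {α : Type} {l1 l2 l : List α} {a v : α} (h : a :: l = l1 ++ v :: l2) : (l1 = [] ∧ v = a ∧ l2 = l) ∨ (∃ l1', l1 = a :: l1' ∧ l = l1' ++ v :: l2) := by
  rcases app_cons h with ⟨h1, h2⟩ | h
  · left
    simp at h2
    exact ⟨h1, h2⟩
  · exact Or.inr h

lemma nil_app {α : Type} {l1 l2 : List α} {v : α} (h : [] = l1 ++ v :: l2) : False := by simp at h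

section
variable {σ : ℕ → ℕ → Option Bool} {τ : ℕ → Ty} {cx cy T : ℕ} {r : Bool}
variable {t : ℕ}

local notation "Wd" => Word X Y cx cy
local notation "Kl" => Kill X Y

lemma tr0 (h : Tr X Y cx cy t []) : Wd (t+1) [t] := by
  rcases h with ⟨l1, l2, e, h⟩ | ⟨l1, v, l2, e, hk, h⟩
  · simp at e
    simpa [e] using h
  · exact (nil_app e).elim

lemma tr1 {a : ℕ} (h : Tr X Y cx cy t [a]) : Wd (t+1) [t, a] ∨ Wd (t+1) [a, t] ∨ (Kl a t ∧ Wd (t+1) [t]) := by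
  rcases h with ⟨l1, l2, e, h⟩ | ⟨l1, v, l2, e, hk, h⟩
  · rcases app_one e with ⟨rfl, rfl⟩ | ⟨rfl, rfl⟩
    · exact Or.inl h
    · exact Or.inr (Or.inl h)
  · rcases cons_app e with ⟨rfl, rfl, rfl⟩ | ⟨l1, rfl, e1⟩
    · exact Or.inr (Or.inr ⟨hk, h⟩)
    · exact (nil_app e1).elim

lemma tr2 {a b : ℕ} (h : Tr X Y cx cy t [a, b]) : Wd (t+1) [t, a, b] ∨ Wd (t+1) [a, t, b] ∨ Wd (t+1) [a, b, t] ∨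
    (Kl a t ∧ Wd (t+1) [t, b]) ∨ (Kl b t ∧ Wd (t+1) [a, t]) := by
  rcases h with ⟨l1, l2, e, h⟩ | ⟨l1, v, l2, e, hk, h⟩
  · rcases app_cons e with ⟨rfl, rfl⟩ | ⟨l1, rfl, e1⟩
    · exact Or.inl h
    rcases app_one e1 with ⟨rfl, rfl⟩ | ⟨rfl, rfl⟩
    · exact Or.inr (Or.inl h)
    · exact Or.inr (Or.inr (Or.inl h))
  · rcases cons_app e with ⟨rfl, rfl, rfl⟩ | ⟨l1, rfl, e1⟩
    · exact Or.inr (Or.inr (Or.inr (Or.inl ⟨hk, h⟩)))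
    rcases cons_app e1 with ⟨rfl, rfl, rfl⟩ | ⟨l1, rfl, e2⟩
    · exact Or.inr (Or.inr (Or.inr (Or.inr ⟨hk, h⟩)))
    · exact (nil_app e2).elim

lemma tr3 {a b c : ℕ} (h : Tr X Y cx cy t [a, b, c]) : (∃ a b c d, Wd (t+1) [a, b, c, d]) ∨
    (Kl a t ∧ Wd (t+1) [t, b, c]) ∨ (Kl b t ∧ Wd (t+1) [a, t, c]) ∨ (Kl c t ∧ Wd (t+1) [a, b, t]) := by
  rcases h with ⟨l1, l2, e, h⟩ | ⟨l1, v, l2, e, hk, h⟩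
  · left
    rcases app_cons e with ⟨rfl, rfl⟩ | ⟨l1, rfl, e1⟩
    · exact ⟨_, _, _, _, h⟩
    rcases app_cons e1 with ⟨rfl, rfl⟩ | ⟨l1, rfl, e2⟩
    · exact ⟨_, _, _, _, h⟩
    rcases app_one e2 with ⟨rfl, rfl⟩ | ⟨rfl, rfl⟩
    · exact ⟨_, _, _, _, h⟩
    · exact ⟨_, _, _, _, h⟩
  · right
    rcases cons_app e with ⟨rfl, rfl, rfl⟩ | ⟨l1, rfl, e1⟩
    · exact Or.inl ⟨hk, h⟩
    rcases cons_app e1 with ⟨rfl, rfl, rfl⟩ | ⟨l1, rfl, e2⟩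
    · exact Or.inr (Or.inl ⟨hk, h⟩)
    rcases cons_app e2 with ⟨rfl, rfl, rfl⟩ | ⟨l1, rfl, e3⟩
    · exact Or.inr (Or.inr ⟨hk, h⟩)
    · exact (nil_app e3).elim

lemma tr4 {a b c d : ℕ} (h : Tr X Y cx cy t [a, b, c, d]) :
    (Wd (t+1) [t, a, b, c, d] ∨ Wd (t+1) [a, t, b, c, d] ∨ Wd (t+1) [a, b, t, c, d] ∨ Wd (t+1) [a, b, c, t, d] ∨ Wd (t+1) [a, b, c, d, t]) ∨
    Kl a t ∨ (Kl b t ∧ Wd (t+1) [a, t, c, d]) ∨ (Kl c t ∧ Wd (t+1) [a, b, t, d]) ∨ Kl d t := by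
  rcases h with ⟨l1, l2, e, h⟩ | ⟨l1, v, l2, e, hk, h⟩
  · left
    rcases app_cons e with ⟨rfl, rfl⟩ | ⟨l1, rfl, e1⟩
    · exact Or.inl h
    right
    rcases app_cons e1 with ⟨rfl, rfl⟩ | ⟨l1, rfl, e2⟩
    · exact Or.inl h
    right
    rcases app_cons e2 with ⟨rfl, rfl⟩ | ⟨l1, rfl, e3⟩
    · exact Or.inl h
    right
    rcases app_one e3 with ⟨rfl, rfl⟩ | ⟨rfl, rfl⟩
    · exact Or.inl h
    · exact Or.inr h
  · right
    rcases cons_app e with ⟨rfl, rfl, rfl⟩ | ⟨l1, rfl, e1⟩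
    · exact Or.inl hk
    right
    rcases cons_app e1 with ⟨rfl, rfl, rfl⟩ | ⟨l1, rfl, e2⟩
    · exact Or.inl ⟨hk, h⟩
    right
    rcases cons_app e2 with ⟨rfl, rfl, rfl⟩ | ⟨l1, rfl, e3⟩
    · exact Or.inl ⟨hk, h⟩
    right
    rcases cons_app e3 with ⟨rfl, rfl, rfl⟩ | ⟨l1, rfl, e4⟩
    · exact hk
    · exact (nil_app e4).elim

lemma tr5 {a b c d f : ℕ} (h : Tr X Y cx cy t [a, b, c, d, f]) :
    (∃ a b c d e f, Wd (t+1) [a, b, c, d, e, f]) ∨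
    Kl a t ∨ Kl b t ∨ (Kl c t ∧ Wd (t+1) [a, b, t, d, f]) ∨ Kl d t ∨ Kl f t := by
  rcases h with ⟨l1, l2, e, h⟩ | ⟨l1, v, l2, e, hk, h⟩
  · left
    rcases app_cons e with ⟨rfl, rfl⟩ | ⟨l1, rfl, e1⟩
    · exact ⟨_, _, _, _, _, _, h⟩
    rcases app_cons e1 with ⟨rfl, rfl⟩ | ⟨l1, rfl, e2⟩
    · exact ⟨_, _, _, _, _, _, h⟩
    rcases app_cons e2 with ⟨rfl, rfl⟩ | ⟨l1, rfl, e3⟩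
    · exact ⟨_, _, _, _, _, _, h⟩
    rcases app_cons e3 with ⟨rfl, rfl⟩ | ⟨l1, rfl, e4⟩
    · exact ⟨_, _, _, _, _, _, h⟩
    rcases app_one e4 with ⟨rfl, rfl⟩ | ⟨rfl, rfl⟩
    · exact ⟨_, _, _, _, _, _, h⟩
    · exact ⟨_, _, _, _, _, _, h⟩
  · right
    rcases cons_app e with ⟨rfl, rfl, rfl⟩ | ⟨l1, rfl, e1⟩
    · exact Or.inl hk
    right
    rcases cons_app e1 with ⟨rfl, rfl, rfl⟩ | ⟨l1, rfl, e2⟩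
    · exact Or.inl hk
    right
    rcases cons_app e2 with ⟨rfl, rfl, rfl⟩ | ⟨l1, rfl, e3⟩
    · exact Or.inl ⟨hk, h⟩
    right
    rcases cons_app e3 with ⟨rfl, rfl, rfl⟩ | ⟨l1, rfl, e4⟩
    · exact Or.inl hk
    right
    rcases cons_app e4 with ⟨rfl, rfl, rfl⟩ | ⟨l1, rfl, e5⟩
    · exact hk
    · exact (nil_app e5).elim

variable (hX : Function.Injective X) (hY : Function.Injective Y) (P : Pr X Y σ τ) (M : Mn X Y σ cx cy T r)
include hX hY P M

lemma step1 (ht : t < T) (hW : inW X Y cx cy t) {a : ℕ} (h : Wd t [a]) (hJ : J1 X Y cx cy t a) : J X Y σ τ r cx cy (t+1) := by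
  have hc := cnt_in hW
  have hle : cnt X Y cx cy t ≤ 2 := by rcases hJ with h | h <;> omega
  rcases tr1 (trans hX hY P M ht hW h) with h' | h' | ⟨hk, h'⟩
  · exact Or.inr (Or.inr (Or.inl ⟨_, _, h', Or.inl (by omega)⟩))
  · exact Or.inr (Or.inr (Or.inl ⟨_, _, h', Or.inl (by omega)⟩))
  · refine Or.inr (Or.inl ⟨_, h', Or.inr ⟨?_, a, h.inW (by simp), hk⟩⟩)
    rcases hJ with hJ | ⟨_, hJ⟩
    · omega
    · exfalso
      obtain ⟨q, h1, h2, h3⟩ := F_death hX hY P M ht (h.inW (by simp)) hk hJ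
      have := (h.1 q).2 ⟨h1.2.1, h3⟩
      simp at this
      omega

lemma step2 (ht : t < T) (hW : inW X Y cx cy t) {a b : ℕ} (h : Wd t [a, b]) (hJ : J2 X Y σ τ r cx cy t a b) : J X Y σ τ r cx cy (t+1) := by
  have hc := cnt_in hW
  have hle : cnt X Y cx cy t ≤ 6 := by rcases hJ with h | h | h | h <;> omega
  have hn : nb X Y t a b := h.nb hY [] []
  have hat := hn.1.1
  have hbt := hn.2.1.1
  have haW := h.inW (p := a) (by simp)
  have hbW := h.inW (p := b) (by simp)
  have hr : Wd t [b, a] := h.rev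
  rcases tr2 (trans hX hY P M ht hW h) with h' | h' | h' | ⟨hk, h'⟩ | ⟨hk, h'⟩
  · exact Or.inr (Or.inr (Or.inr (Or.inl ⟨_, _, _, h', Or.inl (by omega)⟩)))
  · exact Or.inr (Or.inr (Or.inr (Or.inl ⟨_, _, _, h', Or.inl (by omega)⟩)))
  · exact Or.inr (Or.inr (Or.inr (Or.inl ⟨_, _, _, h', Or.inl (by omega)⟩)))
  · have hht : hh X Y cx cy t := ⟨a, haW, hk⟩
    refine Or.inr (Or.inr (Or.inl ⟨_, _, h', ?_⟩))
    rcases hJ with hJ | ⟨_, ha, hlt, _⟩ | ⟨hcn, ha, hb, hlt, hA⟩ | ⟨_, _, ha, hlt⟩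
    · exact Or.inr (Or.inl ⟨by omega, hht, hbt, killer2 hX hY P M ht hW h hk h'⟩)
    · exact (end_frozen hX hY P M ht h hk ha hlt).elim
    · have hQ : Q τ r b := by
        have hca := M.m2 t a ht haW hk
        rcases hA with hA | hA | hA | ⟨_, _, hA, _⟩
        · exact hA
        · exact absurd hA (P.p3 hX hY hn hca)
        · exact absurd hA (die_nQ P M ht haW hk)
        · rw [hca] at hA; cases hA
      exact Or.inr (Or.inr (Or.inr ⟨by omega, hQ, hht, hbt⟩))
    · exact (end_frozen hX hY P M ht h hk ha hlt).elim
  · have hht : hh X Y cx cy t := ⟨b, hbW, hk⟩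
    have h'r : Wd (t+1) [t, a] := h'.rev
    have hK := killer2 hX hY P M ht hW hr hk h'r
    rcases hJ with hJ | ⟨hcn, ha, hlt, hA⟩ | ⟨hcn, ha, hb, hlt, hA⟩ | ⟨_, hQ, ha, hlt⟩
    · exact Or.inr (Or.inr (Or.inl ⟨_, _, h'r, Or.inr (Or.inl ⟨by omega, hht, hat, hK⟩)⟩))
    · refine Or.inr (Or.inr (Or.inl ⟨_, _, h', Or.inr (Or.inr (Or.inl ⟨by omega, ha, hht, hat, ?_⟩))⟩))
      have hca := adj_unc hX hY P M ht.le (nb_symm hn) haW (M.m2 t b ht hbW hk)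
      rcases hA with hA | hA | ⟨h1, h2, h3⟩
      · exact Or.inr (Or.inr (Or.inl hA))
      · rw [hA] at hca; cases hca
      · rcases hK with hK | hK | ⟨hK, _⟩
        · exact Or.inl hK
        · exact Or.inr (Or.inl hK)
        · exact A2_of hX hY P M ht hat hW (h'.nb hY [] []) hat h1 hK h2 h3 (Or.inr (fun hc => hc.2 t (by omega) hk.2))
    · exact (end_frozen hX hY P M ht hr hk hb hlt).elim
    · exact absurd hQ (die_nQ P M ht hbW hk)

lemma step2_out (ht : t < T) (hW : ¬ inW X Y cx cy t) {a b : ℕ} (h : Wd t [a, b]) (hJ : J2 X Y σ τ r cx cy t a b) : J2 X Y σ τ r cx cy (t+1) a b := by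
  have hn : nb X Y t a b := h.nb hY [] []
  have hn' : nb X Y (t+1) a b := (h.out hW).nb hY [] []
  have hat := hn.1.1
  have haW := h.inW (p := a) (by simp)
  have hbW := h.inW (p := b) (by simp)
  unfold J2
  rw [cnt_out hW]
  refine hJ.imp id (Or.imp ?_ (Or.imp ?_ id))
  · rintro ⟨h1, h2, h3, h4⟩
    exact ⟨h1, h2, h3, A1_step hX hY P M ht hat haW h4⟩
  · rintro ⟨h1, h2, h3, h4, h5⟩
    refine ⟨h1, h2, h3, h4, ?_⟩
    rcases h5 with h5 | h5 | h5 | ⟨h5, h6, h7, h8⟩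
    · exact Or.inl h5
    · exact Or.inr (Or.inl (P.mono (by omega) h5))
    · exact Or.inr (Or.inr (Or.inl h5))
    · exact A2_of hX hY P M ht hat hbW hn' h4 h5 h6 h7 h8 (Or.inl rfl)

lemma step3 (ht : t < T) (hW : inW X Y cx cy t) {a m b : ℕ} (h : Wd t [a, m, b]) (hJ : J3 X Y τ r cx cy t a m b) : J X Y σ τ r cx cy (t+1) := by
  have hc := cnt_in hW
  have hle : cnt X Y cx cy t ≤ 8 := by rcases hJ with h | h <;> omega
  have n1 : nb X Y t a m := h.nb hY [] [b]
  have n2 : nb X Y t m b := h.nb hY [a] []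
  have haW := h.inW (p := a) (by simp)
  have hmW := h.inW (p := m) (by simp)
  have hbW := h.inW (p := b) (by simp)
  have hmt := n2.1.1
  have hs := struct3 hX hY P M ht.le h
  rcases tr3 (trans hX hY P M ht hW h) with ⟨_, _, _, _, h'⟩ | ⟨hk, h'⟩ | ⟨hk, h'⟩ | ⟨hk, h'⟩
  · exact Or.inr (Or.inr (Or.inr (Or.inr (Or.inl ⟨_, _, _, _, h', Or.inl (by omega)⟩))))
  · rcases hs with ⟨_, hs⟩ | ⟨hO, hs⟩
    · exact (adj_live hX hY P M ht (nb_symm n1) haW hs hk).elim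
    · have hQ : Q τ r b := by
        rcases hs with hs | hs
        · exact absurd hs.1 (die_nQ P M ht haW hk)
        · exact hs.1
      refine Or.inr (Or.inr (Or.inr (Or.inl ⟨_, _, _, h', Or.inr ⟨?_, Or.inr ⟨hO, ⟨a, haW, hk⟩, hmt, hQ⟩⟩⟩)))
      rcases hJ with hJ | ⟨_, ⟨_, _, _, hN⟩ | ⟨_, ha, hlt, _⟩⟩
      · omega
      · rw [hO] at hN; cases hN
      · exact (end_frozen hX hY P M ht h hk ha hlt).elim
  · obtain ⟨hN, l1, l2⟩ := W_new hX hY P M [] [] ht h'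
    refine Or.inr (Or.inr (Or.inr (Or.inl ⟨_, _, _, h', Or.inr ⟨?_, Or.inl ⟨⟨m, hmW, hk⟩, l1, l2, hN⟩⟩⟩)))
    rcases hJ with hJ | ⟨_, ⟨hm, l3, l4, _⟩ | ⟨hO, _, _, _⟩⟩
    · omega
    · exact (int_frozen hX hY P M (l1 := []) ht h hk hm l3 l4).elim
    · exact absurd (Or.inr hO) (die_nQ P M ht hmW hk)
  · rcases hs with ⟨_, hs⟩ | ⟨hO, hs⟩
    · exact (adj_live hX hY P M ht n2 hbW hs hk).elim
    · have hQ : Q τ r a := by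
        rcases hs with hs | hs
        · exact hs.1
        · exact absurd hs.1 (die_nQ P M ht hbW hk)
      have h'r : Wd (t+1) [t, m, a] := h'.rev
      refine Or.inr (Or.inr (Or.inr (Or.inl ⟨_, _, _, h'r, Or.inr ⟨?_, Or.inr ⟨hO, ⟨b, hbW, hk⟩, hmt, hQ⟩⟩⟩)))
      rcases hJ with hJ | ⟨_, ⟨_, _, _, hN⟩ | ⟨_, ha, hlt, hQb⟩⟩
      · omega
      · rw [hO] at hN; cases hN
      · exact absurd hQb (die_nQ P M ht hbW hk)

lemma step4 (ht : t < T) (hW : inW X Y cx cy t) {a m1 m2 b : ℕ} (h : Wd t [a, m1, m2, b]) (hJ : J4 X Y τ cx cy t a m1 m2) : J X Y σ τ r cx cy (t+1) := by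
  have hc := cnt_in hW
  have hle : cnt X Y cx cy t ≤ 10 := by rcases hJ with h | h <;> omega
  have n1 : nb X Y t a m1 := h.nb hY [] [m2, b]
  have n2 : nb X Y t m1 m2 := h.nb hY [a] [b]
  have n3 : nb X Y t m2 b := h.nb hY [a, m1] []
  have haW := h.inW (p := a) (by simp)
  have hm1W := h.inW (p := m1) (by simp)
  have hm2W := h.inW (p := m2) (by simp)
  have hbW := h.inW (p := b) (by simp)
  have hs := struct4 hX hY P M ht.le h
  have dq : ∀ p, inW X Y cx cy p → Kl p t → ¬ Q τ r p := fun p hp hk => die_nQ P M ht hp hk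
  have j5 : ∀ a m1 m2 m3 b, Wd (t+1) [a, m1, m2, m3, b] → J5 X Y cx cy (t+1) m1 m2 m3 → J X Y σ τ r cx cy (t+1) :=
    fun a m1 m2 m3 b h1 h2 => Or.inr (Or.inr (Or.inr (Or.inr (Or.inr ⟨a, m1, m2, m3, b, h1, h2⟩))))
  rcases tr4 (trans hX hY P M ht hW h) with h' | hk | ⟨hk, h'⟩ | ⟨hk, h'⟩ | hk
  · rcases hJ with hJ | ⟨_, hm, l1, l2, hN⟩
    · rcases h' with h' | h' | h' | h' | h' <;> exact j5 _ _ _ _ _ h' (Or.inl (by omega))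
    · rcases h' with h' | h' | h' | h' | h'
      · exact j5 _ _ _ _ _ h' (Or.inr ⟨by omega, hm, l1, l2⟩)
      · have h5 := (struct5 hX hY P M (by omega) h').2.2.1
        have h6 := (W_new hX hY P M [] [m2, b] ht h').1
        rw [h5] at h6; cases h6
      · have h5 := (struct5 hX hY P M (by omega) h').2.2.1
        rw [h5] at hN; cases hN
      · have h5 := (struct5 hX hY P M (by omega) h').2.2.1
        rw [h5] at hN; cases hN
      · have h5 := (struct5 hX hY P M (by omega) h').2.2.1
        rw [h5] at hN; cases hN
  · exfalso
    rcases hs with ⟨_, _, q, _⟩ | ⟨_, c, _, _⟩ | ⟨_, _, _, q⟩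
    · exact dq _ haW hk q
    · exact adj_live hX hY P M ht (nb_symm n1) haW c hk
    · exact dq _ haW hk q
  · obtain ⟨hN, l1, l2⟩ := W_new hX hY P M [] [b] ht h'
    refine Or.inr (Or.inr (Or.inr (Or.inr (Or.inl ⟨_, _, _, _, h', Or.inr ⟨?_, ⟨m1, hm1W, hk⟩, l1, l2, hN⟩⟩))))
    rcases hJ with hJ | ⟨_, hm, l1, l2, hN⟩
    · omega
    · exact (int_frozen hX hY P M (l1 := []) ht h hk hm l1 l2).elim
  · obtain ⟨hN, l1, l2⟩ := W_new hX hY P M [a] [] ht h'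
    have h'r : Wd (t+1) [b, t, m1, a] := h'.rev
    refine Or.inr (Or.inr (Or.inr (Or.inr (Or.inl ⟨_, _, _, _, h'r, Or.inr ⟨?_, ⟨m2, hm2W, hk⟩, l2, l1, hN⟩⟩))))
    rcases hJ with hJ | ⟨_, hm, l1, l2, hN⟩
    · omega
    · exfalso
      rcases hs with ⟨_, q, _, _⟩ | ⟨_, _, q, _⟩ | ⟨_, _, q, _⟩
      · exact dq _ hm2W hk (Or.inr q)
      · exact dq _ hm2W hk (Or.inr q)
      · rw [q] at hN; cases hN
  · exfalso
    rcases hs with ⟨_, _, _, q⟩ | ⟨_, _, _, q⟩ | ⟨_, c, _, _⟩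
    · exact dq _ hbW hk q
    · exact dq _ hbW hk q
    · exact adj_live hX hY P M ht n3 hbW c hk

lemma step5 (ht : t < T) (hW : inW X Y cx cy t) {a m1 m2 m3 b : ℕ} (h : Wd t [a, m1, m2, m3, b]) (hJ : J5 X Y cx cy t m1 m2 m3) : J X Y σ τ r cx cy (t+1) := by
  have hc := cnt_in hW
  have dq : ∀ p ∈ [a, m1, m2, m3, b], Kl p t → ¬ Q τ r p := fun p hp hk => die_nQ P M ht (h.inW hp) hk
  obtain ⟨h2, c2, h1, h3, qa, qb⟩ := struct5 hX hY P M ht.le h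
  rcases tr5 (trans hX hY P M ht hW h) with ⟨_, _, _, _, _, _, h'⟩ | hk | hk | ⟨hk, h'⟩ | hk | hk
  · exact (struct6 hX hY P M (by omega) h').elim
  · exact absurd qa (dq _ (by simp) hk)
  · exact absurd (Or.inr h1) (dq _ (by simp) hk)
  · obtain ⟨hN, l1, l2⟩ := W_new hX hY P M [a] [b] ht h'
    refine Or.inr (Or.inr (Or.inr (Or.inr (Or.inr ⟨_, _, _, _, _, h', Or.inr ⟨?_, ⟨m2, h.inW (by simp), hk⟩, l1, l2⟩⟩))))
    rcases hJ with hJ | ⟨_, hm, l1, l2⟩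
    · omega
    · exact (int_frozen hX hY P M (l1 := [a]) ht h hk hm l1 l2).elim
  · exact absurd (Or.inr h3) (dq _ (by simp) hk)
  · exact absurd qb (dq _ (by simp) hk)

lemma J_all (ht : t ≤ T) : J X Y σ τ r cx cy t := by
  induction t with
  | zero =>
    refine Or.inl ⟨⟨fun p => ?_, by simp⟩, by simp [cnt]⟩
    simp only [List.not_mem_nil, false_iff]
    rintro ⟨h, _⟩
    exact absurd h.1 (by omega)
  | succ t ih =>
    have ht' : t < T := by omega
    have ih := ih ht'.le
    by_cases hW : inW X Y cx cy t
    · rcases ih with ⟨h, hJ⟩ | ⟨a, h, hJ⟩ | ⟨a, b, h, hJ⟩ | ⟨a, m, b, h, hJ⟩ | ⟨a, m1, m2, b, h, hJ⟩ | ⟨a, m1, m2, m3, b, h, hJ⟩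
      · exact Or.inr (Or.inl ⟨_, tr0 (trans hX hY P M ht' hW h), Or.inl (by rw [cnt_in hW]; omega)⟩)
      · exact step1 hX hY P M ht' hW h hJ
      · exact step2 hX hY P M ht' hW h hJ
      · exact step3 hX hY P M ht' hW h hJ
      · exact step4 hX hY P M ht' hW h hJ
      · exact step5 hX hY P M ht' hW h hJ
    · have hc := cnt_out hW
      rcases ih with ⟨h, hJ⟩ | ⟨a, h, hJ⟩ | ⟨a, b, h, hJ⟩ | ⟨a, m, b, h, hJ⟩ | ⟨a, m1, m2, b, h, hJ⟩ | ⟨a, m1, m2, m3, b, h, hJ⟩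
      · exact Or.inl ⟨h.out hW, by omega⟩
      · exact Or.inr (Or.inl ⟨a, h.out hW, by unfold J1; rw [hc]; exact hJ⟩)
      · exact Or.inr (Or.inr (Or.inl ⟨a, b, h.out hW, step2_out hX hY P M ht' hW h hJ⟩))
      · exact Or.inr (Or.inr (Or.inr (Or.inl ⟨a, m, b, h.out hW, by unfold J3; rw [hc]; exact hJ⟩)))
      · exact Or.inr (Or.inr (Or.inr (Or.inr (Or.inl ⟨a, m1, m2, b, h.out hW, by unfold J4; rw [hc]; exact hJ⟩))))
      · exact Or.inr (Or.inr (Or.inr (Or.inr (Or.inr ⟨a, m1, m2, m3, b, h.out hW, by unfold J5; rw [hc]; exact hJ⟩))))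

lemma cnt_le : cnt X Y cx cy T ≤ 11 := by
  rcases J_all hX hY P M (t := T) le_rfl with ⟨h, hJ⟩ | ⟨a, h, hJ⟩ | ⟨a, b, h, hJ⟩ | ⟨a, m, b, h, hJ⟩ | ⟨a, m1, m2, b, h, hJ⟩ | ⟨a, m1, m2, m3, b, h, hJ⟩
  · omega
  · rcases hJ with h | h <;> omega
  · rcases hJ with h | h | h | h <;> omega
  · rcases hJ with h | h <;> omega
  · rcases hJ with h | h <;> omega
  · rcases hJ with h | h <;> omega
end

theorem comb (hX : Function.Injective X) (hY : Function.Injective Y) (n : ℕ) :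
    ∃ col : ℕ → Bool, ∀ T ≤ n, ∀ cx cy, 12 ≤ cnt X Y cx cy T → ∀ b, ∃ i < T, inW X Y cx cy i ∧ col i = b := by
  obtain ⟨σ, τ, P⟩ := exists_Pr X Y
  obtain ⟨col, hcol⟩ := exists_color hX hY P n
  refine ⟨col, fun T hT cx cy hc b => ?_⟩
  by_contra h
  push Not at h
  have := cnt_le hX hY P (hcol T hT cx cy (!b) (fun i hi hW => by
    have := h i hi hW
    cases b <;> simpa using this))
  omega


/-! reduction -/

lemma exists_rank {I : Type} [Fintype I] (f : I → ℝ) :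
    ∃ e : I ≃ Fin (Fintype.card I), ∀ x : ℝ, ∃ c ≤ Fintype.card I, ∀ i, x ≤ f i ↔ (e i : ℕ) < c := by
  let e0 := Fintype.equivFin I
  let g : Fin (Fintype.card I) → ℝ := fun k => - f (e0.symm k)
  have hg := Tuple.monotone_sort g
  let e : I ≃ Fin (Fintype.card I) := e0.trans (Tuple.sort g).symm
  have he : ∀ i j, e i ≤ e j → f j ≤ f i := by
    intro i j h
    have := hg h
    simp [g, e] at this
    exact this
  refine ⟨e, fun x => ⟨(Finset.univ.filter (fun i => x ≤ f i)).sup (fun i => (e i : ℕ) + 1), ?_, ?_⟩⟩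
  · apply Finset.sup_le
    intro i _
    have := (e i).2
    omega
  · intro i
    rw [Finset.lt_sup_iff]
    constructor
    · intro h
      exact ⟨i, by simpa using h, by omega⟩
    · rintro ⟨j, hj, hlt⟩
      simp only [Finset.mem_filter, Finset.mem_univ, true_and] at hj
      exact hj.trans (he i j (by rw [Fin.le_def]; omega))

lemma exists_ext {n : ℕ} (e : Fin n ≃ Fin n) : ∃ X : ℕ → ℕ, Function.Injective X ∧ ∀ t : Fin n, X t = e t := by
  refine ⟨fun t => if h : t < n then (e ⟨t, h⟩ : ℕ) else t, ?_, fun t => by simp⟩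
  intro a b hab
  by_cases ha : a < n <;> by_cases hb : b < n <;> simp only [ha, hb, dif_pos, dif_neg, not_false_eq_true] at hab
  · have := e.injective (Fin.ext hab)
    simpa using this
  · have := (e ⟨a, ha⟩).2
    omega
  · have := (e ⟨b, hb⟩).2
    omega
  · exact hab

end Oct

/-- Octants are cover-decomposable: any `12`-fold covering of any subset of `ℝ³`
by finitely many translates of the octant decomposes into two coverings. -/
theorem octants_cover_decomposable
    (I : Type) [Fintype I]
    (a : I → (Fin 3 → ℝ)) (X : Set (Fin 3 → ℝ))
    (hcov : ∀ x ∈ X, 12 ≤ {i : I | x ∈ Octant (a i)}.ncard) :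
    ∃ f : I → Bool, ∀ b : Bool, ∀ x ∈ X, ∃ i : I, f i = b ∧ x ∈ Octant (a i) := by
  obtain ⟨e0, h0⟩ := Oct.exists_rank (fun i => a i 0)
  obtain ⟨e1, h1⟩ := Oct.exists_rank (fun i => a i 1)
  obtain ⟨e2, h2⟩ := Oct.exists_rank (fun i => a i 2)
  obtain ⟨X', hX, hX'⟩ := Oct.exists_ext (e2.symm.trans e0)
  obtain ⟨Y', hY, hY'⟩ := Oct.exists_ext (e2.symm.trans e1)
  obtain ⟨col, hcol⟩ := Oct.comb hX hY (Fintype.card I)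
  have hx : ∀ i, X' (e2 i) = e0 i := fun i => by rw [hX']; simp
  have hy : ∀ i, Y' (e2 i) = e1 i := fun i => by rw [hY']; simp
  refine ⟨fun i => col (e2 i), fun b x hxX => ?_⟩
  obtain ⟨cx, _, hcx⟩ := h0 (x 0)
  obtain ⟨cy, _, hcy⟩ := h1 (x 1)
  obtain ⟨T, hT, hcT⟩ := h2 (x 2)
  have hoct : ∀ i, x ∈ Octant (a i) ↔ Oct.inW X' Y' cx cy (e2 i) ∧ (e2 i : ℕ) < T := by
    intro i
    unfold Octant Oct.inW
    rw [hx, hy, Set.mem_setOf_eq, hcx i, hcy i, hcT i]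
    tauto
  have hc : 12 ≤ Oct.cnt X' Y' cx cy T := by
    refine (hcov x hxX).trans ?_
    unfold Oct.cnt
    rw [← Set.ncard_coe_finset]
    refine Set.ncard_le_ncard_of_injOn (fun i => (e2 i : ℕ)) ?_ ?_ (Finset.finite_toSet _)
    · intro i hi
      have := (hoct i).1 hi
      simp only [Finset.coe_filter, Finset.mem_range, Set.mem_setOf_eq]
      exact ⟨this.2, this.1⟩
    · intro i _ j _ hij
      exact e2.injective (Fin.ext hij)
  obtain ⟨t, htT, hW, hb⟩ := hcol T hT cx cy hc b
  have htn : t < Fintype.card I := by omega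
  have ht : (e2 (e2.symm ⟨t, htn⟩) : ℕ) = t := by simp
  refine ⟨e2.symm ⟨t, htn⟩, by simpa using hb, ?_⟩
  rw [hoct, ht]
  exact ⟨hW, htT⟩
end

section
/- Any finite set of points in ℝ³ can be colored with two colors such that every translate of a given octant containing at least 12 of the points contains points of both colors. Precisely: for every finite S ⊆ ℝ³ there exists c : S → Bool such that for every a ∈ ℝ³, if |S ∩ O(a)| ≥ 12 then c takes both values true and false on S ∩ O(a). -/
namespace OctPf

abbrev V := Fin 3 → ℝ

def le2 (x y : V) : Prop := x 0 ≤ y 0 ∧ x 1 ≤ y 1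

def inW (a b : ℝ) (x : V) : Prop := x 0 ≤ a ∧ x 1 ≤ b

def EF (E : V → V → Prop) (a b : ℝ) : Prop := ∀ u v, E u v → inW a b u → inW a b v → False

structure St (P R U : Finset V) (E : V → V → Prop) : Prop where
  RP : ∀ x ∈ R, x ∈ P
  UP : ∀ x ∈ U, x ∈ P
  EP : ∀ u v, E u v → u ∈ P ∧ v ∈ P
  good : ∀ x ∈ P, x ∈ R ∨ x ∈ U ∨ ∃ u v, E u v ∧ le2 u x ∧ le2 v x
  anti : ∀ r ∈ R, ∀ x, (x ∈ R ∨ x ∈ U) → le2 x r → x = r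
  two : ∀ a b, EF E a b → ∃ t1 t2 : V, ∀ u ∈ U, inW a b u → u = t1 ∨ u = t2
  free : ∀ f : V → Bool, ∃ c : V → Bool, (∀ r ∈ R, c r = f r) ∧ ∀ u v, E u v → c u ≠ c v

def I1 (R U : Finset V) : Prop :=
  ∀ x1 ∈ R, ∀ x2 ∈ R, ∀ x3 ∈ R, ∀ x4 ∈ R, x1 0 < x2 0 → x2 0 < x3 0 → x3 0 < x4 0 →
    ∃ u ∈ U, u 0 ≤ x4 0 ∧ u 1 ≤ x1 1

open Classical in
lemma step1 {P R U : Finset V} {E : V → V → Prop} (h : St P R U E) {p q : V}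
    (hp : p ∉ P) (hq : q ∈ P) (hqp : le2 q p) :
    St (insert p P) R U (fun u v => E u v ∨ (u = p ∧ v = q)) := by
  refine ⟨?_, ?_, ?_, ?_, h.anti, ?_, ?_⟩
  · intro x hx; exact Finset.mem_insert_of_mem (h.RP x hx)
  · intro x hx; exact Finset.mem_insert_of_mem (h.UP x hx)
  · rintro u v (hE | ⟨rfl, rfl⟩)
    · exact ⟨Finset.mem_insert_of_mem (h.EP u v hE).1, Finset.mem_insert_of_mem (h.EP u v hE).2⟩
    · exact ⟨Finset.mem_insert_self _ _, Finset.mem_insert_of_mem hq⟩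
  · intro x hx
    rcases Finset.mem_insert.1 hx with rfl | hx
    · exact Or.inr (Or.inr ⟨x, q, Or.inr ⟨rfl, rfl⟩, ⟨le_rfl, le_rfl⟩, hqp⟩)
    · rcases h.good x hx with h1 | h1 | ⟨u, v, h1, h2⟩
      · exact Or.inl h1
      · exact Or.inr (Or.inl h1)
      · exact Or.inr (Or.inr ⟨u, v, Or.inl h1, h2⟩)
  · intro a b hab
    exact h.two a b (fun u v hE => hab u v (Or.inl hE))
  · intro f
    obtain ⟨c, hc1, hc2⟩ := h.free f
    have hne : ∀ x ∈ P, x ≠ p := fun x hx hxp => hp (hxp ▸ hx)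
    refine ⟨Function.update c p (!c q), ?_, ?_⟩
    · intro r hr
      rw [Function.update_of_ne (hne r (h.RP r hr))]
      exact hc1 r hr
    · rintro u v (hE | ⟨rfl, rfl⟩)
      · rw [Function.update_of_ne (hne u (h.EP u v hE).1),
          Function.update_of_ne (hne v (h.EP u v hE).2)]
        exact hc2 u v hE
      · rw [Function.update_self, Function.update_of_ne (hne v hq)]
        simp

open Classical in
lemma step2 {P R U : Finset V} {E : V → V → Prop} (h : St P R U E) {p : V}
    (hp : p ∉ P) (hq : ∀ q ∈ P, ¬ le2 q p) :
    St (insert p P) (insert p (R.filter (fun r => ¬ le2 p r))) U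
      (fun u v => E u v ∨ (u ∈ R ∧ le2 p u ∧ v = p)) := by
  have hne : ∀ x ∈ P, x ≠ p := fun x hx hxp => hp (hxp ▸ hx)
  refine ⟨?_, ?_, ?_, ?_, ?_, ?_, ?_⟩
  · intro x hx
    rcases Finset.mem_insert.1 hx with rfl | hx
    · exact Finset.mem_insert_self _ _
    · exact Finset.mem_insert_of_mem (h.RP x (Finset.mem_filter.1 hx).1)
  · intro x hx; exact Finset.mem_insert_of_mem (h.UP x hx)
  · rintro u v (hE | ⟨hu, hu2, rfl⟩)
    · exact ⟨Finset.mem_insert_of_mem (h.EP u v hE).1, Finset.mem_insert_of_mem (h.EP u v hE).2⟩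
    · exact ⟨Finset.mem_insert_of_mem (h.RP u hu), Finset.mem_insert_self _ _⟩
  · intro x hx
    rcases Finset.mem_insert.1 hx with rfl | hx
    · exact Or.inl (Finset.mem_insert_self _ _)
    · rcases h.good x hx with h1 | h1 | ⟨u, v, h1, h2⟩
      · by_cases hpx : le2 p x
        · exact Or.inr (Or.inr ⟨x, p, Or.inr ⟨h1, hpx, rfl⟩, ⟨le_rfl, le_rfl⟩, hpx⟩)
        · exact Or.inl (Finset.mem_insert_of_mem (Finset.mem_filter.2 ⟨h1, hpx⟩))
      · exact Or.inr (Or.inl h1)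
      · exact Or.inr (Or.inr ⟨u, v, Or.inl h1, h2⟩)
  · intro r hr x hx hxr
    have hx' : x = p ∨ x ∈ R ∨ x ∈ U := by
      rcases hx with hx | hx
      · rcases Finset.mem_insert.1 hx with rfl | hx
        · exact Or.inl rfl
        · exact Or.inr (Or.inl (Finset.mem_filter.1 hx).1)
      · exact Or.inr (Or.inr hx)
    rcases Finset.mem_insert.1 hr with rfl | hr
    · rcases hx' with h1 | h1 | h1
      · exact h1
      · exact absurd hxr (hq x (h.RP x h1))
      · exact absurd hxr (hq x (h.UP x h1))
    · rcases Finset.mem_filter.1 hr with ⟨hr, hpr⟩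
      rcases hx' with rfl | h1
      · exact absurd hxr hpr
      · exact h.anti r hr x h1 hxr
  · intro a b hab
    exact h.two a b (fun u v hE => hab u v (Or.inl hE))
  · intro f
    obtain ⟨c, hc1, hc2⟩ := h.free (fun r => if le2 p r then !f p else f r)
    refine ⟨Function.update c p (f p), ?_, ?_⟩
    · intro r hr
      rcases Finset.mem_insert.1 hr with rfl | hr
      · simp
      · rcases Finset.mem_filter.1 hr with ⟨hr, hpr⟩
        rw [Function.update_of_ne (hne r (h.RP r hr)), hc1 r hr, if_neg hpr]
    · rintro u v (hE | ⟨hu, hu2, rfl⟩)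
      · rw [Function.update_of_ne (hne u (h.EP u v hE).1),
          Function.update_of_ne (hne v (h.EP u v hE).2)]
        exact hc2 u v hE
      · rw [Function.update_self, Function.update_of_ne (hne u (h.RP u hu)), hc1 u hu, if_pos hu2]
        simp

lemma St.lt1 {P R U : Finset V} {E : V → V → Prop} (h : St P R U E) {x y : V}
    (hx : x ∈ R) (hy : y ∈ R) (hxy : x 0 < y 0) : y 1 < x 1 := by
  by_contra hc
  have := h.anti y hy x (Or.inl hx) ⟨hxy.le, not_lt.1 hc⟩
  subst this
  exact lt_irrefl _ hxy

open Classical in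
lemma step3 {P R U : Finset V} {E : V → V → Prop} (h : St P R U E) {x1 x2 x3 x4 : V}
    (h1 : x1 ∈ R) (h2 : x2 ∈ R) (h3 : x3 ∈ R) (h4 : x4 ∈ R)
    (h12 : x1 0 < x2 0) (h23 : x2 0 < x3 0) (h34 : x3 0 < x4 0)
    (hU : ∀ u ∈ U, ¬ (u 0 ≤ x4 0 ∧ u 1 ≤ x1 1)) :
    St P (R.filter (fun r => r ≠ x2 ∧ r ≠ x3)) (insert x2 (insert x3 U))
      (fun u v => E u v ∨ (u = x1 ∧ v = x2) ∨ (u = x3 ∧ v = x4)) := by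
  have g12 := h.lt1 h1 h2 h12
  have g23 := h.lt1 h2 h3 h23
  have g34 := h.lt1 h3 h4 h34
  have n12 : x1 ≠ x2 := by rintro rfl; exact lt_irrefl _ h12
  have n13 : x1 ≠ x3 := by rintro rfl; exact lt_irrefl _ (h12.trans h23)
  have n42 : x4 ≠ x2 := by rintro rfl; exact lt_irrefl _ (h23.trans h34)
  have n43 : x4 ≠ x3 := by rintro rfl; exact lt_irrefl _ h34
  have n23 : x2 ≠ x3 := by rintro rfl; exact lt_irrefl _ h23
  refine ⟨?_, ?_, ?_, ?_, ?_, ?_, ?_⟩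
  · intro x hx; exact h.RP x (Finset.mem_filter.1 hx).1
  · intro x hx
    simp only [Finset.mem_insert] at hx
    rcases hx with rfl | rfl | hx
    · exact h.RP _ h2
    · exact h.RP _ h3
    · exact h.UP _ hx
  · rintro u v (hE | ⟨rfl, rfl⟩ | ⟨rfl, rfl⟩)
    · exact h.EP u v hE
    · exact ⟨h.RP _ h1, h.RP _ h2⟩
    · exact ⟨h.RP _ h3, h.RP _ h4⟩
  · intro x hx
    rcases h.good x hx with h1 | h1 | ⟨u, v, h1, h2⟩
    · by_cases hx2 : x = x2
      · right; left; simp [hx2]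
      · by_cases hx3 : x = x3
        · right; left; simp [hx3]
        · left; exact Finset.mem_filter.2 ⟨h1, hx2, hx3⟩
    · right; left; simp [h1]
    · exact Or.inr (Or.inr ⟨u, v, Or.inl h1, h2⟩)
  · intro r hr x hx hxr
    refine h.anti r (Finset.mem_filter.1 hr).1 x ?_ hxr
    rcases hx with hx | hx
    · exact Or.inl (Finset.mem_filter.1 hx).1
    · simp only [Finset.mem_insert] at hx
      rcases hx with rfl | rfl | hx
      · exact Or.inl h2
      · exact Or.inl h3
      · exact Or.inr hx
  · intro a b hab
    by_cases hX : inW a b x2 ∨ inW a b x3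
    · refine ⟨x2, x3, ?_⟩
      intro u hu huW
      simp only [Finset.mem_insert] at hu
      rcases hu with rfl | rfl | hu
      · exact Or.inl rfl
      · exact Or.inr rfl
      · exfalso
        have e1 := hab x1 x2 (Or.inr (Or.inl ⟨rfl, rfl⟩))
        have e2 := hab x3 x4 (Or.inr (Or.inr ⟨rfl, rfl⟩))
        have hU' := hU u hu
        unfold inW at *
        grind
    · obtain ⟨t1, t2, ht⟩ := h.two a b (fun u v hE => hab u v (Or.inl hE))
      refine ⟨t1, t2, ?_⟩
      intro u hu huW
      simp only [Finset.mem_insert] at hu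
      rcases hu with rfl | rfl | hu
      · exact absurd (Or.inl huW) hX
      · exact absurd (Or.inr huW) hX
      · exact ht u hu huW
  · intro f
    obtain ⟨c, hc1, hc2⟩ := h.free (fun r => if r = x2 then !f x1 else if r = x3 then !f x4 else f r)
    refine ⟨c, ?_, ?_⟩
    · intro r hr
      rcases Finset.mem_filter.1 hr with ⟨hr, hr2, hr3⟩
      rw [hc1 r hr, if_neg hr2, if_neg hr3]
    · rintro u v (hE | ⟨rfl, rfl⟩ | ⟨rfl, rfl⟩)
      · exact hc2 u v hE
      · rw [hc1 _ h1, hc1 _ h2, if_neg n12, if_neg n13, if_pos rfl]; simp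
      · rw [hc1 _ h3, hc1 _ h4, if_neg n23.symm, if_pos rfl, if_neg n42, if_neg n43]; simp

open Classical in
lemma loop {P : Finset V} (n : ℕ) : ∀ {R U : Finset V} {E : V → V → Prop}, St P R U E →
    R.card ≤ n → ∃ R' U' E', St P R' U' E' ∧ I1 R' U' ∧ ∀ u v, E u v → E' u v := by
  induction n with
  | zero =>
    intro R U E h hn
    refine ⟨R, U, E, h, ?_, fun _ _ h => h⟩
    intro x1 hx1
    rw [Finset.card_eq_zero.1 (Nat.le_zero.1 hn)] at hx1
    simp at hx1
  | succ n ih =>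
    intro R U E h hn
    by_cases hI : I1 R U
    · exact ⟨R, U, E, h, hI, fun _ _ h => h⟩
    · unfold I1 at hI
      push Not at hI
      obtain ⟨x1, h1, x2, h2, x3, h3, x4, h4, h12, h23, h34, hU⟩ := hI
      have h' := step3 h h1 h2 h3 h4 h12 h23 h34
        (fun u hu hc => absurd (hU u hu hc.1) (not_lt.2 hc.2))
      have hc : (R.filter (fun r => r ≠ x2 ∧ r ≠ x3)).card < R.card := by
        apply Finset.card_lt_card
        rw [Finset.filter_ssubset]
        exact ⟨x2, h2, by simp⟩
      obtain ⟨R', U', E', a1, a2, a3⟩ := ih h' (by omega)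
      exact ⟨R', U', E', a1, a2, fun u v hE => a3 u v (Or.inl hE)⟩

lemma four {A : Finset V} (hinj : ∀ x ∈ A, ∀ y ∈ A, x 0 = y 0 → x = y) (hA : 4 ≤ A.card) :
    ∃ x1 ∈ A, ∃ x2 ∈ A, ∃ x3 ∈ A, ∃ x4 ∈ A, x1 0 < x2 0 ∧ x2 0 < x3 0 ∧ x3 0 < x4 0 := by
  have hc : (A.image (fun x => x 0)).card = A.card :=
    Finset.card_image_of_injOn (fun x hx y hy hxy => hinj x hx y hy hxy)
  let e := (A.image (fun x => x 0)).orderEmbOfFin rfl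
  have hm : ∀ i, ∃ x ∈ A, x 0 = e i := by
    intro i
    have := Finset.orderEmbOfFin_mem (A.image (fun x => x 0)) rfl i
    exact Finset.mem_image.1 this
  have hk : 4 ≤ (A.image (fun x => x 0)).card := by omega
  obtain ⟨x1, m1, e1⟩ := hm ⟨0, by omega⟩
  obtain ⟨x2, m2, e2⟩ := hm ⟨1, by omega⟩
  obtain ⟨x3, m3, e3⟩ := hm ⟨2, by omega⟩
  obtain ⟨x4, m4, e4⟩ := hm ⟨3, by omega⟩
  refine ⟨x1, m1, x2, m2, x3, m3, x4, m4, ?_, ?_, ?_⟩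
  · rw [e1, e2]; exact e.strictMono (by simp [Fin.lt_def])
  · rw [e2, e3]; exact e.strictMono (by simp [Fin.lt_def])
  · rw [e3, e4]; exact e.strictMono (by simp [Fin.lt_def])

lemma three {P R U A : Finset V} {E : V → V → Prop} (h : St P R U E) (hI : I1 R U)
    (hA : A ⊆ R) (hU : ∀ x ∈ A, ∀ y ∈ A, ∀ u ∈ U, u 0 ≤ x 0 → u 1 ≤ y 1 → False) :
    A.card ≤ 3 := by
  by_contra hc
  obtain ⟨x1, m1, x2, m2, x3, m3, x4, m4, a, b, c⟩ := four (A := A) (by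
    intro x hx y hy hxy
    rcases le_total (x 1) (y 1) with h1 | h1
    · exact h.anti y (hA hy) x (Or.inl (hA hx)) ⟨hxy.le, h1⟩
    · exact (h.anti x (hA hx) y (Or.inl (hA hy)) ⟨hxy.ge, h1⟩).symm) (by omega)
  obtain ⟨u, hu, hu1, hu2⟩ := hI x1 (hA m1) x2 (hA m2) x3 (hA m3) x4 (hA m4) a b c
  exact hU x4 m4 x1 m1 u hu hu1 hu2

open Classical in
lemma count {P R U : Finset V} {E : V → V → Prop} (h : St P R U E) (hI : I1 R U)
    {a b : ℝ} (hab : EF E a b) : (P.filter (inW a b)).card ≤ 11 := by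
  have hsub : ∀ x ∈ P, inW a b x → x ∈ R ∨ x ∈ U := by
    intro x hx hxW
    rcases h.good x hx with h1 | h1 | ⟨u, v, h1, h2, h3⟩
    · exact Or.inl h1
    · exact Or.inr h1
    · exact (hab u v h1 ⟨h2.1.trans hxW.1, h2.2.trans hxW.2⟩
        ⟨h3.1.trans hxW.1, h3.2.trans hxW.2⟩).elim
  obtain ⟨t1, t2, ht⟩ : ∃ t1 t2 : V, t1 0 ≤ t2 0 ∧ ∀ u ∈ U, inW a b u → u = t1 ∨ u = t2 := by
    obtain ⟨t1, t2, ht⟩ := h.two a b hab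
    rcases le_total (t1 0) (t2 0) with h1 | h1
    · exact ⟨t1, t2, h1, ht⟩
    · exact ⟨t2, t1, h1, fun u hu hw => (ht u hu hw).symm⟩
  obtain ⟨h12, ht⟩ := ht
  by_cases hU : ∀ u ∈ U, ¬ inW a b u
  · have : (P.filter (inW a b)).card ≤ 3 := by
      apply three h hI
      · intro x hx
        rcases Finset.mem_filter.1 hx with ⟨hx, hW⟩
        rcases hsub x hx hW with h1 | h1
        · exact h1
        · exact absurd hW (hU x h1)
      · intro x hx y hy u hu h1 h2
        exact hU u hu ⟨h1.trans (Finset.mem_filter.1 hx).2.1, h2.trans (Finset.mem_filter.1 hy).2.2⟩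
    omega
  · obtain ⟨t1, t2, h12, ht, hU1, hU2⟩ : ∃ t1 t2 : V, t1 0 ≤ t2 0 ∧
        (∀ u ∈ U, inW a b u → u = t1 ∨ u = t2) ∧ t1 ∈ U ∧ t2 ∈ U := by
      push Not at hU
      obtain ⟨u, hu, huW⟩ := hU
      by_cases k1 : t1 ∈ U
      · by_cases k2 : t2 ∈ U
        · exact ⟨t1, t2, h12, ht, k1, k2⟩
        · refine ⟨t1, t1, le_rfl, ?_, k1, k1⟩
          intro v hv hvW
          rcases ht v hv hvW with rfl | rfl
          · exact Or.inl rfl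
          · exact absurd hv k2
      · have key : ∀ v ∈ U, inW a b v → v = t2 := by
          intro v hv hvW
          rcases ht v hv hvW with rfl | rfl
          · exact absurd hv k1
          · rfl
        have k2 : t2 ∈ U := key u hu huW ▸ hu
        exact ⟨t2, t2, le_rfl, fun v hv hw => Or.inl (key v hv hw), k2, k2⟩
    let Q := R.filter (inW a b)
    let A := Q.filter (fun q => q 0 < t1 0)
    let B := Q.filter (fun q => q 0 < t2 0 ∧ q 1 < t1 1)
    let C := Q.filter (fun q => q 1 < t1 1 ∧ q 1 < t2 1)
    have mQ : ∀ x ∈ Q, x ∈ R ∧ inW a b x := fun x hx => Finset.mem_filter.1 hx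
    have hQ : ∀ x ∈ Q, ∀ y ∈ Q, ∀ u ∈ U, u 0 ≤ x 0 → u 1 ≤ y 1 → u = t1 ∨ u = t2 := by
      intro x hx y hy u hu h1 h2
      exact ht u hu ⟨h1.trans (mQ x hx).2.1, h2.trans (mQ y hy).2.2⟩
    have cA : A.card ≤ 3 := by
      apply three h hI
      · intro x hx; exact (mQ x (Finset.mem_filter.1 hx).1).1
      · intro x hx y hy u hu h1 h2
        rcases Finset.mem_filter.1 hx with ⟨hx, kx⟩
        rcases Finset.mem_filter.1 hy with ⟨hy, ky⟩
        rcases hQ x hx y hy u hu h1 h2 with rfl | rfl <;> linarith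
    have cB : B.card ≤ 3 := by
      apply three h hI
      · intro x hx; exact (mQ x (Finset.mem_filter.1 hx).1).1
      · intro x hx y hy u hu h1 h2
        rcases Finset.mem_filter.1 hx with ⟨hx, kx, kx'⟩
        rcases Finset.mem_filter.1 hy with ⟨hy, ky, ky'⟩
        rcases hQ x hx y hy u hu h1 h2 with rfl | rfl <;> linarith
    have cC : C.card ≤ 3 := by
      apply three h hI
      · intro x hx; exact (mQ x (Finset.mem_filter.1 hx).1).1
      · intro x hx y hy u hu h1 h2
        rcases Finset.mem_filter.1 hx with ⟨hx, kx, kx'⟩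
        rcases Finset.mem_filter.1 hy with ⟨hy, ky, ky'⟩
        rcases hQ x hx y hy u hu h1 h2 with rfl | rfl <;> linarith
    have hcov : P.filter (inW a b) ⊆ ({t1, t2} : Finset V) ∪ (A ∪ (B ∪ C)) := by
      intro x hx
      rcases Finset.mem_filter.1 hx with ⟨hx, hW⟩
      by_cases hxU : x ∈ U
      · have := ht x hxU hW
        apply Finset.mem_union_left
        simpa using this
      · have hxR : x ∈ R := (hsub x hx hW).resolve_right hxU
        have hxQ : x ∈ Q := Finset.mem_filter.2 ⟨hxR, hW⟩
        have n1 : ¬ le2 t1 x := fun hl => hxU ((h.anti x hxR t1 (Or.inr hU1) hl) ▸ hU1)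
        have n2 : ¬ le2 t2 x := fun hl => hxU ((h.anti x hxR t2 (Or.inr hU2) hl) ▸ hU2)
        apply Finset.mem_union_right
        simp only [A, B, C, Finset.mem_union, Finset.mem_filter]
        unfold le2 at n1 n2
        grind
    have c2 : ({t1, t2} : Finset V).card ≤ 2 := Finset.card_le_two
    have := Finset.card_le_card hcov
    have u1 := Finset.card_union_le ({t1, t2} : Finset V) (A ∪ (B ∪ C))
    have u2 := Finset.card_union_le A (B ∪ C)
    have u3 := Finset.card_union_le B C
    omega

open Classical in
lemma main (P : Finset V) : ∃ R U E, St P R U E ∧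
    ∀ a : V, 12 ≤ (P.filter (· ∈ Octant a)).card → ∃ u v, E u v ∧ u ∈ Octant a ∧ v ∈ Octant a := by
  induction P using Finset.induction_on_max_value (fun x : V => x 2) with
  | empty =>
    refine ⟨∅, ∅, fun _ _ => False, ?_, by simp⟩
    refine ⟨by simp, by simp, by simp, by simp, by simp, fun a b _ => ⟨0, 0, by simp⟩, ?_⟩
    intro f; exact ⟨f, by simp, by simp⟩
  | insert p P hp hmax ih =>
    obtain ⟨R, U, E, h, H⟩ := ih
    have hs : ∃ R' U' E', St (insert p P) R' U' E' ∧ ∀ u v, E u v → E' u v := by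
      by_cases hq : ∃ q ∈ P, le2 q p
      · obtain ⟨q, hq, hqp⟩ := hq
        exact ⟨_, _, _, step1 h hp hq hqp, fun u v => Or.inl⟩
      · push Not at hq
        exact ⟨_, _, _, step2 h hp hq, fun u v => Or.inl⟩
    obtain ⟨R1, U1, E1, h1, hE1⟩ := hs
    obtain ⟨R2, U2, E2, h2, hI, hE2⟩ := loop _ h1 le_rfl
    refine ⟨R2, U2, E2, h2, ?_⟩
    intro a ha
    by_cases hpa : p ∈ Octant a
    · have hz : ∀ x ∈ insert p P, inW (a 0) (a 1) x → x ∈ Octant a := by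
        intro x hx hW
        refine ⟨hW.1, hW.2, ?_⟩
        rcases Finset.mem_insert.1 hx with rfl | hx
        · exact hpa.2.2
        · exact (hmax x hx).trans hpa.2.2
      by_contra hcon
      have hEF : EF E2 (a 0) (a 1) := by
        intro u v hE hu hv
        exact hcon ⟨u, v, hE, hz u (h2.EP u v hE).1 hu, hz v (h2.EP u v hE).2 hv⟩
      have hc := count h2 hI hEF
      have : ((insert p P).filter (· ∈ Octant a)).card ≤
          ((insert p P).filter (inW (a 0) (a 1))).card := by
        apply Finset.card_le_card
        intro x hx
        rcases Finset.mem_filter.1 hx with ⟨hx, hO⟩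
        exact Finset.mem_filter.2 ⟨hx, hO.1, hO.2.1⟩
      omega
    · rw [Finset.filter_insert, if_neg hpa] at ha
      obtain ⟨u, v, hE, hu⟩ := H a ha
      exact ⟨u, v, hE2 u v (hE1 u v hE), hu⟩

end OctPf

/-- Any finite point set in `ℝ³` has a 2-coloring such that every translate of the
octant containing at least 12 of the points contains both colors. -/
theorem octant_two_coloring (S : Set (Fin 3 → ℝ)) (hS : S.Finite) :
    ∃ c : S → Bool, ∀ a : Fin 3 → ℝ,
      12 ≤ (S ∩ Octant a).ncard →
      ∀ b : Bool, ∃ x : S, (x : Fin 3 → ℝ) ∈ Octant a ∧ c x = b := by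
  classical
  obtain ⟨R, U, E, h, H⟩ := OctPf.main hS.toFinset
  obtain ⟨c, -, hc⟩ := h.free (fun _ => true)
  refine ⟨fun x => c x, ?_⟩
  intro a ha b
  have hset : S ∩ Octant a = ((hS.toFinset.filter (· ∈ Octant a) : Finset (Fin 3 → ℝ)) :
      Set (Fin 3 → ℝ)) := by
    ext x; simp
  rw [hset, Set.ncard_coe_finset] at ha
  obtain ⟨u, v, hE, hu, hv⟩ := H a ha
  have huS : u ∈ S := by simpa using (h.EP u v hE).1
  have hvS : v ∈ S := by simpa using (h.EP u v hE).2
  have hne := hc u v hE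
  by_cases hb : c u = b
  · exact ⟨⟨u, huS⟩, hu, hb⟩
  · refine ⟨⟨v, hvS⟩, hv, ?_⟩
    show c v = b
    revert hne hb
    cases c u <;> cases c v <;> cases b <;> simp
end
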